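/- Let λ, μ ∈ ℝ with μ > 0 and 3λ + 2μ > 0, and let r₀, E₀ > 0, D₀ > 1. There exist R ≥ 3D₀ depending only on λ, μ, r₀, E₀, D₀, a number s > 1 depending only on λ, μ, E₀, and constants a, b, c > 0 depending only on λ, μ, r₀, E₀, D₀, such that for every C³ cavity C with parameters r₀, E₀, D₀, every p > 0, every normalized solution w of the cavity problem in Ω = ℝ³₋ \ C̄, every ϱ > 0, and every point x̄ ∈ B⁻_R(0) \ C with dist(x̄, ∂(B⁻_R(0) \ C)) > sϱ, one has ∫_{B_ϱ(x̄)} |∇̂w|² dx ≥ c e^{−a ϱ^{−b}} ∫_{B⁻_R(0)\C} |∇̂w|² dx. -/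

import Mathlib

open MeasureTheory Metric Set

noncomputable section

abbrev E3 := EuclideanSpace ℝ (Fin 3)
abbrev E2 := EuclideanSpace ℝ (Fin 2)

/-- The open lower half-space `{x : x₃ < 0}`. -/
def lowerHalf : Set E3 := {x | x 2 < 0}

/-- The lower half-ball `B⁻_r(0) = {|x| < r, x₃ < 0}`. -/
def negBall (r : ℝ) : Set E3 := {x | ‖x‖ < r ∧ x 2 < 0}

/-- Jacobian matrix of a vector field: `(jac u x) i j = ∂uᵢ/∂xⱼ (x)`. -/
def jac (u : E3 → E3) (x : E3) : Matrix (Fin 3) (Fin 3) ℝ :=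
  fun i j => fderiv ℝ u x (EuclideanSpace.single j 1) i

/-- Symmetric part of the Jacobian (strain tensor) `∇̂u`. -/
def strain (u : E3 → E3) (x : E3) : Matrix (Fin 3) (Fin 3) ℝ :=
  fun i j => (jac u x i j + jac u x j i) / 2

/-- Squared Frobenius norm of a 3×3 matrix. -/
def frob2 (M : Matrix (Fin 3) (Fin 3) ℝ) : ℝ := ∑ i, ∑ j, (M i j)^2

/-- Divergence of a vector field. -/
def divg (u : E3 → E3) (x : E3) : ℝ := ∑ i, jac u x i i

/-- Projection on the first two coordinates. -/
def proj12 (x : E3) : E2 :=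
  (x 0) • EuclideanSpace.single 0 1 + (x 1) • EuclideanSpace.single 1 1

/-- Embedding of the plane `{x₃ = 0}` into `ℝ³`: `x' ↦ (x'₁, x'₂, 0)`. -/
def emb2 (x' : E2) : E3 :=
  (x' 0) • EuclideanSpace.single 0 1 + (x' 1) • EuclideanSpace.single 1 1

/-- Partial derivative of a scalar field in the k-th coordinate direction. -/
def pd (f : E3 → ℝ) (k : Fin 3) (x : E3) : ℝ := fderiv ℝ f x (EuclideanSpace.single k 1)

/-- `S` has boundary of Lipschitz class with constants r₀, E₀: at each boundary point `P`,
after a rigid change of coordinates sending `P` to `0`, the set is locally the open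
epigraph of a Lipschitz function `ψ` with `ψ 0 = 0` and Lipschitz constant at most `E₀`. -/
def HasLipschitzBoundary (r₀ E₀ : ℝ) (S : Set E3) : Prop :=
  ∀ P ∈ frontier S, ∃ (φ : E3 ≃ᵢ E3) (ψ : E2 → ℝ),
    φ P = 0 ∧ ψ 0 = 0 ∧ LipschitzOnWith (Real.toNNReal E₀) ψ (Metric.ball 0 r₀) ∧
    (φ '' S) ∩ Metric.ball 0 r₀ = {x ∈ Metric.ball (0 : E3) r₀ | ψ (proj12 x) < x 2}

/-- `S` has boundary of class C³ with constants r₀, E₀. -/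
def HasC3Boundary (r₀ E₀ : ℝ) (S : Set E3) : Prop :=
  ∀ P ∈ frontier S, ∃ (φ : E3 ≃ᵢ E3) (ψ : E2 → ℝ),
    φ P = 0 ∧ ψ 0 = 0 ∧ ContDiff ℝ 3 ψ ∧ fderiv ℝ ψ 0 = 0 ∧
    (∀ x' ∈ Metric.ball (0 : E2) r₀, ∀ k : ℕ, k ≤ 3 → ‖iteratedFDeriv ℝ k ψ x'‖ ≤ E₀) ∧
    (φ '' S) ∩ Metric.ball 0 r₀ = {x ∈ Metric.ball (0 : E3) r₀ | ψ (proj12 x) < x 2}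

/-- Geometric a priori assumptions on a cavity: bounded open set, closure inside the lower
half-space, connected complement in the half-space, contained in `B⁻_{2D₀}(0)`, at distance
at least `D₀` from the plane `{x₃ = 0}`, with diameter less than `D₀`. -/
def IsCavity (D₀ : ℝ) (C : Set E3) : Prop :=
  IsOpen C ∧ Bornology.IsBounded C ∧ closure C ⊆ lowerHalf ∧
  IsConnected (lowerHalf \ closure C) ∧ C ⊆ negBall (2*D₀) ∧
  (∀ x ∈ C, x 2 ≤ -D₀) ∧ Metric.diam C < D₀

/-- Lipschitz cavity with parameters r₀, E₀, D₀. -/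
def IsLipschitzCavity (r₀ E₀ D₀ : ℝ) (C : Set E3) : Prop :=
  IsCavity D₀ C ∧ HasLipschitzBoundary r₀ E₀ C

/-- C³ cavity with parameters r₀, E₀, D₀. -/
def IsC3Cavity (r₀ E₀ D₀ : ℝ) (C : Set E3) : Prop :=
  IsCavity D₀ C ∧ HasC3Boundary r₀ E₀ C

/-- Normalized solution `w = u − ū` of the cavity problem (with `ū(x) = (p/(3λ+2μ)) x`):
`w` is continuous up to the boundary plane, C¹ on `Ω = ℝ³₋ \ C̄`, `w + ū` lies in the
weighted class, and `w` satisfies the variational identity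
`∫_Ω ℂ∇̂w : ∇̂v = −p ∫_{ℝ²} v₃(x₁,x₂,0) dx₁dx₂` for all smooth compactly supported `v`. -/
def IsNormalizedSolution (lam mu p : ℝ) (C : Set E3) (w : E3 → E3) : Prop :=
  ContinuousOn w ({x : E3 | x 2 ≤ 0} \ closure C) ∧
  ContDiffOn ℝ 1 w (lowerHalf \ closure C) ∧
  IntegrableOn (fun x => ‖w x + (p / (3*lam+2*mu)) • x‖^2 / (1 + ‖x‖^2)) (lowerHalf \ closure C) ∧
  IntegrableOn
    (fun x => frob2 (fun i j => jac w x i j + (p/(3*lam+2*mu)) * (if i = j then 1 else 0)))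
    (lowerHalf \ closure C) ∧
  ∀ v : E3 → E3, ContDiff ℝ (⊤ : ℕ∞) v → HasCompactSupport v →
    ∫ x in lowerHalf \ closure C,
        (lam * divg w x * divg v x + 2 * mu * ∑ i, ∑ j, strain w x i j * strain v x i j)
      = -p * ∫ x' : E2, v (emb2 x') 2


set_option linter.unusedVariables false

open scoped ContDiff

/-! ### Calculus with directional derivatives -/

/-- Directional derivative. -/
def DD (d : E3) (f : E3 → ℝ) (x : E3) : ℝ := fderiv ℝ f x d

/-- Basis vector. -/
abbrev ee (k : Fin 3) : E3 := EuclideanSpace.single k 1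

/-- Laplacian. -/
def lapl (f : E3 → ℝ) (x : E3) : ℝ := ∑ k, DD (ee k) (DD (ee k) f) x

lemma DD_contDiffOn {f : E3 → ℝ} {U : Set E3} (hU : IsOpen U) (hf : ContDiffOn ℝ ∞ f U) (d : E3) :
    ContDiffOn ℝ ∞ (DD d f) U := by
  have h := hf.fderiv_of_isOpen hU (m := ∞) (by simp)
  exact h.clm_apply contDiffOn_const

lemma DD_contDiff {f : E3 → ℝ} (hf : ContDiff ℝ ∞ f) (d : E3) : ContDiff ℝ ∞ (DD d f) :=
  (hf.fderiv_right (m := ∞) (by simp)).clm_apply contDiff_const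

lemma DD_continuousOn {f : E3 → ℝ} {U : Set E3} (hU : IsOpen U) (hf : ContDiffOn ℝ 1 f U) (d : E3) :
    ContinuousOn (DD d f) U := by
  have h := hf.continuousOn_fderiv_of_isOpen hU (by simp)
  exact h.clm_apply continuousOn_const

lemma lapl_contDiff {f : E3 → ℝ} (hf : ContDiff ℝ ∞ f) : ContDiff ℝ ∞ (lapl f) := by
  unfold lapl
  exact ContDiff.sum fun k _ => DD_contDiff (DD_contDiff hf _) _

lemma DD_comm {f : E3 → ℝ} (hf : ContDiff ℝ ∞ f) (a b : E3) : DD a (DD b f) = DD b (DD a f) := by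
  have key : ∀ (a b x : E3), DD a (DD b f) x = fderiv ℝ (fderiv ℝ f) x a b := by
    intro a b x
    have h1 : DifferentiableAt ℝ (fderiv ℝ f) x :=
      ((hf.fderiv_right (m := ∞) (by simp)).differentiable (by simp)) x
    unfold DD
    rw [fderiv_clm_apply h1 (differentiableAt_const b)]
    simp
  funext x
  rw [key, key]
  have := (hf.contDiffAt (x := x)).isSymmSndFDerivAt (by simp; exact WithTop.coe_le_coe.2 (le_top (a := (2 : ℕ∞))))
  exact this a b

lemma DD_add {f g : E3 → ℝ} (hf : ContDiff ℝ ∞ f) (hg : ContDiff ℝ ∞ g) (d : E3) :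
    DD d (fun x => f x + g x) = fun x => DD d f x + DD d g x := by
  funext x
  unfold DD
  rw [fderiv_fun_add (hf.differentiable (by simp) x) (hg.differentiable (by simp) x)]
  rfl

lemma DD_sub {f g : E3 → ℝ} (hf : ContDiff ℝ ∞ f) (hg : ContDiff ℝ ∞ g) (d : E3) :
    DD d (fun x => f x - g x) = fun x => DD d f x - DD d g x := by
  funext x
  unfold DD
  rw [fderiv_fun_sub (hf.differentiable (by simp) x) (hg.differentiable (by simp) x)]
  rfl

lemma DD_sum {ι : Type*} (s : Finset ι) {f : ι → E3 → ℝ} (hf : ∀ i, ContDiff ℝ ∞ (f i)) (d : E3) :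
    DD d (fun x => ∑ i ∈ s, f i x) = fun x => ∑ i ∈ s, DD d (f i) x := by
  funext x
  unfold DD
  rw [fderiv_fun_sum (fun i _ => (hf i).differentiable (by simp) x)]
  simp

lemma DD_const_mul {f : E3 → ℝ} (hf : ContDiff ℝ ∞ f) (c : ℝ) (d : E3) :
    DD d (fun x => c * f x) = fun x => c * DD d f x := by
  funext x
  unfold DD
  rw [fderiv_const_mul (hf.differentiable (by simp) x)]
  rfl

lemma DD_lapl {f : E3 → ℝ} (hf : ContDiff ℝ ∞ f) (d : E3) : DD d (lapl f) = lapl (DD d f) := by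
  have : lapl f = fun x => ∑ k, DD (ee k) (DD (ee k) f) x := rfl
  rw [this, DD_sum _ (fun k => DD_contDiff (DD_contDiff hf _) _)]
  funext x
  unfold lapl
  refine Finset.sum_congr rfl fun k _ => ?_
  rw [DD_comm (DD_contDiff hf _), DD_comm hf]

lemma lapl_sub {f g : E3 → ℝ} (hf : ContDiff ℝ ∞ f) (hg : ContDiff ℝ ∞ g) :
    lapl (fun x => f x - g x) = fun x => lapl f x - lapl g x := by
  funext x
  unfold lapl
  rw [← Finset.sum_sub_distrib]
  refine Finset.sum_congr rfl fun k _ => ?_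
  rw [DD_sub hf hg, DD_sub (DD_contDiff hf _) (DD_contDiff hg _)]

lemma DD_tsupport (f : E3 → ℝ) (d : E3) : tsupport (DD d f) ⊆ tsupport f := by
  refine (closure_mono ?_).trans (tsupport_fderiv_subset ℝ (f := f))
  intro x hx h
  apply hx
  unfold DD
  rw [h]; rfl

lemma DD_hcs {f : E3 → ℝ} (hf : HasCompactSupport f) (d : E3) : HasCompactSupport (DD d f) :=
  hf.mono' ((subset_tsupport _).trans (DD_tsupport f d))

lemma lapl_tsupport (f : E3 → ℝ) : tsupport (lapl f) ⊆ tsupport f := by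
  refine closure_minimal ?_ isClosed_closure
  intro x hx
  by_contra h
  apply hx
  unfold lapl
  refine Finset.sum_eq_zero fun k _ => ?_
  by_contra h2
  exact h (((DD_tsupport _ _).trans (DD_tsupport _ _)) (subset_tsupport _ h2))

lemma lapl_hcs {f : E3 → ℝ} (hf : HasCompactSupport f) : HasCompactSupport (lapl f) :=
  hf.mono' ((subset_tsupport _).trans (lapl_tsupport f))

/-- Product of a function continuous on an open set with a function compactly supported in it. -/
lemma cont_mul_of_tsupport {f φ : E3 → ℝ} {U : Set E3} (hU : IsOpen U) (hf : ContinuousOn f U)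
    (hφ : Continuous φ) (hs : tsupport φ ⊆ U) : Continuous (fun x => f x * φ x) := by
  refine continuous_of_tsupport fun x hx => ?_
  have hx' : x ∈ tsupport φ := by
    refine closure_mono ?_ hx
    intro y hy h
    exact hy (by simp [h])
  exact ((hf x (hs hx')).continuousAt (hU.mem_nhds (hs hx'))).mul hφ.continuousAt

lemma integrable_mul_of_tsupport {f φ : E3 → ℝ} {U : Set E3} (hU : IsOpen U) (hf : ContinuousOn f U)
    (hφ : Continuous φ) (hc : HasCompactSupport φ) (hs : tsupport φ ⊆ U) :
    Integrable (fun x => f x * φ x) :=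
  (cont_mul_of_tsupport hU hf hφ hs).integrable_of_hasCompactSupport hc.mul_left

/-- Integration by parts on an open set. -/
lemma ibp {f φ : E3 → ℝ} {U : Set E3} (hU : IsOpen U) (hf : ContDiffOn ℝ 1 f U)
    (hφ : ContDiff ℝ ∞ φ) (hc : HasCompactSupport φ) (hs : tsupport φ ⊆ U) (d : E3) :
    ∫ x, f x * DD d φ x = - ∫ x, DD d f x * φ x := by
  refine integral_mul_fderiv_eq_neg_fderiv_mul_of_integrable ?_ ?_ ?_ ?_ ?_
  · exact integrable_mul_of_tsupport hU (DD_continuousOn hU hf d) hφ.continuous hc hs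
  · exact integrable_mul_of_tsupport hU hf.continuousOn (DD_contDiff hφ d).continuous (DD_hcs hc d)
      ((DD_tsupport φ d).trans hs)
  · exact integrable_mul_of_tsupport hU hf.continuousOn hφ.continuous hc hs
  · intro x hx
    exact (hf.differentiableOn (by simp)).differentiableAt (hU.mem_nhds (hs hx))
  · intro x _
    exact hφ.differentiable (by simp) x

/-- Continuous weakly biharmonic functions on an open set. -/
def WB (f : E3 → ℝ) (U : Set E3) : Prop :=
  ContinuousOn f U ∧ ∀ φ : E3 → ℝ, ContDiff ℝ ∞ φ → HasCompactSupport φ → tsupport φ ⊆ U →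
    ∫ x, f x * lapl (lapl φ) x = 0

lemma WB.mono {f : E3 → ℝ} {U V : Set E3} (h : WB f U) (hV : V ⊆ U) : WB f V :=
  ⟨h.1.mono hV, fun φ h1 h2 h3 => h.2 φ h1 h2 (h3.trans hV)⟩

lemma WB.DD {f : E3 → ℝ} {U : Set E3} (hU : IsOpen U) (h : WB f U) (hf : ContDiffOn ℝ 1 f U)
    (d : E3) : WB (DD d f) U := by
  refine ⟨DD_continuousOn hU hf d, fun φ h1 h2 h3 => ?_⟩
  have e := ibp hU hf (lapl_contDiff (lapl_contDiff h1)) (lapl_hcs (lapl_hcs h2))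
    ((lapl_tsupport _).trans ((lapl_tsupport _).trans h3)) d
  rw [DD_lapl (lapl_contDiff h1), DD_lapl h1,
    h.2 _ (DD_contDiff h1 d) (DD_hcs h2 d) ((DD_tsupport φ d).trans h3)] at e
  linarith


/-! ### The biharmonic kernel -/

/-- Smooth function on the line equal to the square root on `[1,∞)`. -/
def hk (t : ℝ) : ℝ := Real.smoothTransition (2 * t - 1) * Real.sqrt t

lemma hk_contDiff : ContDiff ℝ ∞ hk := by
  rw [contDiff_iff_contDiffAt]
  intro t
  rcases lt_or_ge t (1/2) with h | h
  · have : hk =ᶠ[nhds t] fun _ => 0 := by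
      filter_upwards [Iio_mem_nhds h] with s hs
      have : (2 * s - 1) ≤ 0 := by simp at hs; linarith
      simp [hk, Real.smoothTransition.zero_of_nonpos this]
    exact contDiffAt_const.congr_of_eventuallyEq this
  · have h1 : ContDiffAt ℝ ∞ (fun t : ℝ => Real.smoothTransition (2 * t - 1)) t := by
      have : ContDiff ℝ ∞ (fun t : ℝ => Real.smoothTransition (2 * t - 1)) :=
        Real.smoothTransition.contDiff.comp (by fun_prop)
      exact this.contDiffAt
    exact h1.mul (Real.contDiffAt_sqrt (by linarith))

lemma hk_eq {t : ℝ} (ht : 1 ≤ t) : hk t = Real.sqrt t := by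
  simp [hk, Real.smoothTransition.one_of_one_le (show 1 ≤ 2 * t - 1 by linarith)]

/-- Radial Laplacian in the variable `t = |x|^2`. -/
def LL (k : ℝ → ℝ) (t : ℝ) : ℝ := 4 * t * deriv (deriv k) t + 6 * deriv k t

lemma deriv_smooth {k : ℝ → ℝ} (hk : ContDiff ℝ ∞ k) : ContDiff ℝ ∞ (deriv k) := by
  exact (contDiff_infty_iff_deriv.1 hk).2

lemma LL_contDiff {k : ℝ → ℝ} (hk : ContDiff ℝ ∞ k) : ContDiff ℝ ∞ (LL k) := by
  have h1 := deriv_smooth hk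
  have h2 := deriv_smooth h1
  unfold LL
  fun_prop

lemma radial_contDiff {k : ℝ → ℝ} (hk : ContDiff ℝ ∞ k) :
    ContDiff ℝ ∞ (fun x : E3 => k (‖x‖^2)) :=
  hk.comp (contDiff_norm_sq ℝ)

lemma DD_radial {k : ℝ → ℝ} (hk : ContDiff ℝ ∞ k) (i : Fin 3) :
    DD (ee i) (fun x : E3 => k (‖x‖^2)) = fun x => 2 * x i * deriv k (‖x‖^2) := by
  funext x
  have h1 : HasFDerivAt (fun x : E3 => ‖x‖^2) (2 • innerSL ℝ x) x := (hasStrictFDerivAt_norm_sq x).hasFDerivAt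
  have h2 : HasDerivAt k (deriv k (‖x‖^2)) (‖x‖^2) := (hk.differentiable (by simp) _).hasDerivAt
  have := (h2.comp_hasFDerivAt x h1).fderiv
  unfold DD
  have e : (fun x : E3 => k (‖x‖^2)) = k ∘ (fun x : E3 => ‖x‖^2) := rfl
  rw [e, this]
  simp [EuclideanSpace.inner_single_right]
  ring

lemma DD_coord (i : Fin 3) (x d : E3) : DD d (fun x : E3 => x i) x = d i := by
  have : HasFDerivAt (fun x : E3 => x i) (EuclideanSpace.proj i : E3 →L[ℝ] ℝ) x :=
    (EuclideanSpace.proj i : E3 →L[ℝ] ℝ).hasFDerivAt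
  unfold DD
  rw [this.fderiv]
  rfl

lemma coord_contDiff (i : Fin 3) : ContDiff ℝ ∞ (fun x : E3 => x i) :=
  (EuclideanSpace.proj i : E3 →L[ℝ] ℝ).contDiff

lemma DD_mul {f g : E3 → ℝ} (hf : ContDiff ℝ ∞ f) (hg : ContDiff ℝ ∞ g) (d : E3) :
    DD d (fun x => f x * g x) = fun x => f x * DD d g x + DD d f x * g x := by
  funext x
  unfold DD
  rw [fderiv_fun_mul (hf.differentiable (by simp) x) (hg.differentiable (by simp) x)]
  simp
  ring

lemma lapl_radial {k : ℝ → ℝ} (hk : ContDiff ℝ ∞ k) :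
    lapl (fun x : E3 => k (‖x‖^2)) = fun x => LL k (‖x‖^2) := by
  funext x
  unfold lapl
  have h1 := deriv_smooth hk
  have key : ∀ i : Fin 3, DD (ee i) (DD (ee i) (fun x : E3 => k (‖x‖^2))) x
      = 4 * (x i)^2 * deriv (deriv k) (‖x‖^2) + 2 * deriv k (‖x‖^2) := by
    intro i
    rw [DD_radial hk, DD_mul (contDiff_const.mul (coord_contDiff i)) (radial_contDiff h1),
      DD_radial h1, DD_const_mul (coord_contDiff i)]
    simp only [DD_coord]
    simp
    ring
  simp only [key]
  unfold LL
  rw [EuclideanSpace.norm_sq_eq]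
  simp [Fin.sum_univ_three]
  ring

lemma LL_hk {t : ℝ} (ht : 1 < t) : LL hk t = 2 / Real.sqrt t := by
  have h0 : ∀ s : ℝ, 1 < s → deriv hk s = 1 / (2 * Real.sqrt s) := by
    intro s hs
    have : hk =ᶠ[nhds s] Real.sqrt := by
      filter_upwards [Ioi_mem_nhds hs] with r hr using hk_eq (le_of_lt hr)
    rw [this.deriv_eq, (Real.hasDerivAt_sqrt (by linarith)).deriv]
  have h1 : deriv (deriv hk) t = - 1 / (4 * t * Real.sqrt t) := by
    have : deriv hk =ᶠ[nhds t] fun s => 1 / (2 * Real.sqrt s) := by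
      filter_upwards [Ioi_mem_nhds ht] with r hr using h0 r hr
    rw [this.deriv_eq]
    have hs : 0 < Real.sqrt t := Real.sqrt_pos.2 (by linarith)
    have h := (((Real.hasDerivAt_sqrt (show t ≠ 0 by linarith)).const_mul 2).inv (by positivity)).deriv
    have e : (fun s => 1 / (2 * Real.sqrt s)) = (fun s => 2 * Real.sqrt s)⁻¹ := by
      funext s; simp
    rw [e, h]
    have h2 : Real.sqrt t ^ 2 = t := Real.sq_sqrt (by linarith)
    have ht0 : 0 < t := by linarith
    field_simp
    rw [h2]; norm_num
  unfold LL
  rw [h0 t ht, h1]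
  have hs : 0 < Real.sqrt t := Real.sqrt_pos.2 (by linarith)
  have h2 : Real.sqrt t ^ 2 = t := Real.sq_sqrt (by linarith)
  have ht0 : 0 < t := by linarith
  field_simp
  norm_num

lemma deriv_LL_hk {t : ℝ} (ht : 1 < t) : deriv (LL hk) t = - 1 / (t * Real.sqrt t) := by
  have : LL hk =ᶠ[nhds t] fun s => 2 / Real.sqrt s := by
    filter_upwards [Ioi_mem_nhds ht] with r hr using LL_hk hr
  rw [this.deriv_eq]
  have hs : 0 < Real.sqrt t := Real.sqrt_pos.2 (by linarith)
  have h := (((Real.hasDerivAt_sqrt (show t ≠ 0 by linarith))).inv (by positivity)).const_mul 2 |>.deriv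
  have e : (fun s => 2 / Real.sqrt s) = (fun s => 2 * (Real.sqrt)⁻¹ s) := by
    funext s; simp [div_eq_mul_inv]
  rw [e, h]
  have h2 : Real.sqrt t ^ 2 = t := Real.sq_sqrt (by linarith)
  have ht0 : 0 < t := by linarith
  field_simp
  rw [h2]

lemma deriv2_LL_hk {t : ℝ} (ht : 1 < t) : deriv (deriv (LL hk)) t = 3 / (2 * t^2 * Real.sqrt t) := by
  have : deriv (LL hk) =ᶠ[nhds t] fun s => - 1 / (s * Real.sqrt s) := by
    filter_upwards [Ioi_mem_nhds ht] with r hr using deriv_LL_hk hr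
  rw [this.deriv_eq]
  have hs : 0 < Real.sqrt t := Real.sqrt_pos.2 (by linarith)
  have ht0 : 0 < t := by linarith
  have h := (((hasDerivAt_id t).mul (Real.hasDerivAt_sqrt (show t ≠ 0 by linarith))).inv
    (by simp; constructor <;> positivity)).neg.deriv
  have e : (fun s => - 1 / (s * Real.sqrt s)) = -(id * Real.sqrt)⁻¹ := by
    funext s; simp [div_eq_mul_inv]
  rw [e, h]
  have h2 : Real.sqrt t ^ 2 = t := Real.sq_sqrt (by linarith)
  simp
  field_simp
  rw [h2]; ring

lemma LLLL_hk {t : ℝ} (ht : 1 < t) : LL (LL hk) t = 0 := by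
  unfold LL
  have := deriv2_LL_hk ht
  have h3 := deriv_LL_hk ht
  unfold LL at this h3
  rw [this, h3]
  have hs : 0 < Real.sqrt t := Real.sqrt_pos.2 (by linarith)
  have ht0 : 0 < t := by linarith
  field_simp
  norm_num

/-- The smooth function `H`, equal to `|x|` outside the unit ball. -/
def HH (x : E3) : ℝ := hk (‖x‖^2)

/-- The (unnormalized) reproducing kernel. -/
def rk (x : E3) : ℝ := LL (LL hk) (‖x‖^2)

lemma HH_contDiff : ContDiff ℝ ∞ HH := radial_contDiff hk_contDiff

lemma rk_contDiff : ContDiff ℝ ∞ rk := radial_contDiff (LL_contDiff (LL_contDiff hk_contDiff))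

lemma HH_eq {x : E3} (hx : 1 ≤ ‖x‖) : HH x = ‖x‖ := by
  unfold HH
  rw [hk_eq (by nlinarith), Real.sqrt_sq (by linarith)]

lemma lapl2_HH : lapl (lapl HH) = rk := by
  have : HH = fun x : E3 => hk (‖x‖^2) := rfl
  rw [this, lapl_radial hk_contDiff, lapl_radial (LL_contDiff hk_contDiff)]
  rfl

lemma rk_zero {x : E3} (hx : 1 < ‖x‖) : rk x = 0 := LLLL_hk (by nlinarith)

lemma rk_tsupport : tsupport rk ⊆ closedBall 0 1 := by
  refine closure_minimal ?_ isClosed_closedBall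
  intro x hx
  by_contra h
  simp at h
  exact hx (rk_zero h)

lemma rk_hcs : HasCompactSupport rk :=
  HasCompactSupport.of_support_subset_isCompact (isCompact_closedBall 0 1)
    ((subset_tsupport _).trans rk_tsupport)

lemma rk_integral_ne : ∫ x, rk x ≠ 0 := by
  have h1 := integral_fun_norm_addHaar (volume : Measure E3) (fun r => LL (LL hk) (r^2))
  have e0 : ∫ x, rk x = ∫ x : E3, (fun r => LL (LL hk) (r^2)) ‖x‖ := rfl
  rw [e0, h1]
  have hsm := LL_contDiff hk_contDiff
  have hsm1 := deriv_smooth hsm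
  have key : ∫ y in Ioi (0:ℝ), y^2 * LL (LL hk) (y^2) = -2 := by
    have e1 : ∫ y in Ioi (0:ℝ), y^2 * LL (LL hk) (y^2) = ∫ y in Ioc (0:ℝ) 2, y^2 * LL (LL hk) (y^2) := by
      refine setIntegral_eq_of_subset_of_forall_sdiff_eq_zero measurableSet_Ioi Ioc_subset_Ioi_self ?_
      intro y hy
      have hy1 : 2 < y := by
        by_contra hc
        exact hy.2 ⟨hy.1, not_lt.1 hc⟩
      have : 1 < y^2 := by nlinarith
      rw [LLLL_hk this]; simp
    rw [e1, ← intervalIntegral.integral_of_le (by norm_num)]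
    have h2 : ∀ y ∈ uIcc (0:ℝ) 2, HasDerivAt (fun y => 2 * y^3 * deriv (LL hk) (y^2))
        (y^2 * LL (LL hk) (y^2)) y := by
      intro y _
      have a1 : HasDerivAt (fun y : ℝ => 2 * y^3) (2 * (3 * y^2)) y := by
        simpa using (hasDerivAt_pow 3 y).const_mul 2
      have a2 : HasDerivAt (fun y : ℝ => y^2) (2 * y) y := by simpa using hasDerivAt_pow 2 y
      have a3 : HasDerivAt (deriv (LL hk)) (deriv (deriv (LL hk)) (y^2)) (y^2) :=
        (hsm1.differentiable (by simp) _).hasDerivAt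
      have := a1.mul (HasDerivAt.comp (h₂ := deriv (LL hk)) (h := fun y : ℝ => y^2) y a3 a2)
      refine HasDerivAt.congr_deriv this ?_
      symm
      show y^2 * (4 * y^2 * deriv (deriv (LL hk)) (y^2) + 6 * deriv (LL hk) (y^2)) = _
      simp
      ring
    rw [intervalIntegral.integral_eq_sub_of_hasDerivAt h2, deriv_LL_hk (by norm_num)]
    · have : Real.sqrt (2^2) = 2 := Real.sqrt_sq (by norm_num)
      rw [this]; norm_num
    · apply Continuous.intervalIntegrable
      have := (LL_contDiff hsm).continuous
      fun_prop
  have hd : Module.finrank ℝ E3 = 3 := by simp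
  rw [hd]
  simp only [smul_eq_mul, show 3 - 1 = 2 from rfl]
  rw [key]
  have : 0 < (volume : Measure E3).real (ball 0 1) := by
    simp only [Measure.real]
    exact ENNReal.toReal_pos (measure_ball_pos _ _ one_pos).ne' measure_ball_lt_top.ne
  simp only [nsmul_eq_mul]
  push_cast
  nlinarith


/-! ### Mean value property of weakly biharmonic functions -/

lemma DD_scale {f : E3 → ℝ} (hf : ContDiff ℝ ∞ f) (a : ℝ) (x d : E3) :
    DD d (fun z => f (a • (z - x))) = fun z => a * DD d f (a • (z - x)) := by
  funext z
  have h1 : HasFDerivAt (fun z : E3 => a • (z - x)) (a • ContinuousLinearMap.id ℝ E3) z :=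
    ((hasFDerivAt_id z).sub_const x).const_smul a
  have h2 := ((hf.differentiable (by simp) (a • (z - x))).hasFDerivAt.comp z h1).fderiv
  have e : (fun z => f (a • (z - x))) = f ∘ (fun z : E3 => a • (z - x)) := rfl
  unfold DD
  rw [e, h2]
  simp

lemma scale_contDiff {f : E3 → ℝ} (hf : ContDiff ℝ ∞ f) (a : ℝ) (x : E3) :
    ContDiff ℝ ∞ (fun z => f (a • (z - x))) := by
  fun_prop

lemma lapl_scale {f : E3 → ℝ} (hf : ContDiff ℝ ∞ f) (a : ℝ) (x : E3) :
    lapl (fun z => f (a • (z - x))) = fun z => a^2 * lapl f (a • (z - x)) := by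
  funext z
  unfold lapl
  rw [Finset.mul_sum]
  refine Finset.sum_congr rfl fun k _ => ?_
  rw [DD_scale hf, DD_const_mul (scale_contDiff (DD_contDiff hf _) a x), DD_scale (DD_contDiff hf _)]
  ring

lemma lapl_const_mul {f : E3 → ℝ} (hf : ContDiff ℝ ∞ f) (c : ℝ) :
    lapl (fun x => c * f x) = fun x => c * lapl f x := by
  funext z
  unfold lapl
  rw [Finset.mul_sum]
  refine Finset.sum_congr rfl fun k _ => ?_
  rw [DD_const_mul hf, DD_const_mul (DD_contDiff hf _)]

/-- Scaled and translated `H`. -/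
def Hs (ε : ℝ) (x z : E3) : ℝ := ε * HH (ε⁻¹ • (z - x))

lemma Hs_contDiff (ε : ℝ) (x : E3) : ContDiff ℝ ∞ (Hs ε x) :=
  contDiff_const.mul (scale_contDiff HH_contDiff _ _)

lemma lapl2_Hs {ε : ℝ} (hε : 0 < ε) (x : E3) :
    lapl (lapl (Hs ε x)) = fun z => (ε⁻¹)^3 * rk (ε⁻¹ • (z - x)) := by
  have e : Hs ε x = fun z => ε * HH (ε⁻¹ • (z - x)) := rfl
  have h1 := lapl_contDiff HH_contDiff
  rw [e, lapl_const_mul (scale_contDiff HH_contDiff _ _), lapl_scale HH_contDiff,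
    lapl_const_mul (contDiff_const.mul (scale_contDiff h1 _ _)),
    lapl_const_mul (scale_contDiff h1 _ _), lapl_scale h1, lapl2_HH]
  funext z
  field_simp

lemma Hs_eq {ε : ℝ} (hε : 0 < ε) {x z : E3} (h : ε ≤ ‖z - x‖) : Hs ε x z = ‖z - x‖ := by
  unfold Hs
  have : ‖ε⁻¹ • (z - x)‖ = ε⁻¹ * ‖z - x‖ := by
    rw [norm_smul, Real.norm_of_nonneg (by positivity)]
  rw [HH_eq, this]
  · field_simp
  · rw [this, inv_mul_eq_div, le_div_iff₀ hε]; linarith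

lemma rk_neg (y : E3) : rk (-y) = rk y := by simp [rk]

lemma mv_var {f : E3 → ℝ} (x : E3) {ε : ℝ} (hε : 0 < ε) :
    ∫ z, f z * ((ε⁻¹)^3 * rk (ε⁻¹ • (z - x))) = ∫ y, f (x + ε • y) * rk y := by
  have h1 := Measure.integral_comp_smul (volume : Measure E3)
    (fun z => f (x + z) * rk (ε⁻¹ • z)) ε
  have h2 : ∫ z, f (x + z) * rk (ε⁻¹ • z) = ∫ z, f z * rk (ε⁻¹ • (z - x)) := by
    have := integral_add_left_eq_self (μ := (volume : Measure E3)) (fun z => f z * rk (ε⁻¹ • (z - x))) x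
    rw [← this]
    simp
  have hd : Module.finrank ℝ E3 = 3 := by simp
  rw [h2, hd] at h1
  have h3 : ∀ y : E3, ε⁻¹ • ε • y = y := fun y => by rw [smul_smul, inv_mul_cancel₀ hε.ne', one_smul]
  simp only [h3] at h1
  rw [h1, abs_of_pos (by positivity), smul_eq_mul, ← integral_const_mul]
  congr 1
  funext z
  rw [inv_pow]; ring

lemma mv_const {f : E3 → ℝ} {U : Set E3} (hf : WB f U) {x : E3} {ε δ : ℝ} (hU : IsOpen U)
    (hδ : 0 < δ) (hδε : δ ≤ ε) (hb : closedBall x ε ⊆ U) :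
    ∫ y, f (x + ε • y) * rk y = ∫ y, f (x + δ • y) * rk y := by
  have hε : 0 < ε := hδ.trans_le hδε
  rw [← mv_var x hε, ← mv_var x hδ]
  have hts : ∀ η, 0 < η → η ≤ ε → tsupport (fun z => (η⁻¹)^3 * rk (η⁻¹ • (z - x))) ⊆ closedBall x ε := by
    intro η hη hηε
    refine closure_minimal ?_ isClosed_closedBall
    intro z hz
    by_contra h
    simp only [mem_closedBall, not_le, dist_eq_norm] at h
    apply hz
    have : 1 < ‖η⁻¹ • (z - x)‖ := by
      rw [norm_smul, Real.norm_of_nonneg (by positivity), inv_mul_eq_div, lt_div_iff₀ hη]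
      linarith
    simp [rk_zero this]
  have hIntg : ∀ η, 0 < η → η ≤ ε → Integrable (fun z => f z * ((η⁻¹)^3 * rk (η⁻¹ • (z - x)))) := by
    intro η hη hηε
    refine integrable_mul_of_tsupport hU hf.1
      (continuous_const.mul (scale_contDiff rk_contDiff _ _).continuous) ?_ ((hts η hη hηε).trans hb)
    exact HasCompactSupport.of_support_subset_isCompact (isCompact_closedBall x ε)
      ((subset_tsupport _).trans (hts η hη hηε))
  rw [← sub_eq_zero, ← integral_sub (hIntg ε hε le_rfl) (hIntg δ hδ hδε)]
  have hG : ContDiff ℝ ∞ (fun z => Hs ε x z - Hs δ x z) := (Hs_contDiff ε x).sub (Hs_contDiff δ x)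
  have hGs : tsupport (fun z => Hs ε x z - Hs δ x z) ⊆ closedBall x ε := by
    refine closure_minimal ?_ isClosed_closedBall
    intro z hz
    by_contra h
    simp only [mem_closedBall, not_le, dist_eq_norm] at h
    apply hz
    show Hs ε x z - Hs δ x z = 0
    rw [Hs_eq hε h.le, Hs_eq hδ (hδε.trans h.le), sub_self]
  have h := hf.2 _ hG (HasCompactSupport.of_support_subset_isCompact (isCompact_closedBall x ε)
      ((subset_tsupport _).trans hGs)) (hGs.trans hb)
  rw [lapl_sub (Hs_contDiff ε x) (Hs_contDiff δ x),
    lapl_sub (lapl_contDiff (Hs_contDiff ε x)) (lapl_contDiff (Hs_contDiff δ x)),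
    lapl2_Hs hε, lapl2_Hs hδ] at h
  rw [← h]
  congr 1
  funext z
  ring

/-- normalizing constant -/
def c0 : ℝ := ∫ x, rk x

lemma rk_integrable : Integrable rk := rk_contDiff.continuous.integrable_of_hasCompactSupport rk_hcs

lemma mv {f : E3 → ℝ} {U : Set E3} (hf : WB f U) {x : E3} {ε : ℝ} (hU : IsOpen U)
    (hε : 0 < ε) (hb : closedBall x ε ⊆ U) :
    ∫ y, f (x + ε • y) * rk y = c0 * f x := by
  have hx : x ∈ U := hb (mem_closedBall_self hε.le)
  have hfx : ContinuousAt f x := (hf.1 x hx).continuousAt (hU.mem_nhds hx)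
  have key : ∀ η > 0, |(∫ y, f (x + ε • y) * rk y) - c0 * f x| ≤ η * ∫ y, |rk y| := by
    intro η hη
    obtain ⟨δ0, hδ0, hd⟩ := Metric.continuousAt_iff.1 hfx η hη
    set δ := min ε (δ0/2) with hδd
    have hδ : 0 < δ := lt_min hε (by linarith)
    rw [mv_const hf hU hδ (min_le_left _ _) hb]
    have hpt : ∀ y, |f (x + δ • y) * rk y - f x * rk y| ≤ η * |rk y| := by
      intro y
      rw [← sub_mul, abs_mul]
      by_cases hy : ‖y‖ ≤ 1
      · gcongr
        have : dist (x + δ • y) x < δ0 := by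
          rw [dist_eq_norm, add_sub_cancel_left, norm_smul, Real.norm_of_nonneg hδ.le]
          have : δ ≤ δ0/2 := min_le_right _ _
          nlinarith [norm_nonneg y]
        have := hd this
        rw [Real.dist_eq] at this
        exact this.le
      · rw [rk_zero (not_le.1 hy)]; simp
    have hi1 : Integrable (fun y => f (x + δ • y) * rk y) := by
      have h1 : tsupport rk ⊆ {y | x + δ • y ∈ U} := by
        intro y hy
        have h2 := rk_tsupport hy
        apply hb
        simp only [mem_closedBall, dist_eq_norm, sub_zero, add_sub_cancel_left] at h2 ⊢
        rw [norm_smul, Real.norm_of_nonneg hδ.le]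
        have : δ ≤ ε := min_le_left _ _
        nlinarith [norm_nonneg y]
      have hc : Continuous (fun y : E3 => x + δ • y) := by fun_prop
      exact integrable_mul_of_tsupport (hU.preimage hc) (hf.1.comp hc.continuousOn (fun y hy => hy))
        rk_contDiff.continuous rk_hcs h1
    have hi2 : Integrable (fun y => f x * rk y) := rk_integrable.const_mul _
    have : c0 * f x = ∫ y, f x * rk y := by
      rw [integral_const_mul]; unfold c0; ring
    rw [this, ← integral_sub hi1 hi2, ← Real.norm_eq_abs, ← integral_const_mul]
    refine norm_integral_le_of_norm_le (rk_integrable.abs.const_mul η) (Filter.Eventually.of_forall ?_)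
    intro y
    exact hpt y
  have h0 : |(∫ y, f (x + ε • y) * rk y) - c0 * f x| ≤ 0 := by
    have hI : 0 ≤ ∫ y, |rk y| := integral_nonneg fun y => abs_nonneg _
    refine le_of_forall_pos_le_add fun η hη => ?_
    have := key (η / (1 + ∫ y, |rk y|)) (by positivity)
    refine this.trans ?_
    rw [zero_add, div_mul_eq_mul_div, div_le_iff₀ (by positivity)]
    nlinarith
  have := abs_nonpos_iff.1 h0
  linarith

/-- Convolution form of the mean value property. -/
lemma mv_conv {f : E3 → ℝ} {U : Set E3} (hf : WB f U) {x : E3} {ε : ℝ} (hU : IsOpen U)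
    (hε : 0 < ε) (hb : closedBall x ε ⊆ U) :
    f x = ∫ z, f z * (c0⁻¹ * (ε⁻¹)^3 * rk (ε⁻¹ • (x - z))) := by
  have h := mv hf hU hε hb
  rw [← mv_var x hε] at h
  have hc : c0 ≠ 0 := rk_integral_ne
  have : ∫ z, f z * (c0⁻¹ * (ε⁻¹)^3 * rk (ε⁻¹ • (x - z)))
      = c0⁻¹ * ∫ z, f z * ((ε⁻¹)^3 * rk (ε⁻¹ • (z - x))) := by
    rw [← integral_const_mul]
    congr 1
    funext z
    have : rk (ε⁻¹ • (x - z)) = rk (ε⁻¹ • (z - x)) := by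
      rw [← rk_neg, ← smul_neg, neg_sub]
    rw [this]; ring
  rw [this, h]
  field_simp

lemma conv_ind {f : E3 → ℝ} {x0 x : E3} {ε : ℝ} (hε : 0 < ε) (hx : x ∈ closedBall x0 ε) :
    ∫ z, f z * (c0⁻¹ * (ε⁻¹)^3 * rk (ε⁻¹ • (x - z))) =
     ∫ z, (closedBall x0 (2*ε)).indicator f z * (c0⁻¹ * (ε⁻¹)^3 * rk (ε⁻¹ • (x - z))) := by
  congr 1
  funext z
  by_cases hz : z ∈ closedBall x0 (2*ε)
  · rw [indicator_of_mem hz]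
  · have : 1 < ‖ε⁻¹ • (x - z)‖ := by
      rw [norm_smul, Real.norm_of_nonneg (by positivity), inv_mul_eq_div, lt_div_iff₀ hε]
      simp only [mem_closedBall, not_le] at hz hx
      have h1 := dist_triangle z x x0
      rw [dist_comm z x, dist_eq_norm x z] at h1
      linarith
    simp [rk_zero this]

lemma ind_integrable {f : E3 → ℝ} {U : Set E3} (hf : ContinuousOn f U) {x : E3} {ε : ℝ}
    (hb : closedBall x ε ⊆ U) : Integrable ((closedBall x ε).indicator f) := by
  rw [integrable_indicator_iff isClosed_closedBall.measurableSet]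
  exact (hf.mono hb).integrableOn_compact (isCompact_closedBall x ε)

lemma WB.smooth {f : E3 → ℝ} {U : Set E3} (hf : WB f U) (hU : IsOpen U) : ContDiffOn ℝ ∞ f U := by
  intro x0 hx0
  obtain ⟨r, hr, hb⟩ := Metric.isOpen_iff.1 hU x0 hx0
  set ε := r/4 with hε_def
  have hε : 0 < ε := by positivity
  have hb2 : closedBall x0 (2*ε) ⊆ U := (closedBall_subset_ball (by linarith)).trans hb
  have hg := ind_integrable hf.1 hb2
  set k : E3 → ℝ := fun y => c0⁻¹ * (ε⁻¹)^3 * rk (ε⁻¹ • y) with hk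
  have hk1 : ContDiff ℝ ∞ k := contDiff_const.mul (rk_contDiff.comp (contDiff_const_smul _))
  have hk2 : HasCompactSupport k := by
    have : HasCompactSupport (fun y => rk (ε⁻¹ • y)) :=
      rk_hcs.comp_homeomorph (Homeomorph.smulOfNeZero ε⁻¹ (by positivity))
    exact this.mul_left
  have hcd := hk2.contDiff_convolution_right (ContinuousLinearMap.mul ℝ ℝ)
    (μ := (volume : Measure E3)) hg.locallyIntegrable hk1
  refine ContDiffAt.contDiffWithinAt ?_
  refine hcd.contDiffAt.congr_of_eventuallyEq ?_
  filter_upwards [ball_mem_nhds x0 hε] with x hx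
  have hbx : closedBall x ε ⊆ U := by
    refine (closedBall_subset_closedBall' ?_).trans hb2
    rw [mem_ball] at hx; linarith
  rw [mv_conv hf hU hε hbx, conv_ind hε (ball_subset_closedBall hx)]
  rfl

/-- volume of the unit ball -/
def v1 : ℝ := (volume : Measure E3).real (ball 0 1)

lemma vol_cb (x : E3) {r : ℝ} (hr : 0 ≤ r) : (volume : Measure E3).real (closedBall x r) = r^3 * v1 := by
  have := Measure.addHaar_real_closedBall (volume : Measure E3) x hr
  rw [this]; simp [v1]

lemma v1_pos : 0 < v1 := by
  simp only [v1, Measure.real]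
  exact ENNReal.toReal_pos (measure_ball_pos _ _ one_pos).ne' measure_ball_lt_top.ne

lemma grad_bound : ∃ A > 0, ∀ (U : Set E3) (f : E3 → ℝ), IsOpen U → WB f U → ∀ (x : E3) (ε B : ℝ),
    0 < ε → closedBall x ε ⊆ U → (∀ y ∈ closedBall x ε, |f y| ≤ B) → ‖fderiv ℝ f x‖ ≤ A / ε * B := by
  obtain ⟨L, hL⟩ := (rk_contDiff.of_le (m := 1) (by simp)).lipschitzWith_of_hasCompactSupport rk_hcs (by simp)
  have hc : 0 < |c0| := abs_pos.2 rk_integral_ne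
  have hv := v1_pos
  refine ⟨16 * v1 * |c0|⁻¹ * L + 1, by positivity, ?_⟩
  intro U f hU hf x0 ε' B hε' hb hB
  have hB0 : 0 ≤ B := (abs_nonneg _).trans (hB x0 (mem_closedBall_self hε'.le))
  set ε := ε'/2 with hε_def
  have hε : 0 < ε := by positivity
  have h2 : 2 * ε = ε' := by rw [hε_def]; ring
  have hb2 : closedBall x0 (2*ε) ⊆ U := by rw [h2]; exact hb
  have hg := ind_integrable hf.1 hb2
  have hlip : ∀ x ∈ closedBall x0 ε, ‖f x - f x0‖ ≤ (16 * v1 * |c0|⁻¹ * L) / ε' * B * ‖x - x0‖ := by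
    intro x hx
    have hbx : closedBall x ε ⊆ U := by
      refine (closedBall_subset_closedBall' ?_).trans hb2
      rw [mem_closedBall] at hx; linarith
    have hbx0 : closedBall x0 ε ⊆ U :=
      (closedBall_subset_closedBall (by linarith)).trans hb2
    have e1 := (mv_conv hf hU hε hbx).trans (conv_ind hε hx)
    have e0 := (mv_conv hf hU hε hbx0).trans (conv_ind hε (mem_closedBall_self hε.le))
    rw [e1, e0]
    have hi : ∀ x : E3, Integrable (fun z => (closedBall x0 (2*ε)).indicator f z * (c0⁻¹ * (ε⁻¹)^3 * rk (ε⁻¹ • (x - z)))) := by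
      intro x
      obtain ⟨Cb, hCb⟩ := rk_hcs.exists_bound_of_continuous rk_contDiff.continuous
      refine hg.mul_bdd (c := |c0⁻¹ * (ε⁻¹)^3| * Cb) ?_ (Filter.Eventually.of_forall ?_)
      · have := rk_contDiff.continuous
        exact Continuous.aestronglyMeasurable (by fun_prop)
      · intro z
        rw [norm_mul]
        gcongr
        · rfl
        · exact hCb _
    rw [← integral_sub (hi x) (hi x0)]
    have hpt : ∀ z, ‖(closedBall x0 (2*ε)).indicator f z * (c0⁻¹ * (ε⁻¹)^3 * rk (ε⁻¹ • (x - z)))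
        - (closedBall x0 (2*ε)).indicator f z * (c0⁻¹ * (ε⁻¹)^3 * rk (ε⁻¹ • (x0 - z)))‖ ≤
        (closedBall x0 (2*ε)).indicator (fun _ => B * (|c0|⁻¹ * (ε⁻¹)^3 * (L * (ε⁻¹ * ‖x - x0‖)))) z := by
      intro z
      by_cases hz : z ∈ closedBall x0 (2*ε)
      · rw [indicator_of_mem hz, indicator_of_mem hz, ← mul_sub, ← mul_sub, norm_mul, norm_mul]
        have h3 : ‖rk (ε⁻¹ • (x - z)) - rk (ε⁻¹ • (x0 - z))‖ ≤ L * (ε⁻¹ * ‖x - x0‖) := by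
          rw [← dist_eq_norm]
          refine (hL.dist_le_mul _ _).trans (le_of_eq ?_)
          rw [dist_eq_norm, ← smul_sub, norm_smul, Real.norm_of_nonneg (by positivity)]
          simp
        have h4 : ‖c0⁻¹ * (ε⁻¹)^3‖ = |c0|⁻¹ * (ε⁻¹)^3 := by
          rw [norm_mul, Real.norm_eq_abs, abs_inv, Real.norm_of_nonneg (by positivity)]
        rw [h4]
        have h5 : ‖f z‖ ≤ B := hB z (by rw [← h2]; exact hz)
        gcongr
      · rw [indicator_of_notMem hz, indicator_of_notMem hz]; simp
    refine (norm_integral_le_of_norm_le ?_ (Filter.Eventually.of_forall hpt)).trans (le_of_eq ?_)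
    · rw [integrable_indicator_iff isClosed_closedBall.measurableSet]
      exact integrableOn_const (isCompact_closedBall x0 _).measure_lt_top.ne
    · rw [integral_indicator isClosed_closedBall.measurableSet, setIntegral_const, vol_cb x0 (by positivity),
        ← h2, smul_eq_mul]
      field_simp
      ring
  have hfin : ‖fderiv ℝ f x0‖ ≤ (16 * v1 * |c0|⁻¹ * L) / ε' * B := by
    refine norm_fderiv_le_of_lip' ℝ (by positivity) ?_
    filter_upwards [closedBall_mem_nhds x0 hε] with x hx
    exact hlip x hx
  refine hfin.trans ?_
  gcongr
  linarith

/-- Cauchy-Schwarz. -/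
lemma cs_int {α : Type*} [MeasurableSpace α] {μ : Measure α} {f g : α → ℝ}
    (hf : Integrable (fun x => f x ^ 2) μ) (hg : Integrable (fun x => g x ^ 2) μ)
    (hfg : Integrable (fun x => f x * g x) μ) :
    (∫ x, f x * g x ∂μ)^2 ≤ (∫ x, f x ^ 2 ∂μ) * ∫ x, g x ^ 2 ∂μ := by
  have h : ∀ t : ℝ, 0 ≤ (∫ x, g x ^ 2 ∂μ) * (t * t) + (-2 * ∫ x, f x * g x ∂μ) * t + ∫ x, f x ^ 2 ∂μ := by
    intro t
    have h0 : 0 ≤ ∫ x, (f x - t * g x)^2 ∂μ := integral_nonneg fun x => sq_nonneg _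
    have e : ∀ x, (f x - t * g x)^2 = f x ^ 2 + ((t*t) * g x ^ 2 + (-2 * t) * (f x * g x)) := fun x => by ring
    simp only [e] at h0
    have i1 := hg.const_mul (t*t)
    have i2 := hfg.const_mul (-2*t)
    have i3 : Integrable (fun x => (t*t) * g x ^ 2 + (-2 * t) * (f x * g x)) μ := i1.add i2
    rw [integral_add hf i3, integral_add i1 i2, integral_const_mul, integral_const_mul] at h0
    linarith
  have := discrim_le_zero h
  unfold discrim at this
  nlinarith

lemma sup_bound : ∃ A > 0, ∀ (U : Set E3) (f : E3 → ℝ), IsOpen U → WB f U → ∀ (x : E3) (ε : ℝ),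
    0 < ε → ball x ε ⊆ U → IntegrableOn (fun y => f y ^ 2) (ball x ε) →
    f x ^ 2 ≤ A / ε^3 * ∫ y in ball x ε, f y ^ 2 := by
  obtain ⟨Cb, hCb⟩ := rk_hcs.exists_bound_of_continuous rk_contDiff.continuous
  have hc : 0 < |c0| := abs_pos.2 rk_integral_ne
  have hv := v1_pos
  have hCb0 : 0 ≤ Cb := (norm_nonneg _).trans (hCb 0)
  refine ⟨(64 * v1 * (|c0|⁻¹ * Cb)^2 + 1) * 8, by positivity, ?_⟩
  intro U f hU hf x ε' hε' hb hIntg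
  set ε := ε'/4 with hε_def
  have hε : 0 < ε := by positivity
  have hb1 : closedBall x ε ⊆ ball x ε' := closedBall_subset_ball (by linarith)
  have hb2 : closedBall x (2*ε) ⊆ ball x ε' := closedBall_subset_ball (by linarith)
  set k : E3 → ℝ := fun z => c0⁻¹ * (ε⁻¹)^3 * rk (ε⁻¹ • (x - z)) with hk
  have hkc : Continuous k := by
    have := rk_contDiff.continuous
    fun_prop
  have hfx : f x = ∫ z in closedBall x (2*ε), f z * k z := by
    rw [mv_conv hf hU hε (hb1.trans hb), conv_ind hε (mem_closedBall_self hε.le),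
      ← integral_indicator isClosed_closedBall.measurableSet]
    congr 1
    funext z
    by_cases hz : z ∈ closedBall x (2*ε)
    · rw [indicator_of_mem hz, indicator_of_mem hz]
    · rw [indicator_of_notMem hz, indicator_of_notMem hz, zero_mul]
  have hfc : ContinuousOn f (closedBall x (2*ε)) := hf.1.mono (hb2.trans hb)
  have hcp := isCompact_closedBall x (2*ε)
  have hcs := cs_int (μ := volume.restrict (closedBall x (2*ε))) (f := f) (g := k)
    ((hfc.pow 2).integrableOn_compact hcp) ((hkc.pow 2).continuousOn.integrableOn_compact hcp)
    ((hfc.mul hkc.continuousOn).integrableOn_compact hcp)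
  rw [← hfx] at hcs
  have h1 : ∫ z in closedBall x (2*ε), f z ^ 2 ≤ ∫ z in ball x ε', f z ^ 2 :=
    setIntegral_mono_set hIntg (Filter.Eventually.of_forall fun z => sq_nonneg _) hb2.eventuallyLE
  have h2 : ∫ z in closedBall x (2*ε), k z ^ 2 ≤ (64 * v1 * (|c0|⁻¹ * Cb)^2 + 1) / ε'^3 * 8 := by
    have hpt : ∀ z, k z ^ 2 ≤ (|c0|⁻¹ * (ε⁻¹)^3 * Cb)^2 := by
      intro z
      rw [← sq_abs (k z)]
      gcongr
      rw [hk]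
      simp only [abs_mul, abs_inv, abs_pow]
      rw [abs_of_pos hε]
      gcongr
      exact hCb _
    calc ∫ z in closedBall x (2*ε), k z ^ 2 ≤ ∫ z in closedBall x (2*ε), (|c0|⁻¹ * (ε⁻¹)^3 * Cb)^2 :=
          setIntegral_mono ((hkc.pow 2).continuousOn.integrableOn_compact hcp)
            (integrableOn_const hcp.measure_lt_top.ne) hpt
      _ = 64 * v1 * (|c0|⁻¹ * Cb)^2 / ε'^3 * 8 := by
          rw [setIntegral_const, vol_cb x (by positivity), hε_def, smul_eq_mul]
          field_simp
          ring
      _ ≤ _ := by gcongr; linarith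
  calc f x ^ 2 ≤ _ := hcs
    _ ≤ (∫ z in ball x ε', f z ^ 2) * ((64 * v1 * (|c0|⁻¹ * Cb)^2 + 1) / ε'^3 * 8) := by
        refine mul_le_mul h1 h2 (integral_nonneg fun _ => sq_nonneg _) (integral_nonneg fun _ => sq_nonneg _)
    _ = _ := by ring


/-! ### Three balls inequality -/

lemma taylor_bd (T B : ℝ) (n : ℕ) : ∀ (g : ℕ → ℝ → ℝ) (a : ℕ → ℝ),
    (∀ k < n, ∀ t ∈ Icc 0 T, HasDerivAt (g k) (g (k+1) t) t) → (∀ t ∈ Icc 0 T, |g n t| ≤ B) →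
    (∀ k < n, |g k 0| ≤ a k) → ∀ t ∈ Icc 0 T,
    |g 0 t| ≤ (∑ k ∈ Finset.range n, a k * (t^k / (k.factorial : ℝ))) + B * (t^n / (n.factorial : ℝ)) := by
  induction n with
  | zero => intro g a _ h2 _ t ht; simpa using h2 t ht
  | succ n ih =>
    intro g a h1 h2 h3 t ht
    have ih' := ih (fun k => g (k+1)) (fun k => a (k+1)) (fun k hk => h1 (k+1) (by omega)) h2
      (fun k hk => h3 (k+1) (by omega))
    have hfac : ∀ m : ℕ, ∀ t : ℝ, HasDerivAt (fun t : ℝ => t^(m+1) / ((m+1).factorial : ℝ)) (t^m / (m.factorial : ℝ)) t := by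
      intro m t
      have := (hasDerivAt_pow (m+1) t).div_const ((m+1).factorial : ℝ)
      refine this.congr_deriv ?_
      rw [Nat.factorial_succ]
      push_cast
      field_simp
    have hB : ∀ t, HasDerivAt (fun t : ℝ => (a 0 + ∑ k ∈ Finset.range n, a (k+1) * (t^(k+1) / ((k+1).factorial : ℝ))) + B * (t^(n+1) / ((n+1).factorial : ℝ)))
       ((∑ k ∈ Finset.range n, a (k+1) * (t^k / (k.factorial : ℝ))) + B * (t^n / (n.factorial : ℝ))) t := by
      intro t
      refine HasDerivAt.add ?_ ((hfac n t).const_mul B)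
      exact (HasDerivAt.fun_sum fun k _ => (hfac k t).const_mul _).const_add _
    have := image_norm_le_of_norm_deriv_right_le_deriv_boundary (f := g 0) (f' := g 1) (a := 0) (b := T)
      (fun t ht => (h1 0 (by omega) t ht).continuousAt.continuousWithinAt)
      (fun t ht => (h1 0 (by omega) t ⟨ht.1, ht.2.le⟩).hasDerivWithinAt)
      (B := fun t : ℝ => (a 0 + ∑ k ∈ Finset.range n, a (k+1) * (t^(k+1) / ((k+1).factorial : ℝ))) + B * (t^(n+1) / ((n+1).factorial : ℝ)))
      (by simpa using h3 0 (by omega)) hB (fun t ht => by simpa using ih' t ⟨ht.1, ht.2.le⟩) ht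
    rw [Finset.sum_range_succ']
    simp only [Real.norm_eq_abs] at this
    refine this.trans (le_of_eq ?_)
    simp; ring

lemma WB.iter {f : E3 → ℝ} {U : Set E3} (hU : IsOpen U) (h : WB f U) (d : E3) (k : ℕ) :
    WB ((_root_.DD d)^[k] f) U := by
  induction k with
  | zero => exact h
  | succ k ih =>
    rw [Function.iterate_succ_apply']
    exact WB.DD hU ih ((ih.smooth hU).of_le (by simp)) d

lemma WB.hasDeriv {f : E3 → ℝ} {U : Set E3} (hU : IsOpen U) (h : WB f U) (d x : E3) (t : ℝ)
    (hx : x + t • d ∈ U) : HasDerivAt (fun t : ℝ => f (x + t • d)) (_root_.DD d f (x + t • d)) t := by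
  have h1 : DifferentiableAt ℝ f (x + t • d) :=
    (((h.smooth hU) _ hx).contDiffAt (hU.mem_nhds hx)).differentiableAt (by simp)
  have h2 : HasDerivAt (fun t : ℝ => x + t • d) d t := by
    simpa using ((hasDerivAt_id t).smul_const d).const_add x
  exact h1.hasFDerivAt.comp_hasDerivAt t h2

lemma iter_bound : ∃ A ≥ 1, ∀ (U : Set E3) (f : E3 → ℝ), IsOpen U → WB f U → ∀ (d x : E3) (R M : ℝ),
    ‖d‖ ≤ 1 → 0 < R → closedBall x R ⊆ U → (∀ y ∈ closedBall x R, |f y| ≤ M) → ∀ k : ℕ,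
    |(DD d)^[k] f x| ≤ M * (A * k / R)^k := by
  obtain ⟨A0, hA0, hA⟩ := grad_bound
  refine ⟨max A0 1, le_max_right _ _, ?_⟩
  set A := max A0 1 with hAdef
  have hA1 : 1 ≤ A := le_max_right _ _
  intro U f hU hf d x R M hd hR hb hM k
  have hM0 : 0 ≤ M := (abs_nonneg _).trans (hM x (mem_closedBall_self hR.le))
  rcases Nat.eq_zero_or_pos k with rfl | hk
  · simpa using hM x (mem_closedBall_self hR.le)
  have hk' : (0:ℝ) < k := by exact_mod_cast hk
  have key : ∀ j : ℕ, j ≤ k → ∀ y ∈ closedBall x (R - j * (R/k)), |(DD d)^[j] f y| ≤ M * (A * k / R)^j := by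
    intro j
    induction j with
    | zero => intro _ y hy; simpa using hM y (by simpa using hy)
    | succ j ih =>
      intro hj y hy
      rw [Function.iterate_succ_apply']
      have hsub : closedBall y (R/k) ⊆ closedBall x (R - j * (R/k)) := by
        apply closedBall_subset_closedBall'
        rw [mem_closedBall] at hy
        push_cast at hy
        linarith
      have hsub2 : closedBall x (R - j * (R/k)) ⊆ closedBall x R := by
        apply closedBall_subset_closedBall
        have : 0 ≤ j * (R/k) := by positivity
        linarith
      have := hA U _ hU (hf.iter hU d j) y (R/k) _ (by positivity) ((hsub.trans hsub2).trans hb)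
        (fun z hz => ih (by omega) z (hsub hz))
      have h2 : |DD d ((DD d)^[j] f) y| ≤ ‖fderiv ℝ ((DD d)^[j] f) y‖ * ‖d‖ :=
        (fderiv ℝ ((DD d)^[j] f) y).le_opNorm d
      calc _ ≤ _ := h2
        _ ≤ (A0 / (R/k) * (M * (A * k / R)^j)) * 1 := by gcongr
        _ ≤ (A / (R/k) * (M * (A * k / R)^j)) * 1 := by gcongr; exact le_max_left _ _
        _ = _ := by rw [pow_succ]; field_simp
  refine key k le_rfl x ?_
  have : R - k * (R/k) = 0 := by field_simp; ring
  rw [this]; simp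

lemma pow_self_le (k : ℕ) : (k:ℝ)^k / (k.factorial : ℝ) ≤ Real.exp 1 ^ k := by
  rw [← Real.exp_nat_mul, mul_one]
  exact Real.pow_div_factorial_le_exp _ (by positivity) k

lemma three_poly : ∃ L ≥ 2, ∀ (U : Set E3) (f : E3 → ℝ), IsOpen U → WB f U → ∀ (x : E3) (r ε M : ℝ),
    0 < r → closedBall x (4*L*r) ⊆ U → (∀ y ∈ closedBall x (4*L*r), |f y| ≤ M) →
    (∀ y ∈ closedBall x r, |f y| ≤ ε) → ∀ n : ℕ, ∀ y ∈ closedBall x (2*r),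
    |f y| ≤ ε * L^n + M * (1/2)^n := by
  obtain ⟨A, hA1, hA⟩ := iter_bound
  set q := 2 * A * Real.exp 1 with hq
  have he : 1 ≤ Real.exp 1 := Real.one_le_exp zero_le_one
  have hq1 : 1 ≤ q := by nlinarith
  refine ⟨q + 1, by linarith, ?_⟩
  set L := q + 1 with hL
  intro U f hU hf x r ε M hr hb hM hε n y hy
  have hM0 : 0 ≤ M := (abs_nonneg _).trans (hM x (mem_closedBall_self (by positivity)))
  have hε0 : 0 ≤ ε := (abs_nonneg _).trans (hε x (mem_closedBall_self hr.le))
  have hL2 : 2 ≤ L := by linarith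
  -- direction
  obtain ⟨d, T, hd, hT0, hT, hyd⟩ : ∃ d : E3, ∃ T : ℝ, ‖d‖ ≤ 1 ∧ 0 ≤ T ∧ T ≤ 2*r ∧ y = x + T • d := by
    refine ⟨(1/‖y - x‖) • (y - x), ‖y - x‖, ?_, norm_nonneg _, by rwa [← dist_eq_norm], ?_⟩
    · rw [norm_smul]; simp only [one_div, norm_inv, norm_norm]
      exact inv_mul_le_one
    · by_cases h : ‖y - x‖ = 0
      · have := sub_eq_zero.1 (norm_eq_zero.1 h)
        simp [this]
      · rw [smul_smul, mul_one_div_cancel h, one_smul]; abel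
  have hin : ∀ t ∈ Icc 0 T, x + t • d ∈ closedBall x (2*r) := by
    intro t ht
    rw [mem_closedBall, dist_eq_norm, add_sub_cancel_left, norm_smul, Real.norm_of_nonneg ht.1]
    nlinarith [ht.1, ht.2, norm_nonneg d]
  have hbr : closedBall x r ⊆ U := (closedBall_subset_closedBall (by nlinarith)).trans hb
  have hb2 : ∀ z ∈ closedBall x (2*r), closedBall z (2*L*r) ⊆ closedBall x (4*L*r) := by
    intro z hz
    apply closedBall_subset_closedBall'
    rw [mem_closedBall] at hz
    nlinarith
  have hbz : closedBall x (2*r) ⊆ U := (closedBall_subset_closedBall (by nlinarith)).trans hb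
  have key := taylor_bd T (M * (A * n / (2*L*r))^n) n (fun k t => (DD d)^[k] f (x + t • d))
    (fun k => ε * (A * k / r)^k)
    (by
      intro k hk t ht
      show HasDerivAt _ ((DD d)^[k+1] f (x + t • d)) t
      rw [Function.iterate_succ_apply']
      exact (hf.iter hU d k).hasDeriv hU d x t (hbz (hin t ht)))
    (by
      intro t ht
      have hz := hin t ht
      exact hA U f hU hf d _ _ _ hd (by positivity) ((hb2 _ hz).trans hb) (fun z hz' => hM z (hb2 _ hz hz')) n)
    (by
      intro k hk
      simp only [zero_smul, add_zero]
      exact hA U f hU hf d x r ε hd hr hbr hε k)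
    T ⟨hT0, le_rfl⟩
  simp only [Function.iterate_zero, id] at key
  rw [← hyd] at key
  refine key.trans (add_le_add ?_ ?_)
  · have h1 : ∀ k ∈ Finset.range n, ε * (A * k / r)^k * (T^k / (k.factorial : ℝ)) ≤ ε * q^k := by
      intro k _
      have : (A * k / r)^k * (T^k / (k.factorial : ℝ)) = (A * (T/r))^k * ((k:ℝ)^k / (k.factorial : ℝ)) := by
        simp only [div_pow, mul_pow]; ring
      rw [mul_assoc, this]
      have h3 : T / r ≤ 2 := by rw [div_le_iff₀ hr]; exact hT
      calc ε * ((A * (T/r))^k * ((k:ℝ)^k / (k.factorial : ℝ))) ≤ ε * ((A * 2)^k * Real.exp 1 ^ k) := by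
            gcongr
            exact pow_self_le k
        _ = ε * q^k := by rw [hq, ← mul_pow]; ring
    refine (Finset.sum_le_sum h1).trans ?_
    rw [← Finset.mul_sum]
    gcongr
    clear h1 key
    induction n with
    | zero => simp
    | succ n ih =>
      rw [Finset.sum_range_succ, pow_succ L]
      have h2 : q^n ≤ q * L^n := by
        have : q^n ≤ L^n := by gcongr; linarith
        nlinarith [pow_nonneg (show 0 ≤ L by linarith) n]
      rw [hL] at *
      nlinarith
  · rw [mul_assoc]
    gcongr
    have : (A * n / (2*L*r))^n * (T^n / (n.factorial : ℝ)) = (A * (T/(2*L*r)))^n * ((n:ℝ)^n / (n.factorial : ℝ)) := by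
        simp only [div_pow, mul_pow]; ring
    rw [this]
    have h3 : A * (T / (2*L*r)) ≤ A / L := by
      rw [mul_div_assoc', div_le_div_iff₀ (by positivity) (by positivity)]
      have : 0 ≤ A * L := by positivity
      nlinarith
    calc (A * (T/(2*L*r)))^n * ((n:ℝ)^n / (n.factorial : ℝ)) ≤ (A / L)^n * Real.exp 1 ^ n := by
          gcongr
          exact pow_self_le n
      _ = (A / L * Real.exp 1)^n := by rw [mul_pow]
      _ ≤ _ := by
        gcongr
        rw [div_mul_eq_mul_div, div_le_div_iff₀ (by positivity) (by positivity)]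
        linarith

lemma three_balls : ∃ K ≥ 8, ∃ θ > 0, ∃ β > 0, θ ≤ 1/2 ∧ ∀ (U : Set E3) (f : E3 → ℝ), IsOpen U → WB f U →
    ∀ (x : E3) (r M τ : ℝ), 0 < r → 0 ≤ M → closedBall x (K*r) ⊆ U →
    (∀ y ∈ closedBall x (K*r), |f y| ≤ M) →
    (∀ y ∈ closedBall x r, |f y| ≤ M * Real.exp (-τ)) → ∀ y ∈ closedBall x (2*r),
    |f y| ≤ M * Real.exp (-(θ*τ - β)) := by
  obtain ⟨L, hL, h3⟩ := three_poly
  have hl2 : 0 < Real.log 2 := Real.log_pos (by norm_num)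
  have hl : Real.log 2 ≤ Real.log L := Real.log_le_log (by norm_num) hL
  have hlL : 0 < Real.log L := hl2.trans_le hl
  have hl3 : 0 < Real.log 3 := Real.log_pos (by norm_num)
  refine ⟨4*L, by linarith, Real.log 2 / (2 * Real.log L), by positivity, Real.log 3, hl3, ?_, ?_⟩
  · rw [div_le_div_iff₀ (by positivity) (by positivity)]; linarith
  set θ := Real.log 2 / (2 * Real.log L) with hθ
  have hθ0 : 0 < θ := by positivity
  have hθ1 : θ ≤ 1/2 := by rw [hθ, div_le_div_iff₀ (by positivity) (by positivity)]; linarith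
  intro U f hU hf x r M τ hr hM0 hb hM hτ y hy
  rcases lt_or_ge τ 0 with ht | ht
  · have h1 := hM y (closedBall_subset_closedBall (by nlinarith) hy)
    refine h1.trans ?_
    have : 1 ≤ Real.exp (-(θ*τ - Real.log 3)) := by
      apply Real.one_le_exp; nlinarith
    nlinarith
  · set n := ⌊τ / (2 * Real.log L)⌋₊ with hn
    have hn1 : (n:ℝ) ≤ τ / (2 * Real.log L) := Nat.floor_le (by positivity)
    have hn2 : τ / (2 * Real.log L) < n + 1 := Nat.lt_floor_add_one _
    have h1 := h3 U f hU hf x r _ M hr hb hM hτ n y hy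
    refine h1.trans ?_
    have e1 : L^n ≤ Real.exp (τ/2) := by
      rw [← Real.exp_log (show 0 < L by linarith), ← Real.exp_nat_mul, Real.exp_le_exp]
      rw [le_div_iff₀ (by positivity)] at hn1
      linarith
    have e2 : (1/2:ℝ)^n ≤ 2 * Real.exp (-(θ*τ)) := by
      have : (1/2:ℝ)^n = Real.exp (-(n * Real.log 2)) := by
        rw [Real.exp_neg, Real.exp_nat_mul, Real.exp_log (by norm_num)]; simp
      rw [this]
      nth_rw 2 [← Real.exp_log (show (0:ℝ) < 2 by norm_num)]
      rw [← Real.exp_add, Real.exp_le_exp, hθ]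
      have : Real.log 2 / (2 * Real.log L) * τ = Real.log 2 * (τ / (2 * Real.log L)) := by ring
      rw [this]; nlinarith
    have e3 : Real.exp (-(θ*τ - Real.log 3)) = 3 * Real.exp (-(θ*τ)) := by
      rw [neg_sub, sub_eq_add_neg, Real.exp_add, Real.exp_log (by norm_num)]
    have e4 : Real.exp (-τ) * L^n ≤ Real.exp (-(θ*τ)) := by
      calc Real.exp (-τ) * L^n ≤ Real.exp (-τ) * Real.exp (τ/2) := by gcongr
        _ = Real.exp (-τ + τ/2) := by rw [Real.exp_add]
        _ ≤ _ := by rw [Real.exp_le_exp]; nlinarith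
    rw [e3]
    have : M * Real.exp (-τ) * L^n + M * (1/2)^n = M * (Real.exp (-τ) * L^n + (1/2)^n) := by ring
    rw [this]
    gcongr
    linarith


/-! ### Geometry -/

/-- The exterior domain. -/
abbrev Om (C : Set E3) : Set E3 := lowerHalf \ closure C

lemma Om_open (C : Set E3) : IsOpen (Om C) := by
  have : IsOpen lowerHalf := isOpen_lt (by fun_prop) continuous_const
  exact this.sdiff isClosed_closure

/-- Uniform interior cone property. -/
def UC (Ω : Set E3) (r c : ℝ) : Prop :=
  ∀ P : E3, ∃ e : E3, ‖e‖ = 1 ∧ ∀ x ∈ ball P r, x ∈ Ω → ∀ t > 0, ∀ y : E3, ‖y - t • e‖ < c * t →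
    x + y ∈ ball P r → x + y ∈ Ω

lemma coord_le (x : E3) (i : Fin 3) : |x i| ≤ ‖x‖ := by
  have := EuclideanSpace.norm_sq_eq x
  simp only [Fin.sum_univ_three, Real.norm_eq_abs, sq_abs] at this
  apply abs_le_of_sq_le_sq _ (norm_nonneg _)
  fin_cases i <;> simp <;> nlinarith [sq_nonneg (x 0), sq_nonneg (x 1), sq_nonneg (x 2)]

lemma proj12_add (x y : E3) : proj12 (x + y) = proj12 x + proj12 y := by
  ext i; fin_cases i <;> simp [proj12]

lemma proj12_norm (x : E3) : ‖proj12 x‖ ≤ ‖x‖ := by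
  apply le_of_sq_le_sq _ (norm_nonneg _)
  rw [EuclideanSpace.norm_sq_eq, EuclideanSpace.norm_sq_eq]
  simp [proj12, Fin.sum_univ_two, Fin.sum_univ_three]
  positivity

lemma proj12_cont : Continuous proj12 := by
  unfold proj12; fun_prop

lemma coord_cont (i : Fin 3) : Continuous (fun x : E3 => x i) := by fun_prop

lemma closure_C {D₀ : ℝ} {C : Set E3} (h : IsCavity D₀ C) :
    closure C ⊆ {x | ‖x‖ ≤ 2*D₀ ∧ x 2 ≤ -D₀} := by
  obtain ⟨_, _, _, _, h5, h6, _⟩ := h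
  refine closure_minimal (fun x hx => ⟨(h5 hx).1.le, h6 x hx⟩) ?_
  exact (isClosed_le continuous_norm continuous_const).inter (isClosed_le (coord_cont 2) continuous_const)

lemma below_open (φ : E3 ≃ᵢ E3) {ψ : E2 → ℝ} (hψ : Continuous ψ) (r₀ : ℝ) :
    IsOpen {z : E3 | φ z ∈ ball (0:E3) r₀ ∧ (φ z) 2 < ψ (proj12 (φ z))} := by
  have h1 : Continuous (fun z : E3 => φ z) := φ.continuous
  have h2 : Continuous (fun z : E3 => (φ z) 2) := (coord_cont 2).comp h1
  have h3 : Continuous (fun z : E3 => ψ (proj12 (φ z))) := hψ.comp (proj12_cont.comp h1)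
  exact IsOpen.and (isOpen_ball.preimage h1) (isOpen_lt h2 h3)

set_option maxHeartbeats 1000000 in
lemma uc_exists (r₀ E₀ D₀ : ℝ) (hr₀ : 0 < r₀) (hE₀ : 0 < E₀) (hD₀ : 1 < D₀) :
    ∃ r > 0, ∃ c > 0, r ≤ 1/2 ∧ c ≤ 1/2 ∧ ∀ C, IsC3Cavity r₀ E₀ D₀ C → UC (Om C) r c := by
  refine ⟨min (r₀/2) (1/2), by positivity, min (1/2) (1/(1+E₀)), by positivity, min_le_right _ _, min_le_left _ _, ?_⟩
  set r := min (r₀/2) (1/2) with hr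
  set c := min (1/2) (1/(1+E₀)) with hc
  have hr1 : r ≤ r₀/2 := min_le_left _ _
  have hr2 : r ≤ 1/2 := min_le_right _ _
  have hc1 : c ≤ 1/2 := min_le_left _ _
  have hc2 : c * (1+E₀) ≤ 1 := by
    have : c ≤ 1/(1+E₀) := min_le_right _ _
    rwa [le_div_iff₀ (by positivity)] at this
  have hc0 : 0 < c := by positivity
  intro C hC P
  have hcl := closure_C hC.1
  by_cases hQ : ∃ Q ∈ frontier C, dist Q P < r
  · obtain ⟨Q, hQf, hQ⟩ := hQ
    obtain ⟨φ, ψ, h1, h2, h3, -, h5, h6⟩ := hC.2 Q hQf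
    set a := φ.toRealAffineIsometryEquiv with ha
    set Lm := a.linearIsometryEquiv with hLm
    have hadd : ∀ x y, φ (x + y) = φ x + Lm y := by
      intro x y
      have := a.map_vadd x y
      have e : (a : E3 → E3) = φ := φ.coeFn_toRealAffineIsometryEquiv
      rw [e] at this
      simp only [vadd_eq_add] at this
      rw [add_comm x y, this, add_comm]
    have hball : ∀ x ∈ ball P r, φ x ∈ ball (0:E3) r₀ := by
      intro x hx
      rw [mem_ball] at hx ⊢
      rw [← h1, φ.dist_eq]
      have := dist_triangle_right x Q P
      linarith
    have hin : ∀ x, φ x ∈ ball (0:E3) r₀ → (x ∈ C ↔ ψ (proj12 (φ x)) < (φ x) 2) := by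
      intro x hx
      have : φ x ∈ (φ '' C) ∩ Metric.ball 0 r₀ ↔ φ x ∈ {x ∈ Metric.ball (0 : E3) r₀ | ψ (proj12 x) < x 2} := by rw [h6]
      simp only [mem_inter_iff, hx, and_true, mem_ofPred_eq, true_and, φ.injective.mem_set_image] at this
      exact this
    have hlip : ∀ u ∈ ball (0:E2) r₀, ∀ v ∈ ball (0:E2) r₀, |ψ v - ψ u| ≤ E₀ * ‖v - u‖ := by
      intro u hu v hv
      refine (convex_ball (0:E2) r₀).norm_image_sub_le_of_norm_fderiv_le (𝕜 := ℝ)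
        (fun x hx => h3.differentiable (by simp) x) ?_ hu hv
      intro x hx
      have := h5 x hx 1 (by norm_num)
      rwa [norm_iteratedFDeriv_one] at this
    refine ⟨Lm.symm (-ee 2), by simp, ?_⟩
    intro x hx hxO t ht y hy hxy
    have hp : ∀ z ∈ ball (0:E3) r₀, proj12 z ∈ ball (0:E2) r₀ := by
      intro z hz
      rw [mem_ball_zero_iff] at *
      exact (proj12_norm z).trans_lt hz
    have hL : ‖Lm y + t • ee 2‖ < c * t := by
      have : Lm y + t • ee 2 = Lm (y - t • Lm.symm (-ee 2)) := by
        simp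
      rw [this, Lm.norm_map]; exact hy
    set v := Lm y + t • ee 2 with hv
    have hLy : Lm y = v + (-t) • ee 2 := by rw [hv, neg_smul]; abel
    have hv2 : (Lm y) 2 = v 2 - t := by rw [hLy]; simp; ring
    have hvp : proj12 (Lm y) = proj12 v := by
      rw [hLy]; ext i; fin_cases i <;> simp [proj12]
    have hxC : x ∉ C := fun h => hxO.2 (subset_closure h)
    have hx1 : (φ x) 2 ≤ ψ (proj12 (φ x)) := by
      have := (hin x (hball x hx)).not.1 hxC
      linarith
    have hl := hlip _ (hp _ (hball _ hxy)) _ (hp _ (hball x hx))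
    have hdiff : proj12 (φ x) - proj12 (φ (x+y)) = - proj12 v := by
      rw [hadd, proj12_add, hvp]; abel
    rw [hdiff, norm_neg] at hl
    have hvn := (proj12_norm v).trans_lt hL
    have hv2' := (le_abs_self _).trans ((coord_le v 2).trans hL.le)
    have hl2 : ψ (proj12 (φ x)) - ψ (proj12 (φ (x+y))) ≤ E₀ * (c * t) :=
      (le_abs_self _).trans (hl.trans (by gcongr))
    have hlt : (φ (x+y)) 2 < ψ (proj12 (φ (x+y))) := by
      have e : (φ (x+y)) 2 = (φ x) 2 + (v 2 - t) := by rw [hadd, ← hv2]; simp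
      have hv2s : v 2 < c * t := (le_abs_self _).trans_lt ((coord_le v 2).trans_lt hL)
      rw [e]
      nlinarith
    constructor
    · show (x+y) 2 < 0
      have hQ2 := (hcl (frontier_subset_closure hQf)).2
      have := (coord_le (x + y - Q) 2)
      rw [← dist_eq_norm] at this
      have h7 := dist_triangle_right (x+y) Q P
      rw [mem_ball] at hxy
      have h8 := (le_abs_self _).trans this
      simp only [PiLp.sub_apply] at h8
      linarith
    · have hop := below_open φ h3.continuous r₀
      intro hcl'
      obtain ⟨z, hz1, hz2⟩ := mem_closure_iff.1 hcl' _ hop ⟨hball _ hxy, hlt⟩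
      have := (hin z hz1.1).1 hz2
      linarith [hz1.2]
  · push Not at hQ
    refine ⟨-ee 2, by simp, ?_⟩
    intro x hx hxO t ht y hy hxy
    constructor
    · show (x+y) 2 < 0
      have h1 := (le_abs_self _).trans ((coord_le _ 2).trans hy.le)
      have h2 : x 2 < 0 := hxO.1
      simp at h1 ⊢
      nlinarith
    · intro hcl'
      have hpre := (convex_ball P r).isPreconnected
      obtain ⟨z, -, hz1, hz2⟩ := hpre C (closure C)ᶜ hC.1.1 isClosed_closure.isOpen_compl (by
          intro z hz
          by_cases hzc : z ∈ closure C
          · left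
            by_contra hzC
            have : z ∈ frontier C := by
              rw [hC.1.1.frontier_eq]; exact ⟨hzc, hzC⟩
            have := hQ z this
            rw [mem_ball] at hz; linarith
          · exact Or.inr hzc)
        ⟨x+y, hxy, by
          by_contra hzC
          have : x+y ∈ frontier C := by
              rw [hC.1.1.frontier_eq]; exact ⟨hcl', hzC⟩
          have := hQ _ this
          rw [mem_ball] at hxy; linarith⟩ ⟨x, hx, hxO.2⟩
      exact hz2 (subset_closure hz1)


/-! ### Propagation of smallness along chains of balls -/

/-- The three balls property with constants. -/
def TB (K θ β : ℝ) : Prop := 8 ≤ K ∧ 0 < θ ∧ 0 < β ∧ θ ≤ 1/2 ∧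
  ∀ (U : Set E3) (f : E3 → ℝ), IsOpen U → WB f U →
    ∀ (x : E3) (r M τ : ℝ), 0 < r → 0 ≤ M → closedBall x (K*r) ⊆ U →
    (∀ y ∈ closedBall x (K*r), |f y| ≤ M) →
    (∀ y ∈ closedBall x r, |f y| ≤ M * Real.exp (-τ)) → ∀ y ∈ closedBall x (2*r),
    |f y| ≤ M * Real.exp (-(θ*τ - β))

lemma TB_exists : ∃ K θ β, TB K θ β := by
  obtain ⟨K, h1, θ, h2, β, h3, h4, h5⟩ := three_balls
  exact ⟨K, θ, β, h1, h2, h3, h4, h5⟩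

/-- Smallness. -/
def Sm (f : E3 → ℝ) (M τ : ℝ) (x : E3) (r : ℝ) : Prop := ∀ y ∈ closedBall x r, |f y| ≤ M * Real.exp (-τ)

/-- Loss in one step. -/
def Phi (θ β τ : ℝ) : ℝ := θ * τ - β

lemma Phi_iter {θ β : ℝ} (h0 : 0 < θ) (h1 : θ ≤ 1/2) (hb : 0 < β) (τ : ℝ) (hτ : 0 ≤ τ) (n N : ℕ) (hn : n ≤ N) :
    θ^N * τ - 2*β ≤ (Phi θ β)^[n] τ := by
  have h : θ^n * τ - 2*β ≤ (Phi θ β)^[n] τ := by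
    clear hn
    induction n with
    | zero => simp; linarith
    | succ n ih =>
      rw [Function.iterate_succ_apply', pow_succ]
      unfold Phi at *
      nlinarith
  have : θ^N ≤ θ^n := pow_le_pow_of_le_one h0.le (by linarith) hn
  nlinarith

/-- Standing assumptions on the function. -/
def Good (f : E3 → ℝ) (Ω : Set E3) (M q : ℝ) : Prop :=
  IsOpen Ω ∧ WB f Ω ∧ 0 ≤ M ∧ 0 < q ∧ ∀ y, ball y q ⊆ Ω → |f y| ≤ M

lemma Sm_step {K θ β : ℝ} (hT : TB K θ β) {f : E3 → ℝ} {Ω : Set E3} {M q : ℝ} (hG : Good f Ω M q)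
    {x x' : E3} {r r' τ : ℝ} (hr : 0 < r) (hb : closedBall x (K*r+q) ⊆ Ω) (hd : dist x' x + r' ≤ 2*r)
    (h : Sm f M τ x r) : Sm f M (Phi θ β τ) x' r' := by
  obtain ⟨h1, h2, h3, h4, h5⟩ := hG
  have := hT.2.2.2.2 Ω f h1 h2 x r M τ hr h3
    ((closedBall_subset_closedBall (by linarith)).trans hb)
    (fun y hy => h5 y ((ball_subset_closedBall.trans (closedBall_subset_closedBall' (by
      rw [mem_closedBall] at hy; linarith))).trans hb)) h
  intro y hy
  exact this y (closedBall_subset_closedBall' (by linarith) hy)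

lemma split_vec (v : E3) {a b : ℝ} (ha : 0 ≤ a) (hb : 0 < b) (h : ‖v‖ ≤ a + b) :
    ∃ v1 v2, v = v1 + v2 ∧ ‖v1‖ ≤ a ∧ ‖v2‖ ≤ b := by
  refine ⟨(a/(a+b)) • v, (b/(a+b)) • v, ?_, ?_, ?_⟩
  · rw [← add_smul, ← add_div, div_self (by positivity), one_smul]
  · rw [norm_smul, Real.norm_of_nonneg (by positivity), div_mul_eq_mul_div, div_le_iff₀ (by positivity)]
    gcongr
  · rw [norm_smul, Real.norm_of_nonneg (by positivity), div_mul_eq_mul_div, div_le_iff₀ (by positivity)]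
    gcongr

lemma push {K θ β r c : ℝ} (hT : TB K θ β) (hr : 0 < r) (hc : 0 < c) (hc2 : c ≤ 1/2)
    {Ω : Set E3} {f : E3 → ℝ} {M ϱ : ℝ} {xb : E3} (hU : UC Ω r c) (hϱ : 0 < ϱ) (hG : Good f Ω M (ϱ/2))
    (hK : K * ϱ ≤ r/8) (hb : closedBall xb (2*K*ϱ) ⊆ Ω) :
    ∃ (n : ℕ) (z : E3), (1 + c/(16*K))^n ≤ r/ϱ ∧ closedBall z (c*r/32) ⊆ Ω ∧ dist z xb ≤ r ∧
      ∀ τ, Sm f M τ xb (ϱ/2) → Sm f M ((Phi θ β)^[n] τ) z (c*r/(64*K)) := by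
  have hK8 := hT.1
  have hK0 : 0 < K := by linarith
  obtain ⟨e, he, hcone⟩ := hU xb
  have hball : ∀ t, 0 ≤ t → t ≤ r/4 → closedBall (xb + t • e) (K*ϱ + c/4*t) ⊆ Ω := by
    intro t ht0 ht
    rcases ht0.eq_or_lt with rfl | htp
    · simp only [zero_smul, add_zero, mul_zero]
      exact (closedBall_subset_closedBall (by nlinarith)).trans hb
    · intro y hy
      rw [mem_closedBall, dist_eq_norm] at hy
      obtain ⟨v1, v2, hv, h1, h2⟩ := split_vec _ (show 0 ≤ K*ϱ by positivity) (show 0 < c/4*t by positivity) hy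
      have hy' : y = (xb + v1) + (t • e + v2) := by
        rw [sub_eq_iff_eq_add] at hv; rw [hv]; abel
      have hte : ‖t • e‖ = t := by rw [norm_smul, he, Real.norm_of_nonneg ht0, mul_one]
      rw [hy']
      refine hcone _ ?_ (hb ?_) t htp _ ?_ ?_
      · rw [mem_ball, dist_eq_norm, add_sub_cancel_left]; linarith
      · rw [mem_closedBall, dist_eq_norm, add_sub_cancel_left]; nlinarith
      · rw [add_sub_cancel_left]; nlinarith
      · rw [mem_ball, dist_eq_norm]
        have : xb + v1 + (t • e + v2) - xb = v1 + t • e + v2 := by abel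
        rw [this]
        have := norm_add₃_le (a := v1) (b := t • e) (c := v2)
        nlinarith
  set b := c/(8*K) with hbdef
  have hb0 : 0 < b := by positivity
  have hbK : b * K = c/8 := by rw [hbdef]; field_simp
  have hbs : b ≤ 1/64 := by nlinarith
  have hγ : c/(16*K) = b/2 := by rw [hbdef]; field_simp; norm_num
  rw [hγ]
  set rr : ℕ → ℝ := fun k => ϱ/2 * (1 + b/2)^k with hrr
  have hrr0 : ∀ k, ϱ/2 ≤ rr k := by
    intro k
    have : 1 ≤ (1+b/2)^k := one_le_pow₀ (by linarith)
    simp only [hrr]; nlinarith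
  have hrrs : ∀ k, rr (k+1) = rr k * (1 + b/2) := by intro k; simp only [hrr, pow_succ]; ring
  have hex : ∃ k, ϱ/2 + b*r/8 ≤ rr k := by
    obtain ⟨k, hk⟩ := pow_unbounded_of_one_lt ((ϱ/2 + b*r/8)/(ϱ/2)) (show 1 < 1 + b/2 by linarith)
    refine ⟨k, ?_⟩
    rw [div_lt_iff₀ (by positivity)] at hk
    simp only [hrr]; linarith
  classical
  set N := Nat.find hex with hN
  have hN1 : ϱ/2 + b*r/8 ≤ rr N := Nat.find_spec hex
  have hlt : ∀ k < N, rr k < ϱ/2 + b*r/8 := fun k hk => not_le.1 (Nat.find_min hex hk)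
  set tt : ℕ → ℝ := fun k => (rr k - ϱ/2)/b with htt
  have htb : ∀ k, b * tt k = rr k - ϱ/2 := by intro k; simp only [htt]; field_simp
  have htt0 : ∀ k, 0 ≤ tt k := fun k => div_nonneg (by linarith [hrr0 k]) hb0.le
  have htts : ∀ k, tt (k+1) = tt k + rr k / 2 := by
    intro k; simp only [htt, hrrs]; field_simp; ring
  have httlt : ∀ k < N, tt k < r/8 := by
    intro k hk
    have := hlt k hk
    have := htb k
    nlinarith
  have hϱr : ϱ ≤ r/64 := by nlinarith
  have hNbd : tt N ≤ r/4 ∧ rr N ≤ 2 * (ϱ/2 + b*r/8) := by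
    obtain ⟨m, hm⟩ : ∃ m, N = m + 1 := by
      refine Nat.exists_eq_succ_of_ne_zero ?_
      intro h0
      rw [h0] at hN1
      simp only [hrr, pow_zero, mul_one] at hN1
      nlinarith [mul_pos hb0 hr]
    have h1 := httlt m (by omega)
    have h2 := hlt m (by omega)
    have h3 := hrr0 m
    rw [hm, htts, hrrs]
    constructor <;> nlinarith
  have hin : ∀ k, tt k ≤ r/4 → closedBall (xb + tt k • e) (2*K*rr k) ⊆ Ω := by
    intro k hk
    have := hball (tt k) (htt0 k) hk
    have e1 : K*ϱ + c/4 * tt k = 2*K*rr k := by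
      have := htb k
      have e2 : c/4 = 2*K*b := by linarith
      rw [e2]; linear_combination 2*K*this
    rwa [e1] at this
  refine ⟨N, xb + tt N • e, ?_, ?_, ?_, ?_⟩
  · rw [le_div_iff₀ hϱ]
    have := hNbd.2
    simp only [hrr] at this
    nlinarith
  · refine (closedBall_subset_closedBall ?_).trans (hin N hNbd.1)
    nlinarith
  · rw [dist_eq_norm, add_sub_cancel_left, norm_smul, he, Real.norm_of_nonneg (htt0 N)]
    linarith [hNbd.1]
  · intro τ hτ
    have key : ∀ k ≤ N, Sm f M ((Phi θ β)^[k] τ) (xb + tt k • e) (rr k) := by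
      intro k
      induction k with
      | zero => intro _; simpa [htt, hrr] using hτ
      | succ k ih =>
        intro hk
        rw [Function.iterate_succ_apply']
        have h0 := hrr0 k
        refine Sm_step hT hG (x := xb + tt k • e) (r := rr k) (by linarith) ?_ ?_ (ih (by omega))
        · refine (closedBall_subset_closedBall ?_).trans (hin k (by linarith [httlt k (by omega)]))
          nlinarith
        · rw [dist_eq_norm, htts, hrrs]
          have : xb + (tt k + rr k / 2) • e - (xb + tt k • e) = (rr k / 2) • e := by
            rw [add_smul]; abel
          rw [this, norm_smul, he, Real.norm_of_nonneg (by linarith)]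
          nlinarith
    intro y hy
    refine key N le_rfl y (closedBall_subset_closedBall ?_ hy)
    have : c*r/(64*K) = b*r/8 := by rw [hbdef]; field_simp; norm_num
    rw [this]; linarith


/-! ### Uniform chains of balls -/

/-- Points with a ball of radius `h` inside. -/
def Wh (Ω : Set E3) (h : ℝ) : Set E3 := {z | closedBall z h ⊆ Ω}

/-- One link. -/
def Lk (Ω : Set E3) (h η : ℝ) (z z' : E3) : Prop := z ∈ Wh Ω h ∧ z' ∈ Wh Ω h ∧ dist z z' ≤ η

lemma Lk_symm {Ω : Set E3} {h η : ℝ} {z z' : E3} (H : Lk Ω h η z z') : Lk Ω h η z' z :=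
  ⟨H.2.1, H.1, by rw [dist_comm]; exact H.2.2⟩

lemma chain_seg {Ω : Set E3} {h η : ℝ} (hη : 0 < η) {z v : E3}
    (H : ∀ a ∈ Icc (0:ℝ) 1, z + a • v ∈ Wh Ω h) : Relation.ReflTransGen (Lk Ω h η) z (z + v) := by
  obtain ⟨n, hn⟩ := exists_nat_gt (‖v‖ / η)
  have hn0 : (0:ℝ) < n := lt_of_le_of_lt (by positivity) hn
  have hin : ∀ k : ℕ, k ≤ n → z + ((k:ℝ)/n) • v ∈ Wh Ω h := by
    intro k hk
    refine H _ ⟨by positivity, ?_⟩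
    rw [div_le_one hn0]; exact_mod_cast hk
  have key : ∀ k : ℕ, k ≤ n → Relation.ReflTransGen (Lk Ω h η) z (z + ((k:ℝ)/n) • v) := by
    intro k
    induction k with
    | zero => intro _; simpa using Relation.ReflTransGen.refl
    | succ k ih =>
      intro hk
      refine (ih (by omega)).tail ⟨hin k (by omega), hin (k+1) hk, ?_⟩
      rw [dist_eq_norm]
      have : z + ((k:ℝ)/n) • v - (z + (((k+1:ℕ):ℝ)/n) • v) = (-(1/(n:ℝ))) • v := by
        rw [add_sub_add_left_eq_sub, ← sub_smul]
        congr 1; push_cast; ring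
      rw [this, norm_smul, norm_neg, Real.norm_of_nonneg (by positivity)]
      rw [div_lt_iff₀ hη] at hn
      rw [div_mul_eq_mul_div, one_mul, div_le_iff₀ hn0]
      linarith
  have := key n le_rfl
  rwa [div_self hn0.ne', one_smul] at this

lemma chain_conn {Ω : Set E3} {r c h η : ℝ} (hr : 0 < r) (hc : 0 < c) (hc2 : c ≤ 1/2)
    (hh : h = c^2*r/128) (hη : 0 < η) (hU : UC Ω r c) (hO : IsOpen Ω) (hpre : IsPreconnected Ω)
    {z z' : E3} (hz : z ∈ Wh Ω h) (hz' : z' ∈ Wh Ω h) : Relation.ReflTransGen (Lk Ω h η) z z' := by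
  set δ := c*r/16 with hδ
  have hδ0 : 0 < δ := by positivity
  have hh0 : 0 < h := by rw [hh]; positivity
  have hcr : c * r ≤ r/2 := by nlinarith
  have hhr : h ≤ r/512 := by
    rw [hh]; nlinarith [mul_pos hc hr]
  have hsub : ∀ z ∈ Wh Ω h, z ∈ Ω := fun z hz => hz (mem_closedBall_self hh0.le)
  have hi : ∀ x ∈ Ω, ∃ z ∈ Wh Ω h, dist z x < δ := by
    intro x hx
    obtain ⟨e, he, hcone⟩ := hU x
    set t := c*r/64 with ht
    have ht0 : 0 < t := by positivity
    have hte : ‖t • e‖ = t := by rw [norm_smul, he, Real.norm_of_nonneg ht0.le, mul_one]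
    refine ⟨x + t • e, ?_, ?_⟩
    · intro y hy
      rw [mem_closedBall, dist_eq_norm] at hy
      have : y = x + (t • e + (y - (x + t • e))) := by abel
      rw [this]
      refine hcone x (mem_ball_self hr) hx t ht0 _ ?_ ?_
      · rw [add_sub_cancel_left]
        have : c * t = 2 * h := by rw [ht, hh]; ring
        linarith
      · rw [mem_ball, dist_eq_norm, add_sub_cancel_left]
        have := norm_add_le (t • e) (y - (x + t • e))
        linarith
    · rw [dist_eq_norm, add_sub_cancel_left, hte]; linarith
  have hii : ∀ x ∈ Ω, ∀ z ∈ Wh Ω h, ∀ z' ∈ Wh Ω h, dist z x < δ → dist z' x < δ →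
      Relation.ReflTransGen (Lk Ω h η) z z' := by
    intro x hx z hz z' hz' hd hd'
    obtain ⟨e, he, hcone⟩ := hU x
    set τ := 3*r/8 with hτ
    have hτ0 : 0 < τ := by positivity
    have hd1 : ‖z' - z‖ ≤ 2*δ := by
      rw [← dist_eq_norm]; have := dist_triangle_right z' z x; linarith
    -- general claim
    have claim : ∀ z ∈ Wh Ω h, dist z x < δ → ∀ s, 0 ≤ s → s ≤ τ → ∀ v : E3, (‖v‖ < c * s ∨ v = 0) → ‖v‖ ≤ 2*δ →
        z + (s • e + v) ∈ Wh Ω h := by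
      intro z hz hd s hs0 hs v hv hv2 y hy
      rw [mem_closedBall, dist_eq_norm] at hy
      set u := y - (z + (s • e + v)) with hu
      have hyu : y = (z + u) + (s • e + v) := by rw [hu]; abel
      have hzu : z + u ∈ Ω := hz (by rw [mem_closedBall, dist_eq_norm, add_sub_cancel_left]; exact hy)
      rcases hs0.eq_or_lt with rfl | hsp
      · have : v = 0 := by
          rcases hv with hv | hv
          · rw [mul_zero] at hv; exact absurd hv (not_lt.2 (norm_nonneg _))
          · exact hv
        rw [hyu, this]; simpa using hzu
      · rw [dist_eq_norm] at hd
        have hse : ‖s • e‖ = s := by rw [norm_smul, he, Real.norm_of_nonneg hs0, mul_one]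
        rw [hyu]
        refine hcone _ ?_ hzu s hsp _ ?_ ?_
        · rw [mem_ball, dist_eq_norm]
          have : z + u - x = (z - x) + u := by abel
          rw [this]
          have := norm_add_le (z-x) u
          linarith
        · rw [add_sub_cancel_left]
          rcases hv with hv | hv
          · exact hv
          · rw [hv, norm_zero]; positivity
        · rw [mem_ball, dist_eq_norm]
          have : z + u + (s • e + v) - x = ((z - x) + u) + (s • e + v) := by abel
          rw [this]
          have h1 := norm_add_le ((z-x)+u) (s • e + v)
          have h2 := norm_add_le (z-x) u
          have h3 := norm_add_le (s • e) v
          linarith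
    have up : ∀ z ∈ Wh Ω h, dist z x < δ → Relation.ReflTransGen (Lk Ω h η) z (z + τ • e) := by
      intro z hz hd
      refine chain_seg hη fun a ha => ?_
      have := claim z hz hd (a*τ) (by nlinarith [ha.1]) (by nlinarith [ha.2]) 0 (Or.inr rfl) (by simp; positivity)
      rwa [add_zero, mul_smul] at this
    have h1 := up z hz hd
    have h3 : Relation.ReflTransGen (Lk Ω h η) (z' + τ • e) z' := by
      have h4 := up z' hz' hd'
      have : Std.Symm (Lk Ω h η) := ⟨fun _ _ H => Lk_symm H⟩
      exact Relation.ReflTransGen.stdSymm.symm _ _ h4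
    have h2 : Relation.ReflTransGen (Lk Ω h η) (z + τ • e) (z' + τ • e) := by
      have e1 : z' + τ • e = (z + τ • e) + (z' - z) := by abel
      rw [e1]
      refine chain_seg hη fun a ha => ?_
      have hn : ‖a • (z' - z)‖ ≤ 2*δ := by
        rw [norm_smul, Real.norm_of_nonneg ha.1]
        nlinarith [norm_nonneg (z'-z), ha.1, ha.2]
      have := claim z hz hd τ hτ0.le le_rfl (a • (z' - z)) (Or.inl (by
        have : c * τ = 6 * δ := by rw [hτ, hδ]; ring
        linarith)) hn
      rwa [add_assoc]
    exact (h1.trans h2).trans h3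
  by_contra hnot
  set A : Set E3 := {x | ∃ y ∈ Wh Ω h, dist y x < δ ∧ Relation.ReflTransGen (Lk Ω h η) z y}
  set B : Set E3 := {x | ∃ y ∈ Wh Ω h, dist y x < δ ∧ ¬ Relation.ReflTransGen (Lk Ω h η) z y}
  have hA : IsOpen A := by
    have : A = ⋃ y ∈ {y | y ∈ Wh Ω h ∧ Relation.ReflTransGen (Lk Ω h η) z y}, ball y δ := by
      ext x
      simp only [A, mem_iUnion, mem_ball, exists_prop, mem_ofPred_eq]
      constructor
      · rintro ⟨y, h1, h2, h3⟩; exact ⟨y, ⟨h1, h3⟩, by rwa [dist_comm]⟩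
      · rintro ⟨y, ⟨h1, h3⟩, h2⟩; exact ⟨y, h1, by rwa [dist_comm], h3⟩
    rw [this]
    exact isOpen_biUnion fun _ _ => isOpen_ball
  have hB : IsOpen B := by
    have : B = ⋃ y ∈ {y | y ∈ Wh Ω h ∧ ¬ Relation.ReflTransGen (Lk Ω h η) z y}, ball y δ := by
      ext x
      simp only [B, mem_iUnion, mem_ball, exists_prop, mem_ofPred_eq]
      constructor
      · rintro ⟨y, h1, h2, h3⟩; exact ⟨y, ⟨h1, h3⟩, by rwa [dist_comm]⟩
      · rintro ⟨y, ⟨h1, h3⟩, h2⟩; exact ⟨y, h1, by rwa [dist_comm], h3⟩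
    rw [this]
    exact isOpen_biUnion fun _ _ => isOpen_ball
  obtain ⟨x, hx, ⟨y, hy1, hy2, hy3⟩, ⟨y', hy1', hy2', hy3'⟩⟩ := hpre A B hA hB
    (by
      intro x hx
      obtain ⟨y, hy, hd⟩ := hi x hx
      by_cases H : Relation.ReflTransGen (Lk Ω h η) z y
      · exact Or.inl ⟨y, hy, hd, H⟩
      · exact Or.inr ⟨y, hy, hd, H⟩)
    ⟨z, hsub z hz, z, hz, by simpa using hδ0, Relation.ReflTransGen.refl⟩
    ⟨z', hsub z' hz', z', hz', by simpa using hδ0, hnot⟩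
  exact hy3' (hy3.trans (hii x hx y hy1 y' hy1' hy2 hy2'))

def clampv (L : ℝ) (x : E3) : E3 := !₂[max (-L) (min L (x 0)), max (-L) (min L (x 1)), max (-L) (x 2)]

lemma clamp_abs (L a b : ℝ) : |max (-L) (min L a) - max (-L) (min L b)| ≤ |a - b| :=
  (abs_max_sub_max_le_max _ _ _ _).trans (by
    simp only [sub_self, abs_zero]
    refine max_le (abs_nonneg _) ((abs_min_sub_min_le_max _ _ _ _).trans ?_)
    simp)

lemma clampv_dist (L : ℝ) (x y : E3) : dist (clampv L x) (clampv L y) ≤ dist x y := by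
  rw [EuclideanSpace.dist_eq, EuclideanSpace.dist_eq]
  apply Real.sqrt_le_sqrt
  simp only [Fin.sum_univ_three, Real.dist_eq, clampv]
  simp only [Matrix.cons_val_zero, Matrix.cons_val_one, Matrix.cons_val]
  have h1 := clamp_abs L (x 0) (y 0)
  have h2 := clamp_abs L (x 1) (y 1)
  have h3 : |max (-L) (x 2) - max (-L) (y 2)| ≤ |x 2 - y 2| :=
    (abs_max_sub_max_le_max _ _ _ _).trans (by simp)
  gcongr

/-- The box. -/
def Bx (L : ℝ) : Set E3 := {x | |x 0| ≤ L ∧ |x 1| ≤ L ∧ -L ≤ x 2}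

lemma clampv_mem {L : ℝ} (hL : 0 ≤ L) (x : E3) : clampv L x ∈ Bx L := by
  simp only [Bx, clampv, mem_ofPred_eq, Matrix.cons_val_zero, Matrix.cons_val_one, Matrix.cons_val, abs_le]
  refine ⟨⟨le_max_left _ _, max_le (by linarith) (min_le_left _ _)⟩,
    ⟨le_max_left _ _, max_le (by linarith) (min_le_left _ _)⟩, le_max_left _ _⟩

lemma clampv_id {L : ℝ} {x : E3} (hx : x ∈ Bx L) : clampv L x = x := by
  obtain ⟨h1, h2, h3⟩ := hx
  rw [abs_le] at h1 h2
  ext i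
  fin_cases i <;> simp [clampv]
  · rw [min_eq_right h1.2, max_eq_right h1.1]
  · rw [min_eq_right h2.2, max_eq_right h2.1]
  · exact h3

lemma clamp1_cases {L : ℝ} (hL : 0 ≤ L) (a : ℝ) : max (-L) (min L a) = a ∨ |max (-L) (min L a)| = L := by
  rcases le_total a L with h | h
  · rw [min_eq_right h]
    rcases le_total (-L) a with h' | h'
    · left; exact max_eq_right h'
    · right; rw [max_eq_left h', abs_neg, abs_of_nonneg hL]
  · right; rw [min_eq_left h, max_eq_right (by linarith), abs_of_nonneg hL]

lemma clampv_Wh {D₀ L h : ℝ} {C : Set E3} (hC : IsCavity D₀ C) (hD : 0 < D₀) (hh : h ≤ 1/2) (hL : 2*D₀ + 1 ≤ L)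
    {z : E3} (hz : z ∈ Wh (Om C) h) : clampv L z ∈ Wh (Om C) h := by
  intro y hy
  have hcl := closure_C hC
  have hL0 : 0 ≤ L := by linarith
  rw [mem_closedBall, dist_eq_norm] at hy
  have hc : ∀ i, |y i - clampv L z i| ≤ h := fun i => by
    have := (coord_le (y - clampv L z) i).trans hy
    simpa using this
  have hz' : z + (y - clampv L z) ∈ Om C := hz (by rw [mem_closedBall, dist_eq_norm, add_sub_cancel_left]; exact hy)
  have hbig : ∀ i, |clampv L z i| = L → y ∉ closure C := by
    intro i hi hyc
    have h1 := (hcl hyc).1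
    have h2 := coord_le y i
    have h3 := hc i
    have h4 : |clampv L z i| ≤ |y i| + |y i - clampv L z i| := by
      rw [abs_sub_comm]; have := abs_sub_abs_le_abs_sub (clampv L z i) (y i); linarith
    linarith
  have h2c : clampv L z 2 = z 2 ∨ clampv L z 2 = -L := by
    have : clampv L z 2 = max (-L) (z 2) := by simp [clampv]
    rw [this]
    rcases le_total (-L) (z 2) with h | h
    · left; exact max_eq_right h
    · right; exact max_eq_left h
  have hy2 : y 2 < 0 := by
    rcases h2c with h | h
    · have h1 : (z + (y - clampv L z)) 2 < 0 := hz'.1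
      simp only [PiLp.add_apply, PiLp.sub_apply, h] at h1
      linarith
    · have := (abs_le.1 (hc 2)).2
      rw [h] at this
      linarith
  refine ⟨hy2, ?_⟩
  have h0 : clampv L z 0 = max (-L) (min L (z 0)) := by simp [clampv]
  have h1 : clampv L z 1 = max (-L) (min L (z 1)) := by simp [clampv]
  rcases clamp1_cases hL0 (z 0) with e0 | e0
  swap
  · exact hbig 0 (by rw [h0, e0])
  rcases clamp1_cases hL0 (z 1) with e1 | e1
  swap
  · exact hbig 1 (by rw [h1, e1])
  rcases h2c with e2 | e2
  swap
  · exact hbig 2 (by rw [e2, abs_neg, abs_of_nonneg hL0])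
  have : clampv L z = z := by
    ext i; fin_cases i
    · exact h0.trans e0
    · exact h1.trans e1
    · exact e2
  rw [this] at hz'
  have h5 : z + (y - z) = y := by abel
  rw [h5] at hz'
  exact hz'.2

lemma Bx_norm {L : ℝ} (hL : 0 ≤ L) {x : E3} (hx : x ∈ Bx L) (h2 : x 2 < 0) : x ∈ closedBall (0:E3) (2*L) := by
  obtain ⟨h0, h1, h3⟩ := hx
  rw [mem_closedBall_zero_iff]
  apply abs_le_of_sq_le_sq' _ (by positivity) |>.2
  rw [EuclideanSpace.norm_sq_eq]
  simp only [Fin.sum_univ_three, Real.norm_eq_abs, sq_abs]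
  have a0 := sq_le_sq' (abs_le.1 h0).1 (abs_le.1 h0).2
  have a1 := sq_le_sq' (abs_le.1 h1).1 (abs_le.1 h1).2
  have a2 := sq_le_sq' h3 (by linarith)
  nlinarith

lemma graph {K θ β r c D₀ L : ℝ} (hT : TB K θ β) (hr : 0 < r) (hr2 : r ≤ 1/2) (hc : 0 < c) (hc2 : c ≤ 1/2)
    (hD : 0 < D₀) (hL : 2*D₀ + 1 ≤ L) :
    ∃ N₀ : ℕ, ∀ C, IsCavity D₀ C → UC (Om C) r c → ∀ (f : E3 → ℝ) (M q : ℝ), Good f (Om C) M q →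
      q ≤ c^2*r/128/2 → ∀ z ∈ Wh (Om C) (c^2*r/128), ∀ z' ∈ Wh (Om C) (c^2*r/128), z ∈ Bx L → z' ∈ Bx L →
      ∃ n ≤ N₀, ∀ τ, Sm f M τ z (c^2*r/128/(4*K)) → |f z'| ≤ M * Real.exp (-((Phi θ β)^[n] τ)) := by
  set h := c^2*r/128 with hh
  have hh0 : 0 < h := by positivity
  have hK8 := hT.1
  have hK0 : 0 < K := by linarith
  set rs := h/(4*K) with hrs
  have hrs0 : 0 < rs := by positivity
  have hKrs : K * rs = h/4 := by rw [hrs]; field_simp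
  set η := rs/4 with hη
  have hη0 : 0 < η := by positivity
  have hL0 : 0 ≤ L := by linarith
  have hh2 : h ≤ 1/2 := by rw [hh]; nlinarith [mul_pos hc hr, mul_pos hc hc]
  obtain ⟨t, -, htf, ht⟩ := (isCompact_closedBall (0:E3) (2*L)).finite_cover_balls hη0
  classical
  set F := htf.toFinset with hF
  refine ⟨F.card + 1, ?_⟩
  intro C hC hU f M q hG hq z hz z' hz' hzb hzb'
  have hΩ := Om_open C
  have hsub : ∀ z ∈ Wh (Om C) h, z 2 < 0 := fun z hz => (hz (mem_closedBall_self hh0.le)).1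
  have hchain := chain_conn (η := η) hr hc hc2 hh hη0 hU hΩ hC.2.2.2.1.isPreconnected hz hz'
  set LB : E3 → E3 → Prop := fun a b => Lk (Om C) h η a b ∧ a ∈ Bx L ∧ b ∈ Bx L with hLB
  have hchain2 : Relation.ReflTransGen LB z z' := by
    have := Relation.ReflTransGen.lift (r := Lk (Om C) h η) (p := LB) (clampv L) (fun a b hab =>
      ⟨⟨clampv_Wh hC hD hh2 hL hab.1, clampv_Wh hC hD hh2 hL hab.2.1, (clampv_dist L a b).trans hab.2.2⟩,
        clampv_mem hL0 a, clampv_mem hL0 b⟩) _ _ hchain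
    rwa [Function.onFun, clampv_id hzb, clampv_id hzb'] at this
  -- net points
  have hnet : ∀ y ∈ Wh (Om C) h, y ∈ Bx L → ∃ p : F, dist y p ≤ η := by
    intro y hy hyb
    obtain ⟨p, hp1, hp2⟩ := mem_iUnion₂.1 (ht (Bx_norm hL0 hyb (hsub y hy)))
    exact ⟨⟨p, by rw [hF, htf.mem_toFinset]; exact hp1⟩, (mem_ball.1 hp2).le⟩
  let near : F → Prop := fun p => ∃ y ∈ Wh (Om C) h, dist y p ≤ η
  let G : SimpleGraph F :=
    { Adj := fun p p' => p ≠ p' ∧ dist (p:E3) p' ≤ 3*η ∧ near p ∧ near p'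
      symm := ⟨fun p p' H => ⟨H.1.symm, by rw [dist_comm]; exact H.2.1, H.2.2.2, H.2.2.1⟩⟩
      loopless := ⟨fun p H => H.1 rfl⟩ }
  obtain ⟨p0, hp0⟩ := hnet z hz hzb
  obtain ⟨p1, hp1⟩ := hnet z' hz' hzb'
  have hadj : ∀ p p' : F, near p → near p' → dist (p:E3) p' ≤ 3*η → G.Reachable p p' := by
    intro p p' h1 h2 h3
    by_cases e : p = p'
    · rw [e]
    · exact SimpleGraph.Adj.reachable ⟨e, h3, h1, h2⟩
  have hreach : ∀ y, Relation.ReflTransGen LB z y → ∀ p : F, y ∈ Wh (Om C) h → dist y p ≤ η → G.Reachable p0 p := by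
    intro y hy
    induction hy with
    | refl =>
      intro p _ hp
      refine hadj p0 p ⟨z, hz, hp0⟩ ⟨z, hz, hp⟩ ?_
      have := dist_triangle_left (p0:E3) p z
      linarith
    | tail hab hbc ih =>
      rename_i b c'
      intro p hy hp
      obtain ⟨pb, hpb⟩ := hnet b hbc.1.1 hbc.2.1
      refine (ih pb hbc.1.1 hpb).trans (hadj pb p ⟨b, hbc.1.1, hpb⟩ ⟨c', hy, hp⟩ ?_)
      have h1 := dist_triangle4 (pb:E3) b c' p
      have h2 := hbc.1.2.2
      rw [dist_comm] at hpb
      linarith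
  obtain ⟨w, hw⟩ := (hreach z' hchain2 p1 hz' hp1).exists_isPath
  have hlen := hw.length_lt
  rw [Fintype.card_coe] at hlen
  have hballp : ∀ p : F, near p → closedBall (p:E3) (K*rs+q) ⊆ Om C := by
    rintro p ⟨y, hy, hd⟩
    refine (closedBall_subset_closedBall' ?_).trans hy
    rw [dist_comm, hKrs]
    have : η ≤ h/8 := by nlinarith
    linarith
  have hwalk : ∀ (a b : F) (w : G.Walk a b) (τ : ℝ), Sm f M τ a rs → Sm f M ((Phi θ β)^[w.length] τ) b rs := by
    intro a b w
    induction w with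
    | nil => intro τ hτ; simpa using hτ
    | cons hh w ih =>
      intro τ hτ
      rw [SimpleGraph.Walk.length_cons, Function.iterate_succ_apply]
      refine ih _ ?_
      refine Sm_step hT hG hrs0 (hballp _ hh.2.2.1) ?_ hτ
      rw [dist_comm]
      have := hh.2.1
      linarith
  refine ⟨w.length + 1, by omega, ?_⟩
  intro τ hτ
  rw [Function.iterate_succ_apply]
  have hs1 : Sm f M (Phi θ β τ) p0 rs := by
    refine Sm_step hT hG hrs0 ?_ ?_ hτ
    · refine (closedBall_subset_closedBall ?_).trans hz
      rw [hKrs]; linarith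
    · rw [dist_comm]; linarith
  exact hwalk p0 p1 w _ hs1 z' (by rw [mem_closedBall]; linarith)


/-! ### Weak form and weak biharmonicity -/

/-- Stress. -/
def sg (lam mu : ℝ) (w : E3 → E3) (x : E3) (i j : Fin 3) : ℝ :=
  lam * divg w x * (if i = j then 1 else 0) + mu * (jac w x i j + jac w x j i)

lemma jac_smul {φ : E3 → ℝ} (hφ : ContDiff ℝ ∞ φ) (i a b : Fin 3) (x : E3) :
    jac (fun x => φ x • ee i) x a b = DD (ee b) φ x * (if a = i then 1 else 0) := by
  unfold jac
  rw [fderiv_smul_const (hφ.differentiable (by simp) x)]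
  simp [DD]

lemma weak_form {lam mu p : ℝ} {C : Set E3} {w : E3 → E3} (h : IsNormalizedSolution lam mu p C w)
    {φ : E3 → ℝ} (hφ : ContDiff ℝ ∞ φ) (hc : HasCompactSupport φ) (i : Fin 3) :
    ∫ x in Om C, ∑ j, sg lam mu w x i j * DD (ee j) φ x =
      -p * ∫ x' : E2, if i = 2 then φ (emb2 x') else 0 := by
  have h1 := h.2.2.2.2 (fun x => φ x • ee i) (hφ.smul contDiff_const) hc.smul_right
  have e1 : ∀ x' : E2, (φ (emb2 x') • ee i) 2 = if i = 2 then φ (emb2 x') else 0 := by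
    intro x'; fin_cases i <;> simp
  simp only [e1] at h1
  rw [← h1]
  congr 1
  funext x
  simp only [divg, strain, sg, jac_smul hφ, Fin.sum_univ_three]
  fin_cases i <;> simp <;> ring

lemma comp_contDiffOn {w : E3 → E3} {U : Set E3} (hw : ContDiffOn ℝ 1 w U) (i : Fin 3) :
    ContDiffOn ℝ 1 (fun x => w x i) U :=
  (contDiff_euclidean.1 contDiff_id i).comp_contDiffOn hw

lemma jac_eq {w : E3 → E3} {U : Set E3} (hU : IsOpen U) (hw : ContDiffOn ℝ 1 w U) {x : E3} (hx : x ∈ U)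
    (i j : Fin 3) : jac w x i j = DD (ee j) (fun x => w x i) x := by
  have hd : DifferentiableAt ℝ w x := (hw.differentiableOn (by simp) x hx).differentiableAt (hU.mem_nhds hx)
  have h2 : HasFDerivAt (fun x => w x i) ((EuclideanSpace.proj (𝕜 := ℝ) i).comp (fderiv ℝ w x)) x :=
    (EuclideanSpace.proj i : E3 →L[ℝ] ℝ).hasFDerivAt.comp x hd.hasFDerivAt
  unfold DD
  rw [h2.fderiv]
  rfl

lemma DD_lin4 {f g h k : E3 → ℝ} (hf : ContDiff ℝ ∞ f) (hg : ContDiff ℝ ∞ g) (hh : ContDiff ℝ ∞ h)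
    (hk : ContDiff ℝ ∞ k) (a b c e : ℝ) (d : E3) :
    DD d (fun x => a * f x + b * g x + c * h x + e * k x) =
      fun x => a * DD d f x + b * DD d g x + c * DD d h x + e * DD d k x := by
  have hf' : ContDiff ℝ ∞ (fun x => a * f x) := contDiff_const.mul hf
  have hg' : ContDiff ℝ ∞ (fun x => b * g x) := contDiff_const.mul hg
  have hh' : ContDiff ℝ ∞ (fun x => c * h x) := contDiff_const.mul hh
  have hk' : ContDiff ℝ ∞ (fun x => e * k x) := contDiff_const.mul hk
  rw [DD_add ((hf'.add hg').add hh') hk', DD_add (hf'.add hg') hh', DD_add hf' hg',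
    DD_const_mul hf, DD_const_mul hg, DD_const_mul hh, DD_const_mul hk]

lemma emb2_not {C : Set E3} (x' : E2) : emb2 x' ∉ Om C := by
  intro h
  have : (emb2 x') 2 < 0 := h.1
  simp [emb2] at this

lemma wb_w0 {lam mu p : ℝ} (hmu : 0 < mu) (hlam : 0 < 3*lam+2*mu) {C : Set E3} {w : E3 → E3}
    (h : IsNormalizedSolution lam mu p C w) : WB (fun x => w x 0) (Om C) := by
  have hU := Om_open C
  have hw : ContDiffOn ℝ 1 w (Om C) := h.2.1
  refine ⟨(comp_contDiffOn hw 0).continuousOn, ?_⟩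
  intro G hG hGc hGs
  have hl := lapl_contDiff hG
  have hD := fun i => DD_contDiff hG (ee i)
  -- the test field
  set v : Fin 3 → E3 → ℝ := fun i x => ((lam+2*mu) * (if i = 0 then 1 else 0)) * lapl G x
    + (-(lam+mu)) * DD (ee i) (DD (ee 0) G) x + 0 * G x + 0 * G x with hv
  have hDD := fun i j => DD_contDiff (hD j) (ee i)
  have hvs : ∀ i, ContDiff ℝ ∞ (v i) := by
    intro i
    exact (((contDiff_const.mul hl).add (contDiff_const.mul (hDD i 0))).add (contDiff_const.mul hG)).add
      (contDiff_const.mul hG)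
  have hsupp : ∀ x ∉ tsupport G, ∀ f : E3 → ℝ, tsupport f ⊆ tsupport G → f x = 0 := by
    intro x hx f hf
    exact image_eq_zero_of_notMem_tsupport (fun h => hx (hf h))
  have hts0 := (DD_tsupport (DD (ee 0) G) (ee 0)).trans (DD_tsupport G (ee 0))
  have htsl := lapl_tsupport G
  have hsub : ∀ f : E3 → ℝ, (∀ x ∉ tsupport G, f x = 0) → tsupport f ⊆ tsupport G := by
    intro f hf
    refine closure_minimal ?_ (isClosed_tsupport G)
    intro x hx
    by_contra hn
    exact hx (hf x hn)
  have hvt : ∀ i, tsupport (v i) ⊆ tsupport G := by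
    intro i
    refine hsub _ fun x hx => ?_
    simp only [hv]
    rw [hsupp x hx _ htsl, hsupp x hx _ ((DD_tsupport _ _).trans (DD_tsupport G _)),
      hsupp x hx _ subset_rfl]
    ring
  have hvc : ∀ i, HasCompactSupport (v i) := fun i =>
    HasCompactSupport.of_support_subset_isCompact hGc ((subset_tsupport _).trans (hvt i))
  have hDv : ∀ i j, DD (ee j) (v i) = fun x => ((lam+2*mu) * (if i = 0 then 1 else 0)) * DD (ee j) (lapl G) x
    + (-(lam+mu)) * DD (ee j) (DD (ee i) (DD (ee 0) G)) x + 0 * DD (ee j) G x + 0 * DD (ee j) G x :=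
    fun i j => DD_lin4 hl (hDD i 0) hG hG _ _ _ _ _
  -- the stress of the test field
  set s : Fin 3 → Fin 3 → E3 → ℝ := fun i j x => (lam * mu * (if i = j then 1 else 0)) * DD (ee 0) (lapl G) x
    + (mu * (lam+2*mu) * (if i = 0 then 1 else 0)) * DD (ee j) (lapl G) x
    + (mu * (lam+2*mu) * (if j = 0 then 1 else 0)) * DD (ee i) (lapl G) x
    + (-2*mu*(lam+mu)) * DD (ee j) (DD (ee i) (DD (ee 0) G)) x with hs
  have hDl := fun i => DD_contDiff hl (ee i)
  have hDDD := fun i j => DD_contDiff (hDD i 0) (ee j)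
  have hss : ∀ i j, ContDiff ℝ ∞ (s i j) := by
    intro i j
    exact (((contDiff_const.mul (hDl 0)).add (contDiff_const.mul (hDl j))).add (contDiff_const.mul (hDl i))).add
      (contDiff_const.mul (hDDD i j))
  have hst : ∀ i j, tsupport (s i j) ⊆ tsupport G := by
    intro i j
    refine hsub _ fun x hx => ?_
    simp only [hs]
    rw [hsupp x hx _ ((DD_tsupport _ _).trans htsl), hsupp x hx _ ((DD_tsupport _ (ee j)).trans htsl),
      hsupp x hx _ ((DD_tsupport _ (ee i)).trans htsl),
      hsupp x hx _ ((DD_tsupport _ (ee j)).trans ((DD_tsupport _ _).trans (DD_tsupport G _)))]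
    ring
  have hsc : ∀ i j, HasCompactSupport (s i j) := fun i j =>
    HasCompactSupport.of_support_subset_isCompact hGc ((subset_tsupport _).trans (hst i j))
  have hdivl : ∀ x, DD (ee 0) (lapl G) x = DD (ee 0) (DD (ee 0) (DD (ee 0) G)) x
     + DD (ee 1) (DD (ee 1) (DD (ee 0) G)) x + DD (ee 2) (DD (ee 2) (DD (ee 0) G)) x := by
    intro x
    rw [DD_lapl hG]
    simp only [lapl, Fin.sum_univ_three]
  have hsym : ∀ i j, DD (ee j) (DD (ee i) (DD (ee 0) G)) = DD (ee i) (DD (ee j) (DD (ee 0) G)) :=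
    fun i j => DD_comm (hD 0) _ _
  -- pointwise identity
  have hpt : ∀ x, ∑ i, ∑ j, sg lam mu w x i j * DD (ee j) (v i) x = ∑ i, ∑ j, jac w x i j * s i j x := by
    intro x
    simp only [hDv, hs, sg, divg, Fin.sum_univ_three, hdivl]
    have e1 := congrFun (hsym 0 1) x
    have e2 := congrFun (hsym 0 2) x
    have e3 := congrFun (hsym 1 2) x
    rw [e1, e2, e3]
    simp
    ring
  have hdiv : ∀ i x, ∑ j, DD (ee j) (s i j) x = (mu*(lam+2*mu) * (if i = 0 then 1 else 0)) * lapl (lapl G) x := by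
    intro i x
    have e : ∀ j, DD (ee j) (s i j) x = (lam * mu * (if i = j then 1 else 0)) * DD (ee j) (DD (ee 0) (lapl G)) x
    + (mu * (lam+2*mu) * (if i = 0 then 1 else 0)) * DD (ee j) (DD (ee j) (lapl G)) x
    + (mu * (lam+2*mu) * (if j = 0 then 1 else 0)) * DD (ee j) (DD (ee i) (lapl G)) x
    + (-2*mu*(lam+mu)) * DD (ee j) (DD (ee j) (DD (ee i) (DD (ee 0) G))) x := by
      intro j
      have := DD_lin4 (hDl 0) (hDl j) (hDl i) (hDDD i j) (lam * mu * (if i = j then 1 else 0))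
        (mu * (lam+2*mu) * (if i = 0 then 1 else 0)) (mu * (lam+2*mu) * (if j = 0 then 1 else 0)) (-2*mu*(lam+mu)) (ee j)
      exact congrFun this x
    simp only [e]
    have e4 : DD (ee i) (DD (ee 0) (lapl G)) x = ∑ j, DD (ee j) (DD (ee j) (DD (ee i) (DD (ee 0) G))) x := by
      rw [DD_lapl hG, DD_lapl (hD 0)]; rfl
    have e5 : DD (ee 0) (DD (ee i) (lapl G)) x = DD (ee i) (DD (ee 0) (lapl G)) x :=
      congrFun (DD_comm hl _ _) x
    have e6 : lapl (lapl G) x = ∑ j, DD (ee j) (DD (ee j) (lapl G)) x := rfl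
    rw [Finset.sum_add_distrib, Finset.sum_add_distrib, Finset.sum_add_distrib, ← Finset.mul_sum, ← Finset.mul_sum, ← e4, ← e6]
    simp only [mul_ite, mul_one, mul_zero, ite_mul, zero_mul, Finset.sum_ite_eq, Finset.mem_univ, if_true, Finset.sum_ite_eq']
    rw [e5]
    ring
  -- combine
  have hzero : ∫ x in Om C, ∑ i, ∑ j, sg lam mu w x i j * DD (ee j) (v i) x = 0 := by
    have hcont : ∀ i j, ContinuousOn (fun x => jac w x i j) (Om C) := by
      intro i j
      exact (DD_continuousOn hU (comp_contDiffOn hw i) (ee j)).congr fun x hx => jac_eq hU hw hx i j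
    have hsgc : ∀ i j, ContinuousOn (fun x => sg lam mu w x i j) (Om C) := by
      intro i j
      unfold sg divg
      refine ContinuousOn.add (ContinuousOn.mul (continuousOn_const.mul
        (continuousOn_finsetSum _ fun i _ => hcont i i)) continuousOn_const) ?_
      exact continuousOn_const.mul ((hcont i j).add (hcont j i))
    have hIntg : ∀ i, Integrable (fun x => ∑ j, sg lam mu w x i j * DD (ee j) (v i) x) := by
      intro i
      refine integrable_finsetSum _ fun j _ => ?_
      exact integrable_mul_of_tsupport hU (hsgc i j) (DD_contDiff (hvs i) _).continuous (DD_hcs (hvc i) _)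
        ((DD_tsupport _ _).trans ((hvt i).trans hGs))
    rw [integral_finsetSum _ fun i _ => (hIntg i).integrableOn]
    refine Finset.sum_eq_zero fun i _ => ?_
    rw [weak_form h (hvs i) (hvc i) i]
    have : ∀ x' : E2, v i (emb2 x') = 0 := fun x' =>
      image_eq_zero_of_notMem_tsupport fun hx => emb2_not x' (hGs (hvt i hx))
    simp [this]
  have h1 : ∫ x in Om C, ∑ i, ∑ j, sg lam mu w x i j * DD (ee j) (v i) x
      = ∫ x, ∑ i, ∑ j, DD (ee j) (fun x => w x i) x * s i j x := by
    simp only [hpt]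
    rw [← integral_indicator hU.measurableSet]
    congr 1
    funext x
    by_cases hx : x ∈ Om C
    · rw [indicator_of_mem hx]
      simp only [jac_eq hU hw hx]
    · rw [indicator_of_notMem hx]
      symm
      refine Finset.sum_eq_zero fun i _ => Finset.sum_eq_zero fun j _ => ?_
      rw [image_eq_zero_of_notMem_tsupport (f := s i j) (fun h => hx (hGs (hst i j h))), mul_zero]
  rw [h1] at hzero
  have hi1 : ∀ i j, Integrable (fun x => DD (ee j) (fun x => w x i) x * s i j x) := fun i j =>
    integrable_mul_of_tsupport hU (DD_continuousOn hU (comp_contDiffOn hw i) (ee j)) (hss i j).continuous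
      (hsc i j) ((hst i j).trans hGs)
  have hi2 : ∀ i j, Integrable (fun x => w x i * DD (ee j) (s i j) x) := fun i j =>
    integrable_mul_of_tsupport hU (comp_contDiffOn hw i).continuousOn (DD_contDiff (hss i j) _).continuous
      (DD_hcs (hsc i j) _) ((DD_tsupport _ _).trans ((hst i j).trans hGs))
  have h2 : ∫ x, ∑ i, ∑ j, DD (ee j) (fun x => w x i) x * s i j x = -∫ x, ∑ i, ∑ j, w x i * DD (ee j) (s i j) x := by
    rw [integral_finsetSum _ fun i _ => integrable_finsetSum _ fun j _ => hi1 i j,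
      integral_finsetSum _ fun i _ => integrable_finsetSum _ fun j _ => hi2 i j, ← Finset.sum_neg_distrib]
    refine Finset.sum_congr rfl fun i _ => ?_
    rw [integral_finsetSum _ fun j _ => hi1 i j, integral_finsetSum _ fun j _ => hi2 i j, ← Finset.sum_neg_distrib]
    refine Finset.sum_congr rfl fun j _ => ?_
    rw [ibp hU (comp_contDiffOn hw i) (hss i j) (hsc i j) ((hst i j).trans hGs) (ee j), neg_neg]
  rw [h2] at hzero
  have h3 : ∀ x, ∑ i, ∑ j, w x i * DD (ee j) (s i j) x = (mu*(lam+2*mu)) * (w x 0 * lapl (lapl G) x) := by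
    intro x
    simp only [← Finset.mul_sum, hdiv]
    simp [Fin.sum_univ_three]
    ring
  simp only [h3] at hzero
  rw [integral_const_mul] at hzero
  have hne : mu*(lam+2*mu) ≠ 0 := by
    have : 0 < lam + 2*mu := by linarith
    positivity
  rcases mul_eq_zero.1 (neg_eq_zero.1 hzero) with h | h
  · exact absurd h hne
  · exact h

lemma wb_f {lam mu p : ℝ} (hmu : 0 < mu) (hlam : 0 < 3*lam+2*mu) {C : Set E3} {w : E3 → E3}
    (h : IsNormalizedSolution lam mu p C w) : WB (DD (ee 0) (fun x => w x 0)) (Om C) :=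
  WB.DD (Om_open C) (wb_w0 hmu hlam h) (comp_contDiffOn h.2.1 0) _

/-! ### Density -/

open scoped Convolution Topology

lemma trans_cont {S G : E3 → ℝ} (hS : MemLp S 2 volume) (hG : MemLp G 2 volume) :
    Continuous (fun y => ∫ x, S x * G (x - y)) := by
  have hmp : ∀ z : E3, MeasurePreserving (fun x : E3 => x - z) volume volume :=
    fun z => measurePreserving_sub_right volume z
  let g : C(E3, C(E3, E3)) := (ContinuousMap.mk (fun a : E3 × E3 => a.2 - a.1) (by fun_prop)).curry
  have hc : Continuous (fun z : E3 => Lp.compMeasurePreserving (g z) (hmp z) (hG.toLp G)) :=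
    continuous_const.compMeasurePreservingLp g.continuous hmp (by simp)
  have h2 : Continuous (fun z : E3 => inner ℝ (Lp.compMeasurePreserving (g z) (hmp z) (hG.toLp G)) (hS.toLp S)) :=
    hc.inner continuous_const
  refine h2.congr fun z => ?_
  rw [L2.inner_def]
  refine integral_congr_ae ?_
  have e1 := Lp.coeFn_compMeasurePreserving (hG.toLp G) (hmp z)
  have e2 := hS.coeFn_toLp
  have e3 := (hmp z).quasiMeasurePreserving.ae_eq_comp hG.coeFn_toLp
  filter_upwards [e1, e2, e3] with x h1 h2 h3
  have h1' : (Lp.compMeasurePreserving (g z) (hmp z) (hG.toLp G)) x = G (x - z) := by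
    rw [← show (G ∘ fun x => x - z) x = G (x - z) from rfl, ← h3]
    exact h1
  rw [h1', h2]
  simp

lemma fub {S G η : E3 → ℝ} (hS : MemLp S 2 volume) (hG : MemLp G 2 volume) (hη : Integrable η) :
    ∫ x, S x * ∫ y, η y * G (x - y) = ∫ y, η y * ∫ x, S x * G (x - y) := by
  have hS2 : Integrable (fun x => S x ^ 2) := hS.integrable_sq
  have hG2 : Integrable (fun x => G x ^ 2) := hG.integrable_sq
  have i1 : Integrable (fun p : E3 × E3 => S p.1 ^ 2 * η p.2) (volume.prod volume) := hS2.mul_prod hη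
  have i2 : Integrable (fun p : E3 × E3 => η p.2 * G (p.1 - p.2) ^ 2) (volume.prod volume) :=
    hη.convolution_integrand (ContinuousLinearMap.mul ℝ ℝ) hG2
  have m : AEStronglyMeasurable (fun p : E3 × E3 => S p.1 * (η p.2 * G (p.1 - p.2))) (volume.prod volume) :=
    hS.aestronglyMeasurable.comp_fst.mul
      (hη.aestronglyMeasurable.convolution_integrand (ContinuousLinearMap.mul ℝ ℝ) hG.aestronglyMeasurable)
  have i3 : Integrable (fun p : E3 × E3 => S p.1 * (η p.2 * G (p.1 - p.2))) (volume.prod volume) := by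
    refine (i1.norm.add i2.norm).mono' m (Filter.Eventually.of_forall fun p => ?_)
    simp only [Real.norm_eq_abs, abs_mul, abs_pow, sq_abs, Pi.add_apply]
    have h0 := abs_nonneg (η p.2)
    have : |S p.1| * |G (p.1 - p.2)| ≤ S p.1 ^ 2 + G (p.1 - p.2) ^ 2 := by
      rw [← sq_abs (S p.1), ← sq_abs (G _)]
      nlinarith [sq_nonneg (|S p.1| - |G (p.1 - p.2)|), sq_nonneg (|S p.1|), sq_nonneg (|G (p.1 - p.2)|)]
    nlinarith
  have := integral_integral_swap (f := fun x y => S x * (η y * G (x - y))) i3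
  simp only [integral_const_mul] at this
  rw [this]
  congr 1
  funext y
  rw [← integral_const_mul]
  congr 1
  funext x
  ring

/-- Admissible functions: C¹ on Ω with L² value and gradient. -/
def Adm (Ω : Set E3) (f : E3 → ℝ) : Prop :=
  ContDiffOn ℝ 1 f Ω ∧ MemLp (Ω.indicator f) 2 volume ∧
    ∀ j : Fin 3, MemLp (Ω.indicator (DD (ee j) f)) 2 volume

/-- Solenoidal L² fields with zero normal trace. -/
def Sol (Ω : Set E3) (S : Fin 3 → E3 → ℝ) : Prop :=
  (∀ j, MemLp (S j) 2 volume) ∧ (∀ j, ∀ x ∉ Ω, S j x = 0) ∧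
    ∀ φ : E3 → ℝ, ContDiff ℝ ∞ φ → HasCompactSupport φ → ∫ x, ∑ j, S j x * DD (ee j) φ x = 0

lemma dens_local {Ω : Set E3} (hΩ : IsOpen Ω) {S : Fin 3 → E3 → ℝ} (hS : Sol Ω S) {r c : ℝ}
    (hr : 0 < r) (hc : 0 < c) (hc2 : c ≤ 1/2) (hU : UC Ω r c) {f : E3 → ℝ} (hf : Adm Ω f) (P : E3)
    (hz : ∀ x ∈ Ω, x ∉ closedBall P (r/2) → f x = 0) :
    ∫ x, ∑ j, S j x * Ω.indicator (DD (ee j) f) x = 0 := by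
  obtain ⟨e, he, hUC⟩ := hU P
  obtain ⟨hf1, hf2, hf3⟩ := hf
  set F := Ω.indicator f with hF
  set G : Fin 3 → E3 → ℝ := fun j => Ω.indicator (DD (ee j) f) with hG
  have hFz : ∀ x ∉ closedBall P (r/2), F x = 0 := by
    intro x hx
    by_cases h : x ∈ Ω
    · rw [hF, indicator_of_mem h, hz x h hx]
    · rw [hF, indicator_of_notMem h]
  have hGz : ∀ j, ∀ x ∉ closedBall P (r/2), G j x = 0 := by
    intro j x hx
    by_cases h : x ∈ Ω
    · simp only [hG, indicator_of_mem h]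
      have : f =ᶠ[𝓝 x] fun _ => 0 := by
        filter_upwards [hΩ.mem_nhds h, isClosed_closedBall.isOpen_compl.mem_nhds hx] with y hy hy2
        exact hz y hy hy2
      unfold DD
      rw [this.fderiv_eq]
      simp
    · simp only [hG, indicator_of_notMem h]
  have hFc : HasCompactSupport F := HasCompactSupport.intro (isCompact_closedBall P (r/2)) hFz
  have hFl : LocallyIntegrable F := hf2.locallyIntegrable (by norm_num)
  set Φ : E3 → ℝ := fun y => ∑ j, ∫ x, S j x * G j (x - y) with hΦ
  have hΦc : Continuous Φ := continuous_finsetSum _ fun j _ => trans_cont (hS.1 j) (hf3 j)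
  have hSG : ∀ j, Integrable (fun x => S j x * G j x) := fun j => (hS.1 j).integrable_mul (hf3 j)
  have hgoal : ∫ x, ∑ j, S j x * G j x = Φ 0 := by
    rw [integral_finsetSum _ fun j _ => hSG j]
    simp [hΦ]
  rw [hgoal]
  by_contra hne
  obtain ⟨δ, hδ, hδ2⟩ := Metric.continuousAt_iff.1 hΦc.continuousAt (|Φ 0|/2) (half_pos (abs_pos.2 hne))
  set t := min (r/16) (δ/4) with ht
  have ht0 : 0 < t := lt_min (by positivity) (by positivity)
  have htr : t ≤ r/16 := min_le_left _ _
  have htd : t ≤ δ/4 := min_le_right _ _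
  have hct : 0 < c*t := by positivity
  have hct2 : c*t ≤ t/2 := by nlinarith
  let k : ContDiffBump (-(t•e)) := ⟨c*t/4, c*t/2, by positivity, by linarith⟩
  set η : E3 → ℝ := k.normed volume with hη
  have ηs : ContDiff ℝ ∞ η := k.contDiff_normed
  have ηc : HasCompactSupport η := k.hasCompactSupport_normed
  have ηt : tsupport η = closedBall (-(t•e)) (c*t/2) := k.tsupport_normed_eq
  have η0 : ∀ x, 0 ≤ η x := k.nonneg_normed
  have η1 : ∫ x, η x = 1 := k.integral_normed
  have ηi : Integrable η := k.integrable_normed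
  -- the mollification
  set v : E3 → ℝ := F ⋆[ContinuousLinearMap.mul ℝ ℝ] η with hv
  have hvs : ContDiff ℝ ∞ v := ηc.contDiff_convolution_right _ hFl ηs
  have hvc : HasCompactSupport v := hFc.convolution _ ηc
  have hvd : ∀ j, ∀ x ∈ Ω, DD (ee j) v x = ∫ y, η y * G j (x - y) := by
    intro j x hx
    have h1 := ηc.hasFDerivAt_convolution_right (ContinuousLinearMap.mul ℝ ℝ) hFl (ηs.of_le (by simp)) x
    have h2 : DD (ee j) v x = ∫ y, F y * DD (ee j) η (x - y) := by
      unfold DD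
      rw [hv, h1.fderiv, convolution_precompR_apply _ hFl (ηc.fderiv ℝ) (ηs.continuous_fderiv (by simp))]
      rfl
    have h3 : ∫ y, η y * G j (x - y) = ∫ y, G j y * η (x - y) := by
      rw [← integral_sub_left_eq_self _ volume x]
      congr 1
      funext y
      rw [sub_sub_cancel, mul_comm]
    rw [h2, h3]
    -- the reflected kernel
    have φs : ContDiff ℝ ∞ (fun y => η (x - y)) := ηs.comp (contDiff_const.sub contDiff_id)
    have φd : ∀ y, DD (ee j) (fun y => η (x - y)) y = - DD (ee j) η (x - y) := by
      intro y
      unfold DD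
      have := (ηs.differentiable (by simp) (x - y)).hasFDerivAt.comp y ((hasFDerivAt_id y).const_sub x)
      have e : (fun y => η (x - y)) = η ∘ (fun y => x - y) := rfl
      rw [e, this.fderiv]
      simp
    have φt : ∀ y, y ∉ closedBall (x + t•e) (c*t/2) → η (x - y) = 0 := by
      intro y hy
      refine image_eq_zero_of_notMem_tsupport fun h => hy ?_
      rw [ηt, mem_closedBall, dist_eq_norm] at h
      rw [mem_closedBall, dist_eq_norm, ← norm_neg]
      refine le_trans (le_of_eq ?_) h
      congr 1
      abel
    have φt' : tsupport (fun y => η (x - y)) ⊆ closedBall (x + t•e) (c*t/2) := by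
      refine closure_minimal ?_ isClosed_closedBall
      intro y hy
      by_contra h
      exact hy (φt y h)
    have hte : ‖t•e‖ = t := by rw [norm_smul, he, mul_one, Real.norm_of_nonneg ht0.le]
    by_cases hxP : dist x P < 3*r/4
    · have hsub : closedBall (x + t•e) (c*t/2) ⊆ Ω := by
        intro y hy
        rw [mem_closedBall, dist_eq_norm] at hy
        have hyx : dist y x ≤ 2*t := by
          rw [dist_eq_norm]
          calc ‖y - x‖ = ‖(y - (x + t•e)) + t•e‖ := by congr 1; abel
            _ ≤ c*t/2 + t := (norm_add_le _ _).trans (by rw [hte]; linarith)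
            _ ≤ 2*t := by linarith
        have := hUC x (by rw [mem_ball]; linarith) hx t ht0 (y - x) (by
          rw [sub_sub]; linarith) (by
          rw [mem_ball, add_sub_cancel]
          have := dist_triangle y x P
          linarith)
        rwa [add_sub_cancel] at this
      have := ibp hΩ hf1 φs (HasCompactSupport.of_support_subset_isCompact (isCompact_closedBall _ _) ((subset_tsupport _).trans φt')) (φt'.trans hsub) (ee j)
      simp only [φd] at this
      have e1 : ∫ y, F y * DD (ee j) η (x - y) = -∫ y, f y * -DD (ee j) η (x - y) := by
        rw [← integral_neg]
        congr 1
        funext y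
        by_cases hy : y ∈ Ω
        · rw [hF, indicator_of_mem hy]; ring
        · rw [hF, indicator_of_notMem hy, ← φd y, image_eq_zero_of_notMem_tsupport (fun h => hy (hsub (φt' (DD_tsupport _ _ h))))]
          ring
      rw [e1, this, neg_neg]
      congr 1
      funext y
      by_cases hy : y ∈ Ω
      · simp only [hG, indicator_of_mem hy]
      · simp only [hG, indicator_of_notMem hy]
        rw [φt y (fun h => hy (hsub h))]
        ring
    · have hfar : ∀ y ∈ closedBall (x + t•e) (c*t/2), y ∉ closedBall P (r/2) := by
        intro y hy hy2
        rw [mem_closedBall] at hy hy2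
        have h1 := dist_triangle x (x + t•e) P
        have h2 := dist_triangle (x + t•e) y P
        have h3 : dist x (x + t•e) = t := by rw [dist_eq_norm]; simp [hte]
        rw [dist_comm] at hy
        push Not at hxP
        linarith
      have e1 : ∀ y, F y * DD (ee j) η (x - y) = 0 := by
        intro y
        by_cases hy : y ∈ closedBall (x + t•e) (c*t/2)
        · rw [hFz y (hfar y hy), zero_mul]
        · rw [← neg_neg (DD (ee j) η (x - y)), ← φd y, image_eq_zero_of_notMem_tsupport (fun h => hy (φt' (DD_tsupport _ _ h)))]
          simp
      have e2 : ∀ y, G j y * η (x - y) = 0 := by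
        intro y
        by_cases hy : y ∈ closedBall (x + t•e) (c*t/2)
        · rw [hGz j y (hfar y hy), zero_mul]
        · rw [φt y hy, mul_zero]
      simp [e1, e2]
  -- conclusion
  have h0 := hS.2.2 v hvs hvc
  have e1 : ∀ x, ∑ j, S j x * DD (ee j) v x = ∑ j, S j x * ∫ y, η y * G j (x - y) := by
    intro x
    refine Finset.sum_congr rfl fun j _ => ?_
    by_cases hx : x ∈ Ω
    · rw [hvd j x hx]
    · rw [hS.2.1 j x hx, zero_mul, zero_mul]
  have hvi : ∀ j, Integrable (fun x => S j x * DD (ee j) v x) := by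
    intro j
    have : MemLp (DD (ee j) v) 2 volume := (DD_contDiff hvs _).continuous.memLp_of_hasCompactSupport (DD_hcs hvc _)
    exact (hS.1 j).integrable_mul this
  rw [integral_finsetSum _ fun j _ => hvi j] at h0
  have e2 : ∀ j, ∫ x, S j x * DD (ee j) v x = ∫ y, η y * ∫ x, S j x * G j (x - y) := by
    intro j
    rw [← fub (hS.1 j) (hf3 j) ηi]
    congr 1
    funext x
    by_cases hx : x ∈ Ω
    · rw [hvd j x hx]
    · rw [hS.2.1 j x hx, zero_mul, zero_mul]
  have ηΦ : ∀ Ψ : E3 → ℝ, Continuous Ψ → Integrable (fun y => η y * Ψ y) := fun Ψ hΨ =>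
    (ηs.continuous.mul hΨ).integrable_of_hasCompactSupport ηc.mul_right
  have h1 : ∫ y, η y * Φ y = 0 := by
    rw [← h0]
    simp only [e2, hΦ, Finset.mul_sum]
    exact integral_finsetSum _ fun j _ => ηΦ _ (trans_cont (hS.1 j) (hf3 j))
  have h2 : ∫ y, η y * (Φ y - Φ 0) = - Φ 0 := by
    have : ∀ y, η y * (Φ y - Φ 0) = η y * Φ y - η y * Φ 0 := fun y => by ring
    simp only [this]
    rw [integral_sub (ηΦ _ hΦc) (ηΦ _ continuous_const), h1, integral_mul_const, η1]
    ring
  have h3 : |∫ y, η y * (Φ y - Φ 0)| ≤ ∫ y, η y * (|Φ 0|/2) := by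
    rw [← Real.norm_eq_abs]
    refine norm_integral_le_of_norm_le (ηΦ _ continuous_const) (Filter.Eventually.of_forall fun y => ?_)
    rw [norm_mul, Real.norm_of_nonneg (η0 y)]
    by_cases hy : y ∈ closedBall (-(t•e)) (c*t/2)
    · refine mul_le_mul_of_nonneg_left ?_ (η0 y)
      have hyd : dist y 0 < δ := by
        have h1 := dist_triangle y (-(t•e)) 0
        have h3 : dist (-(t•e)) 0 = t := by
          rw [dist_zero_right, norm_neg, norm_smul, he, mul_one, Real.norm_of_nonneg ht0.le]
        rw [mem_closedBall] at hy
        linarith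
      have := hδ2 hyd
      rw [Real.dist_eq] at this
      exact this.le
    · rw [image_eq_zero_of_notMem_tsupport (f := η) (by rw [ηt]; exact hy)]
      simp
  rw [h2, integral_mul_const, η1, abs_neg] at h3
  have := abs_pos.2 hne
  linarith

open scoped Topology

lemma DD_mulOn {Ω : Set E3} (hΩ : IsOpen Ω) {χ f : E3 → ℝ} (hχ : ContDiff ℝ ∞ χ) (hf : ContDiffOn ℝ 1 f Ω)
    {x : E3} (hx : x ∈ Ω) (d : E3) : DD d (fun x => χ x * f x) x = χ x * DD d f x + f x * DD d χ x := by
  have hd : DifferentiableAt ℝ f x := (hf.differentiableOn (by simp) x hx).differentiableAt (hΩ.mem_nhds hx)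
  unfold DD
  rw [fderiv_fun_mul (hχ.differentiable (by simp) x) hd]
  simp

/-- Bounded smooth multipliers. -/
def Bd (χ : E3 → ℝ) : Prop := ContDiff ℝ ∞ χ ∧ ∃ B, ∀ x, |χ x| ≤ B ∧ ∀ j, |DD (ee j) χ x| ≤ B

lemma cpt_bdd {χ : E3 → ℝ} (h : Continuous χ) (hc : HasCompactSupport χ) : ∃ B, ∀ x, |χ x| ≤ B := by
  obtain ⟨B, hB⟩ := hc.exists_bound_of_continuous h
  exact ⟨B, fun x => hB x⟩

lemma Bd_of_cpt {χ : E3 → ℝ} (h : ContDiff ℝ ∞ χ) (hc : HasCompactSupport χ) : Bd χ := by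
  refine ⟨h, ?_⟩
  obtain ⟨B, hB⟩ := cpt_bdd h.continuous hc
  choose b hb using fun j => cpt_bdd (DD_contDiff h (ee j)).continuous (DD_hcs hc (ee j))
  have hb0 : ∀ j, 0 ≤ b j := fun j => (abs_nonneg _).trans (hb j 0)
  have hB0 : 0 ≤ B := (abs_nonneg _).trans (hB 0)
  have hs : 0 ≤ ∑ j, b j := Finset.sum_nonneg fun j _ => hb0 j
  refine ⟨B + ∑ j, b j, fun x => ⟨(hB x).trans (by linarith), fun j => (hb j x).trans ?_⟩⟩
  have := Finset.single_le_sum (f := b) (fun j _ => hb0 j) (Finset.mem_univ j)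
  linarith

lemma DD_one_sub {χ : E3 → ℝ} (h : ContDiff ℝ ∞ χ) (d x : E3) : DD d (fun x => 1 - χ x) x = - DD d χ x := by
  unfold DD
  rw [fderiv_const_sub]
  simp

lemma Bd.one_sub {χ : E3 → ℝ} (h : Bd χ) : Bd (fun x => 1 - χ x) := by
  obtain ⟨h1, B, hB⟩ := h
  refine ⟨contDiff_const.sub h1, 1 + B, fun x => ⟨?_, fun j => ?_⟩⟩
  · have := (abs_sub 1 (χ x)).trans (add_le_add_right (hB x).1 _)
    simpa using this
  · rw [DD_one_sub h1, abs_neg]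
    linarith [(hB x).2 j]

lemma memLp_bdd_mul {χ f : E3 → ℝ} {Ω : Set E3} (hf : MemLp (Ω.indicator f) 2 volume) (hχ : Continuous χ) {B : ℝ}
    (hB : ∀ x, |χ x| ≤ B) : MemLp (Ω.indicator (fun x => χ x * f x)) 2 volume := by
  have e : Ω.indicator (fun x => χ x * f x) = fun x => χ x * Ω.indicator f x := by
    funext x
    by_cases hx : x ∈ Ω
    · simp [indicator_of_mem hx]
    · simp [indicator_of_notMem hx]
  rw [e]
  refine hf.of_le_mul (c := B) (hχ.aestronglyMeasurable.mul hf.aestronglyMeasurable)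
    (Filter.Eventually.of_forall fun x => ?_)
  rw [norm_mul]
  exact mul_le_mul_of_nonneg_right (hB x) (norm_nonneg _)

lemma Adm.mul {Ω : Set E3} (hΩ : IsOpen Ω) {χ f : E3 → ℝ} (hf : Adm Ω f) (hχ : Bd χ) :
    Adm Ω (fun x => χ x * f x) := by
  obtain ⟨h1, B, hB⟩ := hχ
  obtain ⟨f1, f2, f3⟩ := hf
  refine ⟨(h1.of_le (by simp)).contDiffOn.mul f1, memLp_bdd_mul f2 h1.continuous fun x => (hB x).1, fun j => ?_⟩
  have a := memLp_bdd_mul (f3 j) h1.continuous fun x => (hB x).1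
  have b := memLp_bdd_mul f2 (DD_contDiff h1 (ee j)).continuous fun x => (hB x).2 j
  have e : Ω.indicator (DD (ee j) fun x => χ x * f x) =
     (Ω.indicator fun x => χ x * DD (ee j) f x) + (Ω.indicator fun x => DD (ee j) χ x * f x) := by
    funext x
    by_cases hx : x ∈ Ω
    · simp only [Pi.add_apply, indicator_of_mem hx, DD_mulOn hΩ h1 f1 hx]; ring
    · simp [indicator_of_notMem hx]
  rw [e]
  exact a.add b

lemma dens_fin {Ω : Set E3} (hΩ : IsOpen Ω) {S : Fin 3 → E3 → ℝ} (hS : Sol Ω S) {r c : ℝ}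
    (hr : 0 < r) (hc : 0 < c) (hc2 : c ≤ 1/2) (hU : UC Ω r c) (t : Finset E3) :
    ∀ f : E3 → ℝ, Adm Ω f → (∀ x ∈ Ω, (∀ P ∈ t, x ∉ closedBall P (r/4)) → f x = 0) →
    ∫ x, ∑ j, S j x * Ω.indicator (DD (ee j) f) x = 0 := by
  classical
  induction t using Finset.induction_on with
  | empty =>
    intro f hf hz
    exact dens_local hΩ hS hr hc hc2 hU hf 0 fun x hx _ => hz x hx (by simp)
  | insert P t hP ih =>
    intro f hf hz
    let k : ContDiffBump P := ⟨r/4, r/2, by positivity, by linarith⟩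
    have ks : ContDiff ℝ ∞ k := k.contDiff
    have kb : Bd k := Bd_of_cpt ks k.hasCompactSupport
    have A1 := hf.mul hΩ kb
    have A2 := hf.mul hΩ kb.one_sub
    have I1 := dens_local hΩ hS hr hc hc2 hU A1 P (by
      intro x hx hx2
      have : k x = 0 := k.zero_of_le_dist (by rw [mem_closedBall, not_le] at hx2; exact hx2.le)
      simp [this])
    have I2 := ih _ A2 (by
      intro x hx hx2
      by_cases h : x ∈ closedBall P (r/4)
      · have : k x = 1 := k.one_of_mem_closedBall h
        simp [this]
      · rw [hz x hx, mul_zero]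
        intro Q hQ
        rcases Finset.mem_insert.1 hQ with rfl | hQ
        · exact h
        · exact hx2 Q hQ)
    have ii : ∀ g, Adm Ω g → Integrable (fun x => ∑ j, S j x * Ω.indicator (DD (ee j) g) x) := fun g hg =>
      integrable_finsetSum _ fun j _ => (hS.1 j).integrable_mul (hg.2.2 j)
    have := integral_add (ii _ A1) (ii _ A2)
    rw [I1, I2, add_zero] at this
    rw [← this]
    congr 1
    funext x
    rw [← Finset.sum_add_distrib]
    refine Finset.sum_congr rfl fun j _ => ?_
    by_cases hx : x ∈ Ω
    · simp only [indicator_of_mem hx]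
      rw [DD_mulOn hΩ ks hf.1 hx, DD_mulOn hΩ kb.one_sub.1 hf.1 hx, DD_one_sub ks]
      ring
    · simp [indicator_of_notMem hx]

lemma dens_inf {Ω : Set E3} (hΩ : IsOpen Ω) {S : Fin 3 → E3 → ℝ} (hS : Sol Ω S) {r c : ℝ}
    (hr : 0 < r) (hc : 0 < c) (hc2 : c ≤ 1/2) (hU : UC Ω r c) {g : E3 → ℝ} (hg : ContDiffOn ℝ 1 g Ω)
    (hg0 : IntegrableOn (fun x => g x ^ 2 / (1 + ‖x‖^2)) Ω)
    (hg1 : ∀ j, MemLp (Ω.indicator (DD (ee j) g)) 2 volume) :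
    ∫ x, ∑ j, S j x * Ω.indicator (DD (ee j) g) x = 0 := by
  let k : ContDiffBump (0 : E3) := ⟨1, 2, by norm_num, by norm_num⟩
  obtain ⟨ks, B, hB⟩ : Bd k := Bd_of_cpt k.contDiff k.hasCompactSupport
  have hB0 : 0 ≤ B := (abs_nonneg _).trans (hB 0).1
  let χ : ℕ → E3 → ℝ := fun n x => k ((1/((n:ℝ)+1)) • x)
  have χs : ∀ n, ContDiff ℝ ∞ (χ n) := fun n => ks.comp (contDiff_const_smul _)
  have hn0 : ∀ n : ℕ, (0:ℝ) < (n:ℝ)+1 := fun n => by positivity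
  have hnorm : ∀ (n : ℕ) (x : E3), dist ((1/((n:ℝ)+1)) • x) 0 = ‖x‖/((n:ℝ)+1) := by
    intro n x
    rw [dist_zero_right, norm_smul, Real.norm_of_nonneg (by have := hn0 n; positivity)]
    ring
  have χ0 : ∀ (n : ℕ) (x : E3), 2*((n:ℝ)+1) ≤ ‖x‖ → χ n x = 0 := by
    intro n x hx
    refine k.zero_of_le_dist ?_
    rw [hnorm]
    show (2:ℝ) ≤ _
    rw [le_div_iff₀ (hn0 n)]
    exact hx
  have χ1 : ∀ (n : ℕ) (x : E3), ‖x‖ ≤ (n:ℝ)+1 → χ n x = 1 := by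
    intro n x hx
    refine k.one_of_mem_closedBall ?_
    rw [mem_closedBall, hnorm]
    show _ ≤ (1:ℝ)
    rw [div_le_one (hn0 n)]
    exact hx
  have χc : ∀ n, HasCompactSupport (χ n) := fun n =>
    HasCompactSupport.intro (isCompact_closedBall 0 (2*((n:ℝ)+1))) fun x hx => χ0 n x (by
      rw [mem_closedBall, dist_zero_right, not_le] at hx; exact hx.le)
  have χd : ∀ n x j, |DD (ee j) (χ n) x| ≤ B/((n:ℝ)+1) := by
    intro n x j
    have h := (ks.differentiable (by simp) ((1/((n:ℝ)+1)) • x)).hasFDerivAt.comp x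
      ((hasFDerivAt_id x).const_smul (1/((n:ℝ)+1)))
    have e : χ n = k ∘ (fun x => (1/((n:ℝ)+1)) • x) := rfl
    have : DD (ee j) (χ n) x = (1/((n:ℝ)+1)) * DD (ee j) k ((1/((n:ℝ)+1)) • x) := by
      unfold DD
      rw [e]
      have h' := h.fderiv
      simp only [Function.comp_def] at h' ⊢
      rw [h']
      simp
    rw [this, abs_mul, abs_of_pos (by have := hn0 n; positivity), div_mul_eq_mul_div, one_mul]
    exact div_le_div_of_nonneg_right ((hB _).2 j) (hn0 n).le
  have χd0 : ∀ (n : ℕ) (x : E3) (j : Fin 3), 2*((n:ℝ)+1) < ‖x‖ → DD (ee j) (χ n) x = 0 := by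
    intro n x j hx
    have : χ n =ᶠ[𝓝 x] fun _ => 0 := by
      filter_upwards [(isOpen_lt continuous_const continuous_norm).mem_nhds hx] with y hy
      exact χ0 n y hy.le
    unfold DD
    rw [this.fderiv_eq]
    simp
  have χd1 : ∀ (n : ℕ) (x : E3) (j : Fin 3), ‖x‖ < (n:ℝ)+1 → DD (ee j) (χ n) x = 0 := by
    intro n x j hx
    have : χ n =ᶠ[𝓝 x] fun _ => 1 := by
      filter_upwards [(isOpen_lt continuous_norm continuous_const).mem_nhds hx] with y hy
      exact χ1 n y (le_of_lt hy)
    unfold DD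
    rw [this.fderiv_eq]
    simp
  have hmeas : AEStronglyMeasurable (Ω.indicator g) volume :=
    (aestronglyMeasurable_indicator_iff hΩ.measurableSet).2 (hg.continuousOn.aestronglyMeasurable hΩ.measurableSet)
  have hgI : Integrable (Ω.indicator fun x => g x ^ 2 / (1 + ‖x‖^2)) := hg0.integrable_indicator hΩ.measurableSet
  -- χ n g in L²
  have hL : ∀ (n : ℕ) (a : E3 → ℝ), Continuous a → (∃ b, ∀ x, |a x| ≤ b) → (∀ x, 2*((n:ℝ)+1) < ‖x‖ → a x = 0) →
      MemLp (Ω.indicator fun x => a x * g x) 2 volume := by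
    intro n a ha ⟨b, hb⟩ ha0
    have e : (Ω.indicator fun x => a x * g x) = fun x => a x * Ω.indicator g x := by
      funext x
      by_cases hx : x ∈ Ω
      · simp [indicator_of_mem hx]
      · simp [indicator_of_notMem hx]
    rw [e]
    have hm : AEStronglyMeasurable (fun x => a x * Ω.indicator g x) volume := ha.aestronglyMeasurable.mul hmeas
    rw [memLp_two_iff_integrable_sq hm]
    refine (hgI.const_mul (b^2*(1+(2*((n:ℝ)+1))^2))).mono' (hm.pow 2) (Filter.Eventually.of_forall fun x => ?_)
    rw [Real.norm_of_nonneg (sq_nonneg _)]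
    by_cases hx : x ∈ Ω
    · simp only [indicator_of_mem hx]
      by_cases hx2 : 2*((n:ℝ)+1) < ‖x‖
      · rw [ha0 x hx2, zero_mul]
        have : 0 ≤ g x ^ 2 / (1+‖x‖^2) := by positivity
        nlinarith [this, sq_nonneg b, sq_nonneg (2*((n:ℝ)+1)), mul_nonneg (sq_nonneg b) this, mul_nonneg (mul_nonneg (sq_nonneg b) this) (sq_nonneg (2*((n:ℝ)+1)))]
      · push Not at hx2
        have h1 : a x ^ 2 ≤ b^2 := by rw [← sq_abs]; exact pow_le_pow_left₀ (abs_nonneg _) (hb x) 2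
        have h2 : 1 + ‖x‖^2 ≤ 1 + (2*((n:ℝ)+1))^2 := by
          have := pow_le_pow_left₀ (norm_nonneg x) hx2 2
          linarith
        have h3 : g x^2 ≤ (1 + (2*((n:ℝ)+1))^2) * (g x^2/(1+‖x‖^2)) := by
          rw [mul_div_assoc', le_div_iff₀ (by positivity), mul_comm]
          exact mul_le_mul_of_nonneg_right h2 (sq_nonneg _)
        rw [mul_pow, mul_assoc]
        exact mul_le_mul h1 h3 (sq_nonneg _) (sq_nonneg _)
    · simp [indicator_of_notMem hx]
  have hAdm : ∀ n, Adm Ω (fun x => χ n x * g x) := by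
    intro n
    have bd := Bd_of_cpt (χs n) (χc n)
    obtain ⟨_, b, hb⟩ := bd
    refine ⟨((χs n).of_le (by simp)).contDiffOn.mul hg, hL n _ (χs n).continuous ⟨b, fun x => (hb x).1⟩ (fun x hx => χ0 n x hx.le), fun j => ?_⟩
    have A := memLp_bdd_mul (hg1 j) (χs n).continuous fun x => (hb x).1
    have A2 := hL n _ (DD_contDiff (χs n) (ee j)).continuous ⟨b, fun x => (hb x).2 j⟩ (fun x hx => χd0 n x j hx)
    have e : Ω.indicator (DD (ee j) fun x => χ n x * g x) =
       (Ω.indicator fun x => χ n x * DD (ee j) g x) + (Ω.indicator fun x => DD (ee j) (χ n) x * g x) := by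
      funext x
      by_cases hx : x ∈ Ω
      · simp only [Pi.add_apply, indicator_of_mem hx, DD_mulOn hΩ (χs n) hg hx]; ring
      · simp [indicator_of_notMem hx]
    rw [e]
    exact A.add A2
  have hzero : ∀ n, ∫ x, ∑ j, S j x * Ω.indicator (DD (ee j) fun x => χ n x * g x) x = 0 := by
    intro n
    obtain ⟨t, ht, ht2⟩ := (isCompact_closedBall (0:E3) (2*((n:ℝ)+1))).elim_finite_subcover_image
      (b := univ) (c := fun P : E3 => ball P (r/4)) (fun _ _ => isOpen_ball) (fun x _ => by
        simp only [mem_iUnion]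
        exact ⟨x, mem_univ _, mem_ball_self (by positivity)⟩)
    refine dens_fin hΩ hS hr hc hc2 hU ht2.1.toFinset _ (hAdm n) fun x hx hx2 => ?_
    by_cases h : x ∈ closedBall (0:E3) (2*((n:ℝ)+1))
    · obtain ⟨P, hP, hP2⟩ := mem_iUnion₂.1 (ht2.2 h)
      exact absurd (ball_subset_closedBall hP2) (hx2 P (by simpa using hP))
    · rw [χ0 n x (by rw [mem_closedBall, dist_zero_right, not_le] at h; exact h.le), zero_mul]
  -- passage to the limit
  set bound : E3 → ℝ := fun x => ∑ j, (B * (S j x ^ 2 + Ω.indicator (DD (ee j) g) x ^ 2) +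
     B * (S j x ^2 + 5 * Ω.indicator (fun x => g x ^ 2 / (1 + ‖x‖^2)) x)) with hbound
  have hlim := tendsto_integral_of_dominated_convergence (μ := volume) (F := fun n x => ∑ j, S j x * Ω.indicator (DD (ee j) fun x => χ n x * g x) x)
    (f := fun x => ∑ j, S j x * Ω.indicator (DD (ee j) g) x) bound ?_ ?_ ?_ ?_
  · simp only [hzero] at hlim
    exact tendsto_nhds_unique hlim tendsto_const_nhds |>.symm ▸ rfl
  · intro n
    exact (integrable_finsetSum _ fun j _ => (hS.1 j).integrable_mul ((hAdm n).2.2 j)).aestronglyMeasurable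
  · refine integrable_finsetSum _ fun j _ => ?_
    exact (((hS.1 j).integrable_sq.add (hg1 j).integrable_sq).const_mul B).add (((hS.1 j).integrable_sq.add (hgI.const_mul 5)).const_mul B)
  · intro n
    refine Filter.Eventually.of_forall fun x => ?_
    refine (norm_sum_le _ _).trans (Finset.sum_le_sum fun j _ => ?_)
    rw [norm_mul, Real.norm_eq_abs, Real.norm_eq_abs]
    by_cases hx : x ∈ Ω
    · simp only [indicator_of_mem hx]
      rw [DD_mulOn hΩ (χs n) hg hx]
      have h1 : |χ n x| ≤ B := (hB _).1
      have h2 := χd n x j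
      have h3 : |S j x| * |χ n x * DD (ee j) g x| ≤ B * (S j x ^ 2 + DD (ee j) g x ^ 2) := by
        rw [abs_mul]
        have : |S j x| * |DD (ee j) g x| ≤ S j x ^ 2 + DD (ee j) g x ^ 2 := by
          rw [← sq_abs (S j x), ← sq_abs (DD (ee j) g x)]
          nlinarith [sq_nonneg (|S j x| - |DD (ee j) g x|), sq_nonneg (|S j x|), sq_nonneg (|DD (ee j) g x|)]
        calc _ = |χ n x| * (|S j x| * |DD (ee j) g x|) := by ring
          _ ≤ _ := mul_le_mul h1 this (by positivity) hB0
      have h4 : |S j x| * |g x * DD (ee j) (χ n) x| ≤ B * (S j x ^ 2 + 5 * (g x ^ 2 / (1 + ‖x‖^2))) := by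
        by_cases hx2 : 2*((n:ℝ)+1) < ‖x‖
        · rw [χd0 n x j hx2]
          simp only [mul_zero, abs_zero]
          positivity
        · push Not at hx2
          have hn := hn0 n
          have a1 : (g x/((n:ℝ)+1))^2 ≤ 5 * (g x ^ 2 / (1 + ‖x‖^2)) := by
            rw [div_pow, mul_div_assoc', div_le_div_iff₀ (by positivity) (by positivity)]
            have : 1 + ‖x‖^2 ≤ 5*((n:ℝ)+1)^2 := by
              have q := pow_le_pow_left₀ (norm_nonneg x) hx2 2
              have : (0:ℝ) ≤ n := Nat.cast_nonneg n
              nlinarith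
            nlinarith [mul_le_mul_of_nonneg_left this (sq_nonneg (g x))]
          have a2 : |S j x| * |g x / ((n:ℝ)+1)| ≤ S j x ^ 2 + (g x/((n:ℝ)+1))^2 := by
            rw [← sq_abs (S j x), ← sq_abs (g x/_)]
            nlinarith [sq_nonneg (|S j x| - |g x/((n:ℝ)+1)|), sq_nonneg (|S j x|), sq_nonneg (|g x/((n:ℝ)+1)|)]
          calc |S j x| * |g x * DD (ee j) (χ n) x| = |S j x| * |g x| * |DD (ee j) (χ n) x| := by rw [abs_mul]; ring
            _ ≤ |S j x| * |g x| * (B/((n:ℝ)+1)) := mul_le_mul_of_nonneg_left h2 (by positivity)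
            _ = B * (|S j x| * |g x / ((n:ℝ)+1)|) := by rw [abs_div, abs_of_pos hn]; ring
            _ ≤ _ := mul_le_mul_of_nonneg_left (a2.trans (by linarith)) hB0
      calc _ ≤ |S j x| * (|χ n x * DD (ee j) g x| + |g x * DD (ee j) (χ n) x|) :=
            mul_le_mul_of_nonneg_left (abs_add_le _ _) (abs_nonneg _)
        _ ≤ _ := by rw [mul_add]; exact add_le_add h3 h4
    · simp only [indicator_of_notMem hx, abs_zero, mul_zero]
      positivity
  · refine Filter.Eventually.of_forall fun x => ?_
    refine tendsto_const_nhds.congr' ?_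
    obtain ⟨N, hN⟩ := exists_nat_gt ‖x‖
    filter_upwards [Filter.eventually_ge_atTop N] with n hn
    refine Finset.sum_congr rfl fun j _ => ?_
    have hlt : ‖x‖ < (n:ℝ)+1 := by
      have : (N:ℝ) ≤ n := by exact_mod_cast hn
      linarith
    by_cases hx : x ∈ Ω
    · simp only [indicator_of_mem hx]
      rw [DD_mulOn hΩ (χs n) hg hx, χ1 n x hlt.le, χd1 n x j hlt]
      ring
    · simp [indicator_of_notMem hx]

/-! ### Half-space integration by parts -/

lemma half_tan {φ : E3 → ℝ} (hφ : ContDiff ℝ ∞ φ) (hc : HasCompactSupport φ) {i : Fin 3} (hi : i ≠ 2) :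
    ∫ x in lowerHalf, DD (ee i) φ x = 0 := by
  have hm : MeasurableSet lowerHalf := (isOpen_lt (coord_cont 2) continuous_const).measurableSet
  have I1 : Integrable (DD (ee i) φ) := (DD_contDiff hφ _).continuous.integrable_of_hasCompactSupport (DD_hcs hc _)
  have I2 : Integrable φ := hφ.continuous.integrable_of_hasCompactSupport hc
  have e : ∀ g : E3 → ℝ, (fun x => (ContinuousLinearMap.mul ℝ ℝ) (lowerHalf.indicator (fun _ => (1:ℝ)) x) (g x)) = lowerHalf.indicator g := by
    intro g
    funext x
    by_cases hx : x ∈ lowerHalf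
    · simp [indicator_of_mem hx]
    · simp [indicator_of_notMem hx]
  have := integral_bilinear_hasLineDerivAt_right_eq_neg_left_of_integrable (μ := (volume : Measure E3))
    (B := ContinuousLinearMap.mul ℝ ℝ) (f := lowerHalf.indicator (fun _ => (1:ℝ))) (f' := fun _ => 0)
    (g := φ) (g' := DD (ee i) φ) (v := ee i) (by simp) (by rw [e]; exact I1.indicator hm)
    (by rw [e]; exact I2.indicator hm) (by
      intro x _
      have : (fun t : ℝ => lowerHalf.indicator (fun _ => (1:ℝ)) (x + t • ee i)) = fun _ => lowerHalf.indicator (fun _ => (1:ℝ)) x := by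
        funext t
        have : (x + t • ee i ∈ lowerHalf) ↔ x ∈ lowerHalf := by
          unfold lowerHalf
          simp [Ne.symm hi]
        by_cases hx : x ∈ lowerHalf
        · rw [indicator_of_mem hx, indicator_of_mem (this.2 hx)]
        · rw [indicator_of_notMem hx, indicator_of_notMem (fun h => hx (this.1 h))]
      unfold HasLineDerivAt
      rw [this]
      exact hasDerivAt_const _ _)
    (by
      intro x _
      exact (hφ.differentiable (by simp) x).hasFDerivAt.hasLineDerivAt _)
  rw [e] at this
  rw [← integral_indicator hm, this]
  simp

/-- (t, y) ↦ (y₀, y₁, t). -/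
def ins (t : ℝ) (y : Fin 2 → ℝ) : E3 := WithLp.toLp 2 (Fin.insertNth (α := fun _ => ℝ) (2 : Fin 3) t y)

lemma ins_two (t : ℝ) (y : Fin 2 → ℝ) : ins t y 2 = t := by simp [ins]

lemma ins_add (t : ℝ) (y : Fin 2 → ℝ) : ins t y = ins 0 y + t • ee 2 := by
  ext k
  have e0 : (0 : Fin 3) = (2 : Fin 3).succAbove 0 := rfl
  have e1 : (1 : Fin 3) = (2 : Fin 3).succAbove 1 := rfl
  fin_cases k
  · simp only [ins, Fin.zero_eta, PiLp.add_apply, PiLp.smul_apply]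
    rw [e0, Fin.insertNth_apply_succAbove, Fin.insertNth_apply_succAbove]
    simp
  · simp only [ins, Fin.mk_one, PiLp.add_apply, PiLp.smul_apply]
    rw [e1, Fin.insertNth_apply_succAbove, Fin.insertNth_apply_succAbove]
    simp
  · simp [ins]

lemma ins_emb (y : E2) : ins 0 (WithLp.ofLp y) = emb2 y := by
  ext k
  have e0 : (0 : Fin 3) = (2 : Fin 3).succAbove 0 := rfl
  have e1 : (1 : Fin 3) = (2 : Fin 3).succAbove 1 := rfl
  fin_cases k
  · simp only [ins, Fin.zero_eta]
    rw [e0, Fin.insertNth_apply_succAbove]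
    simp [emb2]
  · simp only [ins, Fin.mk_one]
    rw [e1, Fin.insertNth_apply_succAbove, ← e1]
    simp [emb2]
  · simp [ins, emb2]

lemma ins_mp : MeasurePreserving (fun z : ℝ × (Fin 2 → ℝ) => ins z.1 z.2) volume volume :=
  (PiLp.volume_preserving_toLp (Fin 3)).comp
    (volume_preserving_piFinSuccAbove (fun _ : Fin 3 => ℝ) 2).symm

lemma ins_me : MeasurableEmbedding (fun z : ℝ × (Fin 2 → ℝ) => ins z.1 z.2) :=
  (MeasurableEquiv.toLp 2 (Fin 3 → ℝ)).measurableEmbedding.comp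
    (MeasurableEquiv.piFinSuccAbove (fun _ : Fin 3 => ℝ) 2).symm.measurableEmbedding

lemma half_nor {φ : E3 → ℝ} (hφ : ContDiff ℝ ∞ φ) (hc : HasCompactSupport φ) :
    ∫ x in lowerHalf, DD (ee 2) φ x = ∫ x' : E2, φ (emb2 x') := by
  have hm : MeasurableSet lowerHalf := (isOpen_lt (coord_cont 2) continuous_const).measurableSet
  have I1 : Integrable (DD (ee 2) φ) := (DD_contDiff hφ _).continuous.integrable_of_hasCompactSupport (DD_hcs hc _)
  rw [← integral_indicator hm, ← ins_mp.integral_comp ins_me]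
  have I2 : Integrable (fun z : ℝ × (Fin 2 → ℝ) => lowerHalf.indicator (DD (ee 2) φ) (ins z.1 z.2)) :=
    (ins_mp.integrable_comp_emb ins_me).2 (I1.indicator hm)
  rw [Measure.volume_eq_prod] at I2 ⊢
  rw [integral_prod_symm _ I2]
  have e2 : ∫ x' : E2, φ (emb2 x') = ∫ y : Fin 2 → ℝ, φ (ins 0 y) := by
    rw [← (PiLp.volume_preserving_ofLp (Fin 2)).integral_comp (MeasurableEquiv.toLp 2 (Fin 2 → ℝ)).symm.measurableEmbedding]
    simp only [ins_emb]
  rw [e2]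
  congr 1
  funext y
  have hψs : ContDiff ℝ 1 (fun t => φ (ins t y)) := by
    have : (fun t => φ (ins t y)) = fun t => φ (ins 0 y + t • ee 2) := by
      funext t; rw [ins_add t y]
    rw [this]
    exact (hφ.of_le (by simp)).comp (contDiff_const.add (contDiff_id.smul contDiff_const))
  have hψd : ∀ t, deriv (fun t => φ (ins t y)) t = DD (ee 2) φ (ins t y) := by
    intro t
    have : (fun t => φ (ins t y)) = fun t => φ (ins 0 y + t • ee 2) := by
      funext t; rw [ins_add t y]
    rw [this, ins_add t y]
    have h1 : HasDerivAt (fun t : ℝ => ins 0 y + t • ee 2) (ee 2) t := by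
      have := ((hasDerivAt_id t).smul_const (ee 2)).const_add (ins 0 y)
      simpa using this
    exact ((hφ.differentiable (by simp) _).hasFDerivAt.comp_hasDerivAt t h1).deriv
  have hψc : HasCompactSupport (fun t => φ (ins t y)) := by
    obtain ⟨R, hR⟩ := hc.isCompact.isBounded.subset_closedBall 0
    refine HasCompactSupport.intro (isCompact_Icc (a := -R) (b := R)) fun t ht => ?_
    refine image_eq_zero_of_notMem_tsupport fun h => ht ?_
    have := hR h
    rw [mem_closedBall, dist_zero_right] at this
    have h2 := coord_le (ins t y) 2
    rw [ins_two] at h2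
    exact abs_le.1 (h2.trans this)
  have := hψc.integral_Iic_deriv_eq hψs 0
  rw [← this, integral_Iic_eq_integral_Iio, ← integral_indicator measurableSet_Iio]
  congr 1
  funext t
  by_cases ht : t < 0
  · have h1 : ins t y ∈ lowerHalf := by
      show ins t y 2 < 0
      rw [ins_two]; exact ht
    rw [indicator_of_mem h1, indicator_of_mem (show t ∈ Iio 0 from ht), hψd]
  · have h1 : ins t y ∉ lowerHalf := by
      intro h
      have : ins t y 2 < 0 := h
      rw [ins_two] at this; exact ht this
    rw [indicator_of_notMem h1, indicator_of_notMem (show t ∉ Iio 0 from ht)]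

/-! ### The reference stress -/

lemma DD_congr {f g : E3 → ℝ} {U : Set E3} (hU : IsOpen U) (h : ∀ x ∈ U, f x = g x) (d : E3) :
    ∀ x ∈ U, DD d f x = DD d g x := by
  intro x hx
  have : f =ᶠ[nhds x] g := by
    filter_upwards [hU.mem_nhds hx] with y hy
    exact h y hy
  unfold DD
  rw [this.fderiv_eq]

lemma T_exists {D₀ : ℝ} (hD : 0 < D₀) : ∃ T : Fin 3 → Fin 3 → E3 → ℝ,
    (∀ i j, ContDiff ℝ ∞ (T i j)) ∧ (∀ i j, HasCompactSupport (T i j)) ∧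
    (∀ i j x, x ∉ lowerHalf → T i j x = 0) ∧
    (∀ i j x, ‖x‖ ≤ 2*D₀ → x 2 ≤ -D₀ → T i j x = if i = j then 1 else 0) ∧
    (∀ i j x, T i j x = T j i x) ∧ ∀ i x, ∑ j, DD (ee j) (T i j) x = 0 := by
  let b : ContDiffBump (0 : E3) := ⟨2*D₀+1, 2*D₀+2, by positivity, by linarith⟩
  have bs : ContDiff ℝ ∞ b := b.contDiff
  let q : E3 → ℝ := fun x => b x * (Real.smoothTransition (-4/D₀ * x 2 - 1) * ((1/4) * ‖x‖^2))
  have qd : ContDiff ℝ ∞ (fun x : E3 => (1/4) * ‖x‖^2) := contDiff_const.mul (contDiff_norm_sq ℝ)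
  have qs : ContDiff ℝ ∞ q := bs.mul ((Real.smoothTransition.contDiff.comp
    ((contDiff_const.mul (coord_contDiff 2)).sub contDiff_const)).mul qd)
  have qc : HasCompactSupport q := b.hasCompactSupport.mul_right
  have D2 := fun i j => DD_contDiff (DD_contDiff qs (ee j)) (ee i)
  have D2c := fun i j => DD_hcs (DD_hcs qc (ee j)) (ee i)
  have U1 : IsOpen {x : E3 | -D₀/4 < x 2} := isOpen_lt continuous_const (coord_cont 2)
  have U2 : IsOpen ({x : E3 | ‖x‖ < 2*D₀+1} ∩ {x : E3 | x 2 < -D₀/2}) :=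
    (isOpen_lt continuous_norm continuous_const).inter (isOpen_lt (coord_cont 2) continuous_const)
  have q1 : ∀ x ∈ {x : E3 | -D₀/4 < x 2}, q x = (fun _ => (0:ℝ)) x := by
    intro x hx
    have hx' : -D₀/4 < x 2 := hx
    have : -4/D₀ * x 2 - 1 ≤ 0 := by
      have : -4/D₀ * x 2 = (-4 * x 2)/D₀ := by ring
      rw [this, sub_nonpos, div_le_one hD]
      linarith
    simp only [q, Real.smoothTransition.zero_of_nonpos this]
    ring
  have q2 : ∀ x ∈ {x : E3 | ‖x‖ < 2*D₀+1} ∩ {x : E3 | x 2 < -D₀/2}, q x = (fun x : E3 => (1/4) * ‖x‖^2) x := by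
    rintro x ⟨hx1, hx2⟩
    have hx1' : ‖x‖ < 2*D₀+1 := hx1
    have hx2' : x 2 < -D₀/2 := hx2
    have h1 : 1 ≤ -4/D₀ * x 2 - 1 := by
      have : -4/D₀ * x 2 = (-4 * x 2)/D₀ := by ring
      rw [this, le_sub_iff_add_le, le_div_iff₀ hD]
      linarith
    have h2 : b x = 1 := b.one_of_mem_closedBall (by rw [mem_closedBall, dist_zero_right]; exact hx1'.le)
    simp only [q, Real.smoothTransition.one_of_one_le h1, h2]
    ring
  have d1 : ∀ i j, ∀ x ∈ {x : E3 | -D₀/4 < x 2}, DD (ee i) (DD (ee j) q) x = 0 := by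
    intro i j x hx
    rw [DD_congr U1 (DD_congr U1 q1 (ee j)) (ee i) x hx]
    have : DD (ee j) (fun _ : E3 => (0:ℝ)) = fun _ => 0 := by funext y; simp [DD]
    rw [this]; simp [DD]
  have d2 : ∀ i j, ∀ x ∈ {x : E3 | ‖x‖ < 2*D₀+1} ∩ {x : E3 | x 2 < -D₀/2},
      DD (ee i) (DD (ee j) q) x = if i = j then 1/2 else 0 := by
    intro i j x hx
    rw [DD_congr U2 (DD_congr U2 q2 (ee j)) (ee i) x hx]
    have : DD (ee j) (fun x : E3 => (1/4) * ‖x‖^2) = fun x => (1/2) * x j := by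
      have := DD_radial (k := fun t => (1/4)*t) (contDiff_const.mul contDiff_id) j
      rw [this]
      funext y
      have : deriv (fun t : ℝ => (1/4)*t) (‖y‖^2) = 1/4 := by
        rw [deriv_const_mul _ differentiableAt_id]; simp
      rw [this]; ring
    rw [this, DD_const_mul (coord_contDiff j)]
    simp only [DD_coord]
    by_cases h : i = j
    · simp [h]
    · simp [h, Ne.symm h]
  refine ⟨fun i j x => lapl q x * (if i = j then 1 else 0) - DD (ee i) (DD (ee j) q) x, ?_, ?_, ?_, ?_, ?_, ?_⟩
  · intro i j
    exact ((lapl_contDiff qs).mul contDiff_const).sub (D2 i j)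
  · intro i j
    exact (lapl_hcs qc).mul_right.sub (D2c i j)
  · intro i j x hx
    have hx' : x ∈ {x : E3 | -D₀/4 < x 2} := by
      have : ¬ x 2 < 0 := hx
      show -D₀/4 < x 2
      linarith
    simp only [lapl, d1 _ _ x hx']
    simp
  · intro i j x h1 h2
    have hx' : x ∈ {x : E3 | ‖x‖ < 2*D₀+1} ∩ {x : E3 | x 2 < -D₀/2} := by
      refine ⟨?_, ?_⟩
      · show ‖x‖ < 2*D₀+1
        linarith
      · show x 2 < -D₀/2
        linarith
    simp only [lapl, d2 _ _ x hx']
    by_cases h : i = j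
    · simp [h]; norm_num
    · simp [h]
  · intro i j x
    simp only [DD_comm qs (ee i) (ee j), eq_comm (a := i) (b := j)]
  · intro i x
    have e : ∀ j, DD (ee j) (fun x => lapl q x * (if i = j then 1 else 0) - DD (ee i) (DD (ee j) q) x) x =
        (if i = j then 1 else 0) * DD (ee j) (lapl q) x - DD (ee j) (DD (ee j) (DD (ee i) q)) x := by
      intro j
      have h1 : ContDiff ℝ ∞ (fun x => (if i = j then (1:ℝ) else 0) * lapl q x) := contDiff_const.mul (lapl_contDiff qs)
      have := congrFun (DD_sub h1 (D2 i j) (ee j)) x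
      rw [DD_const_mul (lapl_contDiff qs), DD_comm qs (ee i) (ee j)] at this
      rw [← this]
      simp only [mul_comm, DD_comm qs (ee i) (ee j)]
    simp only [e, Finset.sum_sub_distrib]
    simp only [ite_mul, one_mul, zero_mul, Finset.sum_ite_eq, Finset.mem_univ, if_true]
    rw [DD_lapl qs]
    simp [lapl]

/-! ### The energy bound -/

/-- Gradient of w + κ x. -/
def Ug (κ : ℝ) (w : E3 → E3) (i j : Fin 3) (x : E3) : ℝ := jac w x i j + κ * (if i = j then 1 else 0)

lemma Ug_memLp {lam mu p : ℝ} {C : Set E3} {w : E3 → E3} (h : IsNormalizedSolution lam mu p C w) (i j : Fin 3) :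
    MemLp ((Om C).indicator (Ug (p/(3*lam+2*mu)) w i j)) 2 volume := by
  have hU := Om_open C
  have hw : ContDiffOn ℝ 1 w (Om C) := h.2.1
  have hc : ContinuousOn (Ug (p/(3*lam+2*mu)) w i j) (Om C) := by
    refine ContinuousOn.add ?_ continuousOn_const
    exact (DD_continuousOn hU (comp_contDiffOn hw i) (ee j)).congr fun x hx => jac_eq hU hw hx i j
  have hm : AEStronglyMeasurable ((Om C).indicator (Ug (p/(3*lam+2*mu)) w i j)) volume :=
    (aestronglyMeasurable_indicator_iff hU.measurableSet).2 (hc.aestronglyMeasurable hU.measurableSet)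
  rw [memLp_two_iff_integrable_sq hm]
  have hI : Integrable ((Om C).indicator fun x => frob2 (fun i j => jac w x i j + (p/(3*lam+2*mu)) * (if i = j then 1 else 0))) :=
    IntegrableOn.integrable_indicator h.2.2.2.1 hU.measurableSet
  refine hI.mono' (hm.pow 2) (Filter.Eventually.of_forall fun x => ?_)
  rw [Real.norm_of_nonneg (sq_nonneg _)]
  by_cases hx : x ∈ Om C
  · simp only [indicator_of_mem hx, frob2]
    have h1 := Finset.single_le_sum (f := fun b => (Ug (p/(3*lam+2*mu)) w i b x)^2) (fun b _ => sq_nonneg _) (Finset.mem_univ j)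
    have h2 := Finset.single_le_sum (f := fun a => ∑ b, (Ug (p/(3*lam+2*mu)) w a b x)^2)
      (fun b _ => Finset.sum_nonneg fun _ _ => sq_nonneg _) (Finset.mem_univ i)
    exact h1.trans h2
  · simp [indicator_of_notMem hx]

lemma DD_u {C : Set E3} {w : E3 → E3} (hw : ContDiffOn ℝ 1 w (Om C)) (κ : ℝ) {x : E3} (hx : x ∈ Om C) (i j : Fin 3) :
    DD (ee j) (fun x => w x i + κ * x i) x = Ug κ w i j x := by
  have hU := Om_open C
  have hd : DifferentiableAt ℝ (fun x => w x i) x :=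
    ((comp_contDiffOn hw i).differentiableOn (by simp) x hx).differentiableAt (hU.mem_nhds hx)
  have hk : ContDiff ℝ ∞ (fun x : E3 => κ * x i) := contDiff_const.mul (coord_contDiff i)
  have e : DD (ee j) (fun x : E3 => κ * x i) x = κ * (if i = j then 1 else 0) := by
    rw [DD_const_mul (coord_contDiff i)]
    simp only [DD_coord]
    by_cases h : i = j
    · simp [h]
    · simp [h]
  unfold Ug
  rw [jac_eq hU hw hx, ← e]
  unfold DD
  rw [fderiv_fun_add hd (hk.differentiable (by simp) x)]
  rfl

/-- The test stress. -/
def Ss (lam mu p : ℝ) (T : Fin 3 → Fin 3 → E3 → ℝ) (w : E3 → E3) (i j : Fin 3) (x : E3) : ℝ :=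
  sg lam mu w x i j + p * (if i = j then 1 else 0) - p * T i j x

lemma Ss_eq {lam mu p : ℝ} (hlam : 0 < 3*lam+2*mu) (T : Fin 3 → Fin 3 → E3 → ℝ) (w : E3 → E3) (i j : Fin 3) (x : E3) :
    Ss lam mu p T w i j x = lam * (if i = j then 1 else 0) * (∑ k, Ug (p/(3*lam+2*mu)) w k k x)
      + mu * (Ug (p/(3*lam+2*mu)) w i j x + Ug (p/(3*lam+2*mu)) w j i x) - p * T i j x := by
  have hp : p = p/(3*lam+2*mu) * (3*lam+2*mu) := by field_simp
  unfold Ss sg Ug divg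
  generalize p/(3*lam+2*mu) = κ at *
  subst hp
  by_cases h : i = j
  · simp [h, Fin.sum_univ_three]; ring
  · simp [h, Ne.symm h]

lemma Ss_sol {lam mu p D₀ : ℝ} (hlam : 0 < 3*lam+2*mu) {C : Set E3} (hC : IsCavity D₀ C)
    {w : E3 → E3} (h : IsNormalizedSolution lam mu p C w) {T : Fin 3 → Fin 3 → E3 → ℝ}
    (T1 : ∀ i j, ContDiff ℝ ∞ (T i j)) (T2 : ∀ i j, HasCompactSupport (T i j))
    (T3 : ∀ i j x, x ∉ lowerHalf → T i j x = 0)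
    (T4 : ∀ i j x, ‖x‖ ≤ 2*D₀ → x 2 ≤ -D₀ → T i j x = if i = j then 1 else 0)
    (T6 : ∀ i x, ∑ j, DD (ee j) (T i j) x = 0) (i : Fin 3) :
    Sol (Om C) (fun j => (Om C).indicator (Ss lam mu p T w i j)) := by
  have hU := Om_open C
  have hUm := hU.measurableSet
  have hL : MeasurableSet lowerHalf := (isOpen_lt (coord_cont 2) continuous_const).measurableSet
  have hTL : ∀ i j, MemLp (T i j) 2 volume := fun i j => (T1 i j).continuous.memLp_of_hasCompactSupport (T2 i j)
  have hS : ∀ j, MemLp ((Om C).indicator (Ss lam mu p T w i j)) 2 volume := by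
    intro j
    have a1 : ∀ k, MemLp _ 2 volume := fun k => Ug_memLp h k k
    have a2 := memLp_finsetSum (μ := volume) (p := 2) (Finset.univ : Finset (Fin 3)) (fun k _ => a1 k)
    have a3 := ((Ug_memLp h i j).add (Ug_memLp h j i)).const_mul mu
    have a4 := ((hTL i j).indicator hUm).const_mul p
    have a5 := ((a2.const_mul (lam * (if i = j then 1 else 0))).add a3).sub a4
    refine a5.ae_eq (Filter.Eventually.of_forall fun x => ?_)
    by_cases hx : x ∈ Om C
    · simp only [Pi.add_apply, Pi.sub_apply, Finset.sum_apply, indicator_of_mem hx]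
      rw [Ss_eq hlam]
    · simp [indicator_of_notMem hx]
  refine ⟨hS, fun j x hx => indicator_of_notMem hx _, ?_⟩
  intro φ hφ hc
  have hDφ : ∀ j, MemLp (DD (ee j) φ) 2 volume := fun j =>
    (DD_contDiff hφ _).continuous.memLp_of_hasCompactSupport (DD_hcs hc _)
  have hDφ1 : ∀ j, Integrable (DD (ee j) φ) := fun j =>
    (DD_contDiff hφ _).continuous.integrable_of_hasCompactSupport (DD_hcs hc _)
  have hTφ : ∀ j, Integrable (fun x => T i j x * DD (ee j) φ x) := fun j => (hTL i j).integrable_mul (hDφ j)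
  have hTs : Integrable (fun x => ∑ j, T i j x * DD (ee j) φ x) := integrable_finsetSum _ fun j _ => hTφ j
  set hh : E3 → ℝ := fun x => DD (ee i) φ x - ∑ j, T i j x * DD (ee j) φ x with hhd
  have hhi : Integrable hh := (hDφ1 i).sub hTs
  have hT0 : ∫ x, ∑ j, T i j x * DD (ee j) φ x = 0 := by
    rw [integral_finsetSum _ fun j _ => hTφ j]
    have : ∀ j, ∫ x, T i j x * DD (ee j) φ x = - ∫ x, DD (ee j) (T i j) x * φ x := fun j =>
      ibp isOpen_univ ((T1 i j).of_le (by simp)).contDiffOn hφ hc (subset_univ _) _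
    simp only [this]
    rw [Finset.sum_neg_distrib, ← integral_finsetSum]
    · simp only [← Finset.sum_mul, T6, zero_mul, integral_zero, neg_zero]
    · intro j _
      exact ((DD_contDiff (T1 i j) _).continuous.mul hφ.continuous).integrable_of_hasCompactSupport hc.mul_left
  have h1 : ∫ x in Om C, hh x = ∫ x in lowerHalf, hh x := by
    symm
    refine setIntegral_eq_of_subset_of_forall_diff_eq_zero hL diff_subset ?_
    intro x hx
    have hxc : x ∈ closure C := by
      by_contra hn
      exact hx.2 ⟨hx.1, hn⟩
    obtain ⟨b1, b2⟩ := closure_C hC hxc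
    simp only [hhd, T4 _ _ x b1 b2]
    simp
  have h2 : ∫ x in lowerHalf, hh x = ∫ x in lowerHalf, DD (ee i) φ x := by
    rw [hhd, integral_sub (hDφ1 i).integrableOn hTs.integrableOn]
    have : ∫ x in lowerHalf, ∑ j, T i j x * DD (ee j) φ x = 0 := by
      rw [← hT0]
      refine setIntegral_eq_integral_of_forall_compl_eq_zero fun x hx => ?_
      simp [T3 i _ x hx]
    rw [this, sub_zero]
  have h3 : ∫ x in lowerHalf, DD (ee i) φ x = ∫ x' : E2, if i = 2 then φ (emb2 x') else 0 := by
    by_cases hi : i = 2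
    · subst hi
      simp only [if_true]
      exact half_nor hφ hc
    · rw [half_tan hφ hc hi]
      simp [hi]
  have h4 := weak_form h hφ hc i
  have hSi : Integrable (fun x => ∑ j, (Om C).indicator (Ss lam mu p T w i j) x * DD (ee j) φ x) :=
    integrable_finsetSum _ fun j _ => (hS j).integrable_mul (hDφ j)
  have e1 : ∫ x, ∑ j, (Om C).indicator (Ss lam mu p T w i j) x * DD (ee j) φ x =
      ∫ x in Om C, ∑ j, (Om C).indicator (Ss lam mu p T w i j) x * DD (ee j) φ x := by
    symm
    refine setIntegral_eq_integral_of_forall_compl_eq_zero fun x hx => ?_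
    simp [indicator_of_notMem hx]
  have e2 : ∫ x in Om C, ∑ j, sg lam mu w x i j * DD (ee j) φ x =
      ∫ x in Om C, ((∑ j, (Om C).indicator (Ss lam mu p T w i j) x * DD (ee j) φ x) - p * hh x) := by
    refine setIntegral_congr_fun hUm fun x hx => ?_
    simp only [indicator_of_mem hx, hhd, Ss]
    have : DD (ee i) φ x = ∑ j, (if i = j then 1 else 0) * DD (ee j) φ x := by simp
    rw [this, ← Finset.sum_sub_distrib, Finset.mul_sum, ← Finset.sum_sub_distrib]
    refine Finset.sum_congr rfl fun j _ => ?_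
    ring
  rw [e2, integral_sub hSi.integrableOn (hhi.const_mul p).integrableOn, integral_const_mul, h1, h2, h3] at h4
  rw [e1]
  linarith

/-- The symmetrized gradient. -/
lemma coer {lam mu m : ℝ} (hm1 : m ≤ 2*mu) (hm2 : m ≤ 3*lam+2*mu) (U : Fin 3 → Fin 3 → ℝ) :
    m * ∑ i, ∑ j, ((U i j + U j i)/2)^2 ≤
      ∑ i, ∑ j, (lam * (if i = j then 1 else 0) * (∑ k, U k k) + mu * (U i j + U j i)) * U i j := by
  simp only [Fin.sum_univ_three]
  simp
  set a := U 0 0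
  set b := U 1 1
  set c := U 2 2
  set d := (U 0 1 + U 1 0)
  set e := (U 0 2 + U 2 0)
  set f := (U 1 2 + U 2 1)
  have h1 : 0 ≤ (2*mu - m) := by linarith
  have h2 : 0 ≤ (3*lam+2*mu - m) := by linarith
  have k1 := mul_nonneg h1 (add_nonneg (add_nonneg (sq_nonneg d) (sq_nonneg e)) (sq_nonneg f))
  have k2 := mul_nonneg h1 (add_nonneg (add_nonneg (sq_nonneg (a-b)) (sq_nonneg (a-c))) (sq_nonneg (b-c)))
  have k3 := mul_nonneg h2 (sq_nonneg (a+b+c))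
  have : U 1 0 = d - U 0 1 := by simp [d]
  have : U 2 0 = e - U 0 2 := by simp [e]
  have : U 2 1 = f - U 1 2 := by simp [f]
  have s1 : U 1 0 + U 0 1 = d := by simp [d]; ring
  have s2 : U 2 0 + U 0 2 = e := by simp [e]; ring
  have s3 : U 2 1 + U 1 2 = f := by simp [f]; ring
  rw [s1, s2, s3]
  simp only [*]
  nlinarith [k1, k2, k3]

lemma energy {lam mu D₀ : ℝ} (hmu : 0 < mu) (hlam : 0 < 3*lam+2*mu) (hD : 0 < D₀) :
    ∃ M > 0, ∀ C, IsCavity D₀ C → ∀ r c, 0 < r → 0 < c → c ≤ 1/2 → UC (Om C) r c → ∀ p, 0 < p →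
      ∀ w, IsNormalizedSolution lam mu p C w →
      IntegrableOn (fun x => ∑ i, ∑ j, ((Ug (p/(3*lam+2*mu)) w i j x + Ug (p/(3*lam+2*mu)) w j i x)/2)^2) (Om C) ∧
      ∫ x in Om C, ∑ i, ∑ j, ((Ug (p/(3*lam+2*mu)) w i j x + Ug (p/(3*lam+2*mu)) w j i x)/2)^2 ≤ M * p^2 := by
  obtain ⟨T, T1, T2, T3, T4, T5, T6⟩ := T_exists hD
  obtain ⟨m, hm0, hm1, hm2⟩ : ∃ m, 0 < m ∧ m ≤ 2*mu ∧ m ≤ 3*lam+2*mu :=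
    ⟨min (2*mu) (3*lam+2*mu), lt_min (by positivity) hlam, min_le_left _ _, min_le_right _ _⟩
  have hTL : ∀ i j, MemLp (T i j) 2 volume := fun i j => (T1 i j).continuous.memLp_of_hasCompactSupport (T2 i j)
  set τ : E3 → ℝ := fun x => ∑ i, ∑ j, T i j x ^ 2 with hτ
  have hτi : Integrable τ := integrable_finsetSum _ fun i _ => integrable_finsetSum _ fun j _ => (hTL i j).integrable_sq
  have hτ0 : ∀ x, 0 ≤ τ x := fun x => Finset.sum_nonneg fun i _ => Finset.sum_nonneg fun j _ => sq_nonneg _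
  have hI0 : 0 ≤ ∫ x, τ x := integral_nonneg hτ0
  refine ⟨(∫ x, τ x)/m^2 + 1, by positivity, ?_⟩
  intro C hC r c hr hc hc2 hUC p hp w h
  have hU := Om_open C
  have hUm := hU.measurableSet
  have hw : ContDiffOn ℝ 1 w (Om C) := h.2.1
  set κ := p/(3*lam+2*mu) with hκ
  have hUL := fun i j => Ug_memLp h i j
  rw [← hκ] at hUL
  -- energy identity
  have key : ∀ i, ∫ x in Om C, ∑ j, Ss lam mu p T w i j x * Ug κ w i j x = 0 := by
    intro i
    have hg : ContDiffOn ℝ 1 (fun x => w x i + κ * x i) (Om C) :=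
      (comp_contDiffOn hw i).add (contDiff_const.mul (coord_contDiff i)|>.of_le (by simp)).contDiffOn
    have ind : ∀ j, (Om C).indicator (DD (ee j) (fun x => w x i + κ * x i)) = (Om C).indicator (Ug κ w i j) := by
      intro j
      exact indicator_congr fun x hx => DD_u hw κ hx i j
    have := dens_inf hU (Ss_sol hlam hC h T1 T2 T3 T4 T6 i) hr hc hc2 hUC hg ?_ ?_
    · rw [← integral_indicator hUm, ← this]
      congr 1
      funext x
      by_cases hx : x ∈ Om C
      · simp only [indicator_of_mem hx]
        exact Finset.sum_congr rfl fun j _ => by rw [DD_u hw κ hx i j]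
      · simp [indicator_of_notMem hx]
    · have h3 := h.2.2.1
      refine Integrable.mono' h3 ?_ (Filter.Eventually.of_forall fun x => ?_)
      · refine ContinuousOn.aestronglyMeasurable ?_ hUm
        refine (hg.continuousOn.pow 2).div (by fun_prop) fun x _ => by positivity
      · rw [Real.norm_of_nonneg (by positivity)]
        refine div_le_div_of_nonneg_right ?_ (by positivity)
        rw [← sq_abs]
        refine pow_le_pow_left₀ (abs_nonneg _) ?_ 2
        have := coord_le (w x + κ • x) i
        simpa using this
    · intro j
      rw [ind]
      exact hUL i j
  have hUon : ∀ i j, MemLp (Ug κ w i j) 2 (volume.restrict (Om C)) := fun i j =>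
    (memLp_indicator_iff_restrict hUm).1 (hUL i j)
  have hTon : ∀ i j, MemLp (T i j) 2 (volume.restrict (Om C)) := fun i j => (hTL i j).restrict _
  set Q : E3 → ℝ := fun x => ∑ i, ∑ j, ((Ug κ w i j x + Ug κ w j i x)/2)^2 with hQ
  have hQi : IntegrableOn Q (Om C) := by
    refine integrable_finsetSum _ fun i _ => integrable_finsetSum _ fun j _ => ?_
    have := (((hUon i j).add (hUon j i)).const_mul (1/2)).integrable_sq
    refine this.congr (Filter.Eventually.of_forall fun x => ?_)
    simp only [Pi.add_apply]
    ring
  refine ⟨hQi, ?_⟩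
  have hSon : ∀ i j, MemLp (Ss lam mu p T w i j) 2 (volume.restrict (Om C)) := fun i j =>
    (memLp_indicator_iff_restrict hUm).1 ((Ss_sol hlam hC h T1 T2 T3 T4 T6 i).1 j)
  have hSUi : ∀ i, IntegrableOn (fun x => ∑ j, Ss lam mu p T w i j x * Ug κ w i j x) (Om C) := fun i =>
    integrable_finsetSum _ fun j _ => (hSon i j).integrable_mul (hUon i j)
  have key2 : ∫ x in Om C, ∑ i, ∑ j, Ss lam mu p T w i j x * Ug κ w i j x = 0 := by
    rw [integral_finsetSum _ fun i _ => hSUi i]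
    exact Finset.sum_eq_zero fun i _ => key i
  have pt : ∀ x, m * Q x ≤ (∑ i, ∑ j, Ss lam mu p T w i j x * Ug κ w i j x) + (m/2 * Q x + p^2/(2*m) * τ x) := by
    intro x
    have c1 := coer hm1 hm2 (fun i j => Ug κ w i j x)
    have c2 : ∑ i, ∑ j, Ss lam mu p T w i j x * Ug κ w i j x =
      (∑ i, ∑ j, (lam * (if i = j then 1 else 0) * (∑ k, Ug κ w k k x) + mu * (Ug κ w i j x + Ug κ w j i x)) * Ug κ w i j x)
       - p * ∑ i, ∑ j, T i j x * ((Ug κ w i j x + Ug κ w j i x)/2) := by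
      have : ∑ i, ∑ j, T i j x * ((Ug κ w i j x + Ug κ w j i x)/2) = ∑ i, ∑ j, T i j x * Ug κ w i j x := by
        simp only [Fin.sum_univ_three]
        rw [T5 1 0, T5 2 0, T5 2 1]
        ring
      rw [this, Finset.mul_sum, ← Finset.sum_sub_distrib]
      refine Finset.sum_congr rfl fun i _ => ?_
      rw [Finset.mul_sum, ← Finset.sum_sub_distrib]
      refine Finset.sum_congr rfl fun j _ => ?_
      rw [Ss_eq hlam]
      ring
    have c3 : p * ∑ i, ∑ j, T i j x * ((Ug κ w i j x + Ug κ w j i x)/2) ≤ m/2 * Q x + p^2/(2*m) * τ x := by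
      simp only [hQ, hτ, Finset.mul_sum, ← Finset.sum_add_distrib]
      refine Finset.sum_le_sum fun i _ => Finset.sum_le_sum fun j _ => ?_
      generalize (Ug κ w i j x + Ug κ w j i x)/2 = u
      have : m/2 * u^2 + p^2/(2*m) * T i j x ^2 - p * (T i j x * u) = (m*u - p * T i j x)^2/(2*m) := by
        field_simp
        ring
      have h0 : 0 ≤ (m*u - p * T i j x)^2/(2*m) := by positivity
      linarith
    linarith
  have hi1 : IntegrableOn (fun x => ∑ i, ∑ j, Ss lam mu p T w i j x * Ug κ w i j x) (Om C) :=
    integrable_finsetSum _ fun i _ => hSUi i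
  have hi2 : IntegrableOn (fun x => m/2 * Q x + p^2/(2*m) * τ x) (Om C) :=
    (hQi.const_mul _).add (hτi.integrableOn.const_mul _)
  have hrhs : IntegrableOn (fun x => (∑ i, ∑ j, Ss lam mu p T w i j x * Ug κ w i j x) + (m/2 * Q x + p^2/(2*m) * τ x)) (Om C) :=
    hi1.add hi2
  have fin := setIntegral_mono (hQi.const_mul m) hrhs pt
  rw [integral_const_mul, integral_add hi1 hi2,
    key2, integral_add (hQi.const_mul _) (hτi.integrableOn.const_mul _), integral_const_mul, integral_const_mul] at fin
  have hτle : ∫ x in Om C, τ x ≤ ∫ x, τ x := setIntegral_le_integral hτi (Filter.Eventually.of_forall hτ0)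
  have f2 : m/2 * ∫ x in Om C, Q x ≤ p^2/(2*m) * ∫ x, τ x := by
    have : p^2/(2*m) * ∫ x in Om C, τ x ≤ p^2/(2*m) * ∫ x, τ x := mul_le_mul_of_nonneg_left hτle (by positivity)
    linarith
  have f3 : ∫ x in Om C, Q x ≤ (∫ x, τ x)/m^2 * p^2 := by
    have : (∫ x, τ x)/m^2 * p^2 = (p^2/(2*m) * ∫ x, τ x) / (m/2) := by field_simp
    rw [this, le_div_iff₀ (by positivity)]
    linarith
  nlinarith [sq_nonneg p]

/-! ### Assembly -/

lemma frob2_strain (κ : ℝ) (w : E3 → E3) (x : E3) :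
    frob2 (strain w x) ≤ 2 * (∑ i, ∑ j, ((Ug κ w i j x + Ug κ w j i x)/2)^2) + 6 * κ^2 := by
  unfold frob2 strain Ug
  simp only [Fin.sum_univ_three]
  generalize jac w x = J
  simp
  nlinarith [sq_nonneg (J 0 0 + 2*κ), sq_nonneg (J 1 1 + 2*κ), sq_nonneg (J 2 2 + 2*κ),
    sq_nonneg (J 0 1 + J 1 0), sq_nonneg (J 0 2 + J 2 0), sq_nonneg (J 1 2 + J 2 1)]

lemma frob2_nonneg (A : Matrix (Fin 3) (Fin 3) ℝ) : 0 ≤ frob2 A :=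
  Finset.sum_nonneg fun _ _ => Finset.sum_nonneg fun _ _ => sq_nonneg _

lemma sq_le_sum2 (F : Fin 3 → Fin 3 → ℝ) : F 0 0 ^ 2 ≤ ∑ i, ∑ j, F i j ^ 2 := by
  simp only [Fin.sum_univ_three]
  nlinarith [sq_nonneg (F 0 1), sq_nonneg (F 0 2), sq_nonneg (F 1 0), sq_nonneg (F 1 1), sq_nonneg (F 1 2),
    sq_nonneg (F 2 0), sq_nonneg (F 2 1), sq_nonneg (F 2 2)]

lemma strain_int {C : Set E3} {w : E3 → E3} (hw : ContDiffOn ℝ 1 w (Om C)) {κ M : ℝ}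
    (hQ : IntegrableOn (fun x => ∑ i, ∑ j, ((Ug κ w i j x + Ug κ w j i x)/2)^2) (Om C))
    (hM : ∫ x in Om C, ∑ i, ∑ j, ((Ug κ w i j x + Ug κ w j i x)/2)^2 ≤ M)
    {S : Set E3} (hS : MeasurableSet S) (hSO : S ⊆ Om C) {q : E3} {ρ : ℝ} (hρ : 0 ≤ ρ) (hSb : S ⊆ closedBall q ρ) :
    IntegrableOn (fun x => frob2 (strain w x)) S ∧ ∫ x in S, frob2 (strain w x) ≤ 2*M + 6*κ^2*(ρ^3*v1) := by
  have hU := Om_open C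
  have hfin : volume S < ⊤ := (measure_mono hSb).trans_lt measure_closedBall_lt_top
  have hci : IntegrableOn (fun _ : E3 => 6*κ^2) S := integrableOn_const hfin.ne
  have hJ : ∀ i j, ContinuousOn (fun x => jac w x i j) (Om C) := fun i j =>
    (DD_continuousOn hU (comp_contDiffOn hw i) (ee j)).congr fun x hx => jac_eq hU hw hx i j
  have hc : ContinuousOn (fun x => frob2 (strain w x)) (Om C) := by
    unfold frob2 strain
    refine continuousOn_finsetSum _ fun i _ => continuousOn_finsetSum _ fun j _ => ?_
    exact (((hJ i j).add (hJ j i)).div_const 2).pow 2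
  have hQS := hQ.mono_set hSO
  have hd : IntegrableOn (fun x => 2 * (∑ i, ∑ j, ((Ug κ w i j x + Ug κ w j i x)/2)^2) + 6 * κ^2) S :=
    (hQS.const_mul 2).add hci
  have hi : IntegrableOn (fun x => frob2 (strain w x)) S := by
    refine Integrable.mono' hd ((hc.mono hSO).aestronglyMeasurable hS) (Filter.Eventually.of_forall fun x => ?_)
    rw [Real.norm_of_nonneg (frob2_nonneg _)]
    exact frob2_strain κ w x
  refine ⟨hi, ?_⟩
  have h1 := setIntegral_mono hi hd (fun x => frob2_strain κ w x)
  rw [integral_add (hQS.const_mul 2) hci, integral_const_mul] at h1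
  have h2 : ∫ x in S, ∑ i, ∑ j, ((Ug κ w i j x + Ug κ w j i x)/2)^2 ≤ ∫ x in Om C, ∑ i, ∑ j, ((Ug κ w i j x + Ug κ w j i x)/2)^2 :=
    setIntegral_mono_set hQ (Filter.Eventually.of_forall fun x =>
      Finset.sum_nonneg fun _ _ => Finset.sum_nonneg fun _ _ => sq_nonneg _) (Filter.Eventually.of_forall hSO)
  have h3 : ∫ _ in S, 6*κ^2 ≤ 6*κ^2*(ρ^3*v1) := by
    rw [setIntegral_const, smul_eq_mul, mul_comm]
    refine mul_le_mul_of_nonneg_left ?_ (by positivity)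
    rw [← vol_cb q hρ]
    exact measureReal_mono hSb measure_closedBall_lt_top.ne
  linarith

lemma ball_in {S : Set E3} (hS : IsOpen S) {x : E3} (hx : x ∈ S) {t : ℝ} (ht : t < infDist x (frontier S)) :
    closedBall x t ⊆ S := by
  by_cases ht0 : t < 0
  · rw [closedBall_eq_empty.2 ht0]; exact empty_subset _
  push Not at ht0
  have hpre : IsPreconnected (closedBall x t) := (convex_closedBall x t).isPreconnected
  refine hpre.subset_left_of_subset_union hS isClosed_closure.isOpen_compl (v := (closure S)ᶜ) ?_ ?_ ?_
  · exact disjoint_compl_right_iff_subset.2 subset_closure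
  · intro y hy
    by_contra hn
    simp only [mem_union, mem_compl_iff, not_or, not_not] at hn
    have : y ∈ frontier S := by
      rw [hS.frontier_eq]; exact ⟨hn.2, hn.1⟩
    have h1 := infDist_le_dist_of_mem (x := x) this
    rw [mem_closedBall, dist_comm] at hy
    linarith
  · exact ⟨x, mem_closedBall_self ht0, hx⟩

lemma far_point {lam mu D₀ M : ℝ} (hlam : 0 < 3*lam+2*mu) (hD : 1 < D₀) (hM : 0 < M) :
    ∃ L, 3*D₀ + 2 ≤ L ∧ ∀ C, IsCavity D₀ C → ∀ p, 0 < p → ∀ w : E3 → E3, ContDiffOn ℝ 1 w (Om C) → 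
      IntegrableOn (fun x => ∑ i, ∑ j, ((Ug (p/(3*lam+2*mu)) w i j x + Ug (p/(3*lam+2*mu)) w j i x)/2)^2) (Om C) →
      ∫ x in Om C, ∑ i, ∑ j, ((Ug (p/(3*lam+2*mu)) w i j x + Ug (p/(3*lam+2*mu)) w j i x)/2)^2 ≤ M * p^2 →
      ∃ x, closedBall x 1 ⊆ Om C ∧ x ∈ Bx L ∧ p/(3*lam+2*mu)/2 ≤ |DD (ee 0) (fun x => w x 0) x| := by
  have hv := v1_pos
  set Λ := 3*lam+2*mu with hΛ
  set ρ := 1 + 4*M*Λ^2/v1 with hρ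
  have hρ1 : 1 ≤ ρ := by rw [hρ]; have : 0 ≤ 4*M*Λ^2/v1 := by positivity
                         linarith
  have hρ3 : 4*M*Λ^2 < ρ^3*v1 := by
    have h1 : ρ ≤ ρ^3 := le_self_pow₀ hρ1 (by norm_num)
    have h2 : 4*M*Λ^2 = (ρ-1)*v1 := by rw [hρ]; field_simp; ring
    rw [h2]
    exact mul_lt_mul_of_pos_right (by linarith) hv
  refine ⟨2*ρ+3*D₀+2, by linarith, ?_⟩
  intro C hC p hp w hw hQ hQM
  set κ := p/Λ with hκ
  have hκ0 : 0 < κ := by positivity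
  have hU := Om_open C
  set q : E3 := EuclideanSpace.single 2 (-(ρ+2*D₀+2)) with hq
  have hq0 : q 0 = 0 := by simp [hq]
  have hq1 : q 1 = 0 := by simp [hq]
  have hq2 : q 2 = -(ρ+2*D₀+2) := by simp [hq]
  have hco : ∀ x t, x ∈ closedBall q t → ∀ i, |x i - q i| ≤ t := by
    intro x t hx i
    have := coord_le (x - q) i
    rw [mem_closedBall, dist_eq_norm] at hx
    exact (by simpa using this : |x i - q i| ≤ ‖x - q‖).trans hx
  have hin : closedBall q (ρ+1) ⊆ Om C := by
    intro x hx
    have h2 := hco x _ hx 2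
    rw [hq2, abs_le] at h2
    refine ⟨?_, fun hxc => ?_⟩
    · show x 2 < 0
      linarith
    · have h3 := (closure_C hC hxc).1
      have h4 := coord_le x 2
      rw [abs_le] at h4
      linarith
  have hin' : closedBall q ρ ⊆ Om C := (closedBall_subset_closedBall (by linarith)).trans hin
  by_contra hcon
  push Not at hcon
  have hsm : ∀ x ∈ closedBall q ρ, κ^2/4 ≤ ∑ i, ∑ j, ((Ug κ w i j x + Ug κ w j i x)/2)^2 := by
    intro x hx
    have h1 : |DD (ee 0) (fun x => w x 0) x| < κ/2 := by
      refine hcon x ((closedBall_subset_closedBall' ?_).trans hin) ?_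
      · rw [mem_closedBall] at hx; linarith
      · have a0 := hco x _ hx 0
        have a1 := hco x _ hx 1
        have a2 := hco x _ hx 2
        rw [hq0, sub_zero] at a0
        rw [hq1, sub_zero] at a1
        rw [hq2, abs_le] at a2
        exact ⟨by linarith, by linarith, by linarith⟩
    rw [← jac_eq hU hw (hin' hx), abs_lt] at h1
    refine le_trans ?_ (sq_le_sum2 fun i j => (Ug κ w i j x + Ug κ w j i x)/2)
    simp only [Ug, if_true]
    nlinarith
  have hi : ∫ _ in closedBall q ρ, κ^2/4 ≤ M*p^2 := by
    refine le_trans ?_ hQM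
    refine le_trans (setIntegral_mono_on (integrableOn_const measure_closedBall_lt_top.ne) (hQ.mono_set hin') isClosed_closedBall.measurableSet hsm) ?_
    exact setIntegral_mono_set hQ (Filter.Eventually.of_forall fun x =>
      Finset.sum_nonneg fun _ _ => Finset.sum_nonneg fun _ _ => sq_nonneg _) (Filter.Eventually.of_forall hin')
  rw [setIntegral_const, smul_eq_mul, vol_cb q (by linarith)] at hi
  have hpk : p = κ*Λ := by rw [hκ]; field_simp
  rw [hpk] at hi
  have : κ^2/4*(4*M*Λ^2) < κ^2/4*(ρ^3*v1) := mul_lt_mul_of_pos_left hρ3 (by positivity)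
  nlinarith

set_option maxHeartbeats 1000000 in
lemma core {lam mu r₀ E₀ D₀ : ℝ} (hmu : 0 < mu) (hlam : 0 < 3*lam + 2*mu) (hr₀ : 0 < r₀) (hE₀ : 0 < E₀) (hD₀ : 1 < D₀) :
    ∃ K ϱ₀ a b B B' : ℝ, 8 ≤ K ∧ 0 < ϱ₀ ∧ 0 < a ∧ 0 < b ∧ 0 < B ∧ 0 < B' ∧
      ∀ C : Set E3, IsC3Cavity r₀ E₀ D₀ C → ∀ p : ℝ, 0 < p →
      ∀ w : E3 → E3, IsNormalizedSolution lam mu p C w →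
      (∫ x in negBall (3*D₀) \ closure C, frob2 (strain w x)) ≤ B' * p^2 ∧
      IntegrableOn (fun x => frob2 (strain w x)) (negBall (3*D₀) \ closure C) ∧
      ∀ ϱ : ℝ, 0 < ϱ → ϱ ≤ ϱ₀ → ∀ xb, closedBall xb (2*K*ϱ) ⊆ negBall (3*D₀) \ closure C → 
      B * p^2 * Real.exp (-(a * ϱ ^ (-b))) ≤ ∫ x in Metric.ball xb ϱ, frob2 (strain w x) := by
  obtain ⟨K, θ, β, hT⟩ := TB_exists
  obtain ⟨r, hr, c, hc, hr2, hc2, hUC⟩ := uc_exists r₀ E₀ D₀ hr₀ hE₀ hD₀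
  obtain ⟨M, hM, hE⟩ := energy hmu hlam (by linarith : (0:ℝ) < D₀)
  obtain ⟨L, hL, hfar⟩ := far_point hlam hD₀ hM
  obtain ⟨N₀, hgr⟩ := graph hT hr hr2 hc hc2 (by linarith : (0:ℝ) < D₀) (by linarith : 2*D₀+1 ≤ L)
  obtain ⟨A, hA, hsup⟩ := sup_bound
  have hv := v1_pos
  have hK8 := hT.1
  have hK0 : 0 < K := by linarith
  have hθ := hT.2.1
  have hβ := hT.2.2.1
  have hθ2 := hT.2.2.2.1
  set Λ := 3*lam+2*mu with hΛ
  set B := 2*M + 6*(v1/Λ^2) with hB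
  have hB0 : 0 < B := by positivity
  set G := Real.sqrt (8*A*B) with hG
  have hG0 : 0 < G := Real.sqrt_pos.2 (by positivity)
  have hG2 : G^2 = 8*A*B := Real.sq_sqrt (by positivity)
  set g := 1 + c/(16*K) with hg
  have hg1 : 1 < g := by rw [hg]; have : 0 < c/(16*K) := by positivity
                         linarith
  set b' := Real.log θ⁻¹ / Real.log g with hb'
  have hlg : 0 < Real.log g := Real.log_pos hg1
  have hθi : 1 < θ⁻¹ := (one_lt_inv₀ hθ).2 (by linarith)
  have hb'0 : 0 < b' := div_pos (Real.log_pos hθi) hlg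
  set X := 2*G*Λ*Real.exp (2*β) with hX
  have hX0 : 0 < X := by positivity
  set aa := (θ⁻¹)^N₀ * X with haa
  have haa0 : 0 < aa := by positivity
  refine ⟨K, min (r/(8*K)) (c^2*r/128), 4*aa, b'+2, B, 2*M + 6*(1/Λ^2)*((3*D₀)^3*v1), hK8, by positivity, by positivity,
    by positivity, hB0, by positivity, ?_⟩
  intro C hC p hp w hw
  have hU := Om_open C
  have hw1 : ContDiffOn ℝ 1 w (Om C) := hw.2.1
  obtain ⟨hQ, hQM⟩ := hE C hC.1 r c hr hc hc2 (hUC C hC) p hp w hw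
  set κ := p/Λ with hκ
  have hκ0 : 0 < κ := by positivity
  have hκ2 : κ^2 = p^2/Λ^2 := by rw [hκ, div_pow]
  have hneg : negBall (3*D₀) \ closure C ⊆ Om C := fun x hx => ⟨hx.1.2, hx.2⟩
  have hnb : negBall (3*D₀) ⊆ closedBall 0 (3*D₀) := fun x hx => by
    rw [mem_closedBall_zero_iff]; exact hx.1.le
  have hno : IsOpen (negBall (3*D₀)) :=
    (isOpen_lt continuous_norm continuous_const).inter (isOpen_lt (coord_cont 2) continuous_const)
  have hSm : MeasurableSet (negBall (3*D₀) \ closure C) := (hno.sdiff isClosed_closure).measurableSet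
  obtain ⟨hJ1, hJ2⟩ := strain_int hw1 hQ hQM hSm hneg (by linarith : (0:ℝ) ≤ 3*D₀) (sdiff_subset.trans hnb)
  refine ⟨?_, hJ1, ?_⟩
  · refine hJ2.trans (le_of_eq ?_)
    rw [hκ2]; ring
  intro ϱ hϱ hϱ0 xb hxb
  have hϱ1 := hϱ0.trans (min_le_left _ _)
  have hϱ2 := hϱ0.trans (min_le_right _ _)
  have hKϱ : K*ϱ ≤ r/8 := by
    rw [le_div_iff₀ (by positivity)] at hϱ1
    linarith
  have hKρ1 : 1*ϱ ≤ K*ϱ := mul_le_mul_of_nonneg_right (by linarith) hϱ.le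
  have hϱle : ϱ ≤ 1 := by linarith
  obtain ⟨xs, hxs1, hxs2, hxs3⟩ := hfar C hC.1 p hp w hw1 hQ hQM
  set f := DD (ee 0) (fun x => w x 0) with hf
  have hfW : WB f (Om C) := wb_f hmu hlam hw
  have hfs : ∀ x ∈ Om C, f x ^ 2 ≤ frob2 (strain w x) := by
    intro x hx
    have h1 := sq_le_sum2 (strain w x)
    have h2 : strain w x 0 0 = f x := by
      rw [hf, ← jac_eq hU hw1 hx]; unfold strain; ring
    rwa [h2] at h1
  have hfc : ContinuousOn f (Om C) := DD_continuousOn hU (comp_contDiffOn hw1 0) (ee 0)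
  -- sup bounds
  have hsb : ∀ y ε, 0 < ε → ε ≤ 1 → ball y ε ⊆ Om C → 
      f y ^ 2 ≤ A/ε^3 * ∫ x in ball y ε, frob2 (strain w x) ∧ ∫ x in ball y ε, frob2 (strain w x) ≤ B*p^2 ∧
      IntegrableOn (fun x => frob2 (strain w x)) (ball y ε) := by
    intro y ε hε hε1 hb
    obtain ⟨i1, i2⟩ := strain_int hw1 hQ hQM measurableSet_ball hb hε.le ball_subset_closedBall
    have i3 : IntegrableOn (fun x => f x ^ 2) (ball y ε) := by
      refine Integrable.mono' i1 (((hfc.mono hb).pow 2).aestronglyMeasurable measurableSet_ball) ?_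
      refine (ae_restrict_iff' measurableSet_ball).2 (Filter.Eventually.of_forall fun x hx => ?_)
      rw [Real.norm_of_nonneg (sq_nonneg _)]
      exact hfs x (hb hx)
    refine ⟨(hsup _ f hU hfW y ε hε hb i3).trans ?_, i2.trans ?_, i1⟩
    · refine mul_le_mul_of_nonneg_left ?_ (by positivity)
      exact setIntegral_mono_on i3 i1 measurableSet_ball fun x hx => hfs x (hb hx)
    · have e3 : ε^3 ≤ 1 := pow_le_one₀ hε.le hε1
      have : 6*κ^2*(ε^3*v1) ≤ 6*κ^2*(1*v1) := by gcongr
      calc 2*(M*p^2) + 6*κ^2*(ε^3*v1) ≤ 2*(M*p^2) + 6*κ^2*(1*v1) := by linarith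
        _ = B*p^2 := by rw [hκ2, hB]; ring
  set I := ∫ x in Metric.ball xb ϱ, frob2 (strain w x) with hI
  have hxbO : closedBall xb (2*K*ϱ) ⊆ Om C := hxb.trans hneg
  have hbϱ : ball xb ϱ ⊆ Om C := by
    refine (ball_subset_closedBall.trans (closedBall_subset_closedBall ?_)).trans hxbO
    linarith
  obtain ⟨-, -, hIi⟩ := hsb xb ϱ hϱ hϱle hbϱ
  set MM := G*p/ϱ^2 with hMM
  have hMM0 : 0 < MM := by positivity
  have hpow : A/(ϱ/2)^3 ≤ 8*A/ϱ^4 := by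
    have e : A/(ϱ/2)^3 = 8*A/ϱ^3 := by field_simp; norm_num
    rw [e]
    exact div_le_div_of_nonneg_left (by positivity) (by positivity)
      (pow_le_pow_of_le_one hϱ.le hϱle (by norm_num))
  have hGood : Good f (Om C) MM (ϱ/2) := by
    refine ⟨hU, hfW, hMM0.le, by positivity, fun y hy => ?_⟩
    obtain ⟨h1, h2, -⟩ := hsb y (ϱ/2) (by positivity) (by linarith) hy
    refine abs_le_of_sq_le_sq ?_ hMM0.le
    calc f y^2 ≤ A/(ϱ/2)^3 * (B*p^2) := h1.trans (mul_le_mul_of_nonneg_left h2 (by positivity))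
      _ ≤ 8*A/ϱ^4 * (B*p^2) := mul_le_mul_of_nonneg_right hpow (by positivity)
      _ = MM^2 := by rw [hMM, div_pow, mul_pow, hG2]; field_simp
  obtain ⟨n, z, hn, hz1, hz2, hz3⟩ := push hT hr hc hc2 (hUC C hC) hϱ hGood hKϱ hxbO
  have hxbn : ‖xb‖ < 3*D₀ := (hxb (mem_closedBall_self (by positivity))).1.1
  have hzn : ‖z‖ ≤ L := by
    have : ‖z‖ ≤ ‖xb‖ + ‖z - xb‖ := by
      calc ‖z‖ = ‖xb + (z - xb)‖ := by congr 1; abel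
        _ ≤ _ := norm_add_le _ _
    rw [dist_eq_norm] at hz2
    linarith
  have hzB : z ∈ Bx L := ⟨(coord_le z 0).trans hzn, (coord_le z 1).trans hzn, by
    have := (coord_le z 2).trans hzn
    rw [abs_le] at this
    exact this.1⟩
  have hcr0 : c^2*r ≤ c*r := mul_le_mul_of_nonneg_right (by rw [sq]; exact mul_le_of_le_one_left hc.le (by linarith)) hr.le
  have hcrp : c*r ≤ 1 := mul_le_one₀ (by linarith) hr.le (by linarith)
  have hcr2 : 0 < c*r := mul_pos hc hr
  have hcr : c^2*r/128 ≤ c*r/32 := by linarith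
  have hcr1 : c^2*r/128 ≤ 1 := by linarith
  obtain ⟨n1, hn1, hgr2⟩ := hgr C hC.1 (hUC C hC) f MM (ϱ/2) hGood (by linarith) z
    ((closedBall_subset_closedBall hcr).trans hz1) xs ((closedBall_subset_closedBall hcr1).trans hxs1) hzB hxs2
  -- the contradiction
  by_contra hcon
  push Not at hcon
  set ww := ϱ ^ (-(b'+2)) with hww
  have hww0 : 0 < ww := Real.rpow_pos_of_pos hϱ _
  set τ := 2*aa*ww with hτ
  have hτ0 : 0 < τ := by positivity
  have hst : Sm f MM τ xb (ϱ/2) := by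
    intro y hy
    have hyb : ball y (ϱ/2) ⊆ ball xb ϱ := ball_subset_ball' (by rw [mem_closedBall] at hy; linarith)
    obtain ⟨h1, -, -⟩ := hsb y (ϱ/2) (by positivity) (by linarith) (hyb.trans hbϱ)
    have h2 : ∫ x in ball y (ϱ/2), frob2 (strain w x) ≤ I :=
      setIntegral_mono_set hIi (Filter.Eventually.of_forall fun x => frob2_nonneg _) (Filter.Eventually.of_forall hyb)
    have hI0 : 0 ≤ I := setIntegral_nonneg measurableSet_ball fun x _ => frob2_nonneg _
    refine abs_le_of_sq_le_sq ?_ (by positivity)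
    have h3 : I ≤ B*p^2*Real.exp (-τ)^2 := by
      refine hcon.le.trans (le_of_eq ?_)
      rw [← Real.exp_nat_mul]
      congr 2
      rw [hτ]; push_cast; ring
    calc f y^2 ≤ A/(ϱ/2)^3 * I := h1.trans (mul_le_mul_of_nonneg_left h2 (by positivity))
      _ ≤ 8*A/ϱ^4 * I := mul_le_mul_of_nonneg_right hpow hI0
      _ ≤ 8*A/ϱ^4 * (B*p^2*Real.exp (-τ)^2) := mul_le_mul_of_nonneg_left h3 (by positivity)
      _ = (MM*Real.exp (-τ))^2 := by rw [mul_pow, hMM, div_pow, mul_pow, hG2]; field_simp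
  have hfin := hgr2 _ (fun y hy => hz3 τ hst y (closedBall_subset_closedBall ?_ hy))
  swap
  · rw [div_div]
    exact div_le_div₀ (by positivity) hcr0 (by positivity) (by linarith)
  rw [← Function.iterate_add_apply] at hfin
  have hph := Phi_iter hθ hθ2 hβ τ hτ0.le (n1+n) (N₀+n) (by omega)
  have h5 : κ/2 ≤ MM * Real.exp (-(θ^(N₀+n)*τ - 2*β)) := by
    refine hxs3.trans (hfin.trans (mul_le_mul_of_nonneg_left (Real.exp_le_exp.2 (by linarith)) hMM0.le))
  have h6 : Real.exp (θ^(N₀+n)*τ) ≤ X/ϱ^2 := by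
    have e1 : Real.exp (-(θ^(N₀+n)*τ - 2*β)) = Real.exp (2*β) / Real.exp (θ^(N₀+n)*τ) := by
      rw [← Real.exp_sub]; congr 1; ring
    rw [e1, ← mul_div_assoc, le_div_iff₀ (Real.exp_pos _)] at h5
    have e2 : MM * Real.exp (2*β) = (κ/2) * (X/ϱ^2) := by
      rw [hMM, hX, hκ]; field_simp
    rw [e2] at h5
    exact le_of_mul_le_mul_left h5 (by positivity)
  have h7 : θ^(N₀+n)*τ ≤ X/ϱ^2 := by
    have := Real.add_one_le_exp (θ^(N₀+n)*τ)
    linarith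
  have h8 : (θ⁻¹)^n ≤ ϱ ^ (-b') := by
    have e1 : θ⁻¹ = g ^ b' := by
      rw [Real.rpow_def_of_pos (by linarith), hb', mul_div_cancel₀ _ hlg.ne', Real.exp_log (by positivity)]
    have e2 : g^n ≤ ϱ⁻¹ := hn.trans (by rw [div_eq_mul_inv]; exact mul_le_of_le_one_left (inv_pos.2 hϱ).le (by linarith))
    rw [e1, ← Real.rpow_natCast, ← Real.rpow_mul (by linarith), mul_comm, Real.rpow_mul (by linarith), Real.rpow_natCast,
      Real.rpow_neg hϱ.le, ← Real.inv_rpow hϱ.le]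
    exact Real.rpow_le_rpow (by positivity) e2 hb'0.le
  have h9 : ww = ϱ^(-b') / ϱ^2 := by
    rw [hww, neg_add, Real.rpow_add hϱ, Real.rpow_neg hϱ.le 2, div_eq_mul_inv]
    norm_num
  have h10 : τ ≤ aa * ww := by
    have e : τ = (θ⁻¹)^(N₀+n) * (θ^(N₀+n)*τ) := by
      rw [← mul_assoc, ← mul_pow, inv_mul_cancel₀ hθ.ne', one_pow, one_mul]
    calc τ = (θ⁻¹)^(N₀+n) * (θ^(N₀+n)*τ) := e
      _ ≤ (θ⁻¹)^(N₀+n) * (X/ϱ^2) := mul_le_mul_of_nonneg_left h7 (by positivity)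
      _ = (θ⁻¹)^N₀ * X / ϱ^2 * (θ⁻¹)^n := by rw [pow_add]; ring
      _ ≤ (θ⁻¹)^N₀ * X / ϱ^2 * ϱ ^ (-b') := mul_le_mul_of_nonneg_left h8 (by positivity)
      _ = aa * ww := by rw [haa, h9]; ring
  have : 0 < aa * ww := by positivity
  rw [hτ] at h10
  linarith

/-- Lipschitz propagation of smallness for normalized solutions of the cavity problem. -/
theorem lipschitz_propagation_of_smallness (lam mu r₀ E₀ D₀ : ℝ)
    (hmu : 0 < mu) (hlam : 0 < 3*lam + 2*mu) (hr₀ : 0 < r₀) (hE₀ : 0 < E₀) (hD₀ : 1 < D₀) :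
    ∃ R s a b c : ℝ, 3*D₀ ≤ R ∧ 1 < s ∧ 0 < a ∧ 0 < b ∧ 0 < c ∧
      ∀ C : Set E3, IsC3Cavity r₀ E₀ D₀ C → ∀ p : ℝ, 0 < p →
      ∀ w : E3 → E3, IsNormalizedSolution lam mu p C w →
      ∀ ϱ : ℝ, 0 < ϱ → ∀ xb ∈ negBall R \ closure C,
      s * ϱ < Metric.infDist xb (frontier (negBall R \ closure C)) →
      c * Real.exp (-(a * ϱ ^ (-b))) * (∫ x in negBall R \ closure C, frob2 (strain w x)) ≤
        ∫ x in Metric.ball xb ϱ, frob2 (strain w x) := by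
  obtain ⟨K, ϱ₀, a, b, B, B', hK, hϱ₀, ha, hb, hB, hB', H⟩ := core hmu hlam hr₀ hE₀ hD₀
  refine ⟨3*D₀, 2*K, a, b, B/B' * Real.exp (-(a*ϱ₀^(-b))), le_rfl, by linarith, ha, hb, by positivity, ?_⟩
  intro C hC p hp w hw ϱ hϱ xb hxb hd
  obtain ⟨h1, h2, h3⟩ := H C hC p hp w hw
  have hno : IsOpen (negBall (3*D₀)) :=
    (isOpen_lt continuous_norm continuous_const).inter (isOpen_lt (coord_cont 2) continuous_const)
  have hin := ball_in (hno.sdiff isClosed_closure) hxb hd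
  set ϱ' := min ϱ ϱ₀ with hϱ'
  have hϱ'0 : 0 < ϱ' := lt_min hϱ hϱ₀
  have hle : ϱ' ≤ ϱ := min_le_left _ _
  have h4 := h3 ϱ' hϱ'0 (min_le_right _ _) xb
    ((closedBall_subset_closedBall (mul_le_mul_of_nonneg_left hle (by linarith))).trans hin)
  have hbs : ball xb ϱ ⊆ negBall (3*D₀) \ closure C := by
    refine (ball_subset_closedBall.trans (closedBall_subset_closedBall ?_)).trans hin
    nlinarith
  have h5 : ∫ x in Metric.ball xb ϱ', frob2 (strain w x) ≤ ∫ x in Metric.ball xb ϱ, frob2 (strain w x) :=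
    setIntegral_mono_set (h2.mono_set hbs) (Filter.Eventually.of_forall fun x => frob2_nonneg _)
      (Filter.Eventually.of_forall (ball_subset_ball hle))
  have h6 : Real.exp (-(a*ϱ₀^(-b))) * Real.exp (-(a*ϱ^(-b))) ≤ Real.exp (-(a*ϱ'^(-b))) := by
    rw [← Real.exp_add, Real.exp_le_exp]
    have e1 : 0 < a*ϱ₀^(-b) := mul_pos ha (Real.rpow_pos_of_pos hϱ₀ _)
    have e2 : 0 < a*ϱ^(-b) := mul_pos ha (Real.rpow_pos_of_pos hϱ _)
    rcases min_choice ϱ ϱ₀ with h | h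
    · rw [hϱ', h]; linarith
    · rw [hϱ', h]; linarith
  refine le_trans ?_ (h4.trans h5)
  calc B/B' * Real.exp (-(a*ϱ₀^(-b))) * Real.exp (-(a * ϱ ^ (-b))) * (∫ x in negBall (3*D₀) \ closure C, frob2 (strain w x))
      ≤ B/B' * Real.exp (-(a*ϱ₀^(-b))) * Real.exp (-(a * ϱ ^ (-b))) * (B' * p^2) :=
        mul_le_mul_of_nonneg_left h1 (by positivity)
    _ = B * p^2 * (Real.exp (-(a*ϱ₀^(-b))) * Real.exp (-(a * ϱ ^ (-b)))) := by field_simp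
    _ ≤ B * p^2 * Real.exp (-(a*ϱ'^(-b))) := mul_le_mul_of_nonneg_left h6 (by positivity)

end
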